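/- Let A be a von Neumann algebra acting on a complex Hilbert space H and let ω be a faithful normal state on A. Then there exists a unique one-parameter group (σ_t)_{t ∈ ℝ} of *-automorphisms of A (satisfying σ_{s+t} = σ_s ∘ σ_t and σ_0 = id, and such that for every A ∈ A and every normal state φ on A the map t ↦ φ(σ_t(A)) is continuous) such that ω is a (σ, 1)-KMS state on A. (Tomita–Takesaki theorem: existence and uniqueness of the modular automorphism group.) -/

import Mathlib

open scoped ComplexOrder InnerProductSpace

noncomputable section

variable {H : Type} [NormedAddCommGroup H] [InnerProductSpace ℂ H] [CompleteSpace H]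

/-- A state on a von Neumann algebra `A`: a linear functional `ω : A → ℂ` with
`ω(a*a) ≥ 0` for all `a ∈ A` and `ω(1) = 1`. -/
def IsStateOn (A : VonNeumannAlgebra H) (ω : ↥A.toStarSubalgebra →ₗ[ℂ] ℂ) : Prop :=
  (∀ a : ↥A.toStarSubalgebra, 0 ≤ ω (star a * a)) ∧ ω 1 = 1

/-- `ω` is faithful: `ω(a*a) = 0` implies `a = 0`. -/
def IsFaithfulState (A : VonNeumannAlgebra H) (ω : ↥A.toStarSubalgebra →ₗ[ℂ] ℂ) : Prop :=
  ∀ a : ↥A.toStarSubalgebra, ω (star a * a) = 0 → a = 0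

/-- `ω` is normal: there is a positive trace-class operator `ρ` on `H` with trace `1`
such that `ω(a) = Tr(ρ a)` for all `a ∈ A`.  The trace of the positive operator `ρ`, and
of `ρ ∘ a`, is expressed as the sum `∑ i, ⟪e i, (ρ ∘ a) (e i)⟫` over a Hilbert basis `e`. -/
def IsNormalState (A : VonNeumannAlgebra H) (ω : ↥A.toStarSubalgebra →ₗ[ℂ] ℂ) : Prop :=
  ∃ ρ : H →L[ℂ] H, ρ.IsPositive ∧
    ∃ (ι : Type) (e : HilbertBasis ι ℂ H),
      HasSum (fun i => ⟪e i, ρ (e i)⟫_ℂ) 1 ∧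
      ∀ a : ↥A.toStarSubalgebra,
        HasSum (fun i => ⟪e i, ρ ((a : H →L[ℂ] H) (e i))⟫_ℂ) (ω a)

/-- `σ` is a one-parameter group of *-endomorphisms of `A`
(hence of *-automorphisms, since each `σ t` is invertible with inverse `σ (-t)`). -/
def IsOneParamAutGroup (A : VonNeumannAlgebra H)
    (σ : ℝ → (↥A.toStarSubalgebra →⋆ₐ[ℂ] ↥A.toStarSubalgebra)) : Prop :=
  σ 0 = StarAlgHom.id ℂ ↥A.toStarSubalgebra ∧
    ∀ s t : ℝ, σ (s + t) = (σ s).comp (σ t)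

/-- `ω` is a `(σ, β)`-KMS state: for all `a, b ∈ A` there is a bounded continuous function
on the closed strip `0 ≤ Im z ≤ β`, holomorphic on the open strip `0 < Im z < β`, with
boundary values `f(t) = ω(b σ_t(a))` and `f(t + iβ) = ω(σ_t(a) b)`. -/
def IsKMSState (A : VonNeumannAlgebra H) (ω : ↥A.toStarSubalgebra →ₗ[ℂ] ℂ)
    (σ : ℝ → (↥A.toStarSubalgebra →⋆ₐ[ℂ] ↥A.toStarSubalgebra)) (β : ℝ) : Prop :=
  ∀ a b : ↥A.toStarSubalgebra, ∃ f : ℂ → ℂ,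
    (∃ C : ℝ, ∀ z : ℂ, 0 ≤ z.im → z.im ≤ β → ‖f z‖ ≤ C) ∧
    ContinuousOn f {z : ℂ | 0 ≤ z.im ∧ z.im ≤ β} ∧
    (∀ z : ℂ, 0 < z.im → z.im < β → DifferentiableAt ℂ f z) ∧
    (∀ t : ℝ, f (t : ℂ) = ω (b * σ t a)) ∧
    (∀ t : ℝ, f ((t : ℂ) + Complex.I * (β : ℂ)) = ω (σ t a * b))

/-- Bounded continuous functions on the closed strip `0 ≤ Im z ≤ 1`, holomorphic inside. -/
def IsStripFun (f : ℂ → ℂ) : Prop :=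
  (∃ C : ℝ, ∀ z : ℂ, 0 ≤ z.im → z.im ≤ 1 → ‖f z‖ ≤ C) ∧
    ContinuousOn f {z : ℂ | 0 ≤ z.im ∧ z.im ≤ 1} ∧
    (∀ z : ℂ, 0 < z.im → z.im < 1 → DifferentiableAt ℂ f z)

/-- The kernel `e^{-pt} / cosh (π t)`. -/
def stripKernel (p t : ℝ) : ℝ := Real.exp (-(p * t)) / Real.cosh (Real.pi * t)

theorem stripKernel_pos (p t : ℝ) : 0 < stripKernel p t :=
  div_pos (Real.exp_pos _) (Real.cosh_pos _)

theorem continuous_stripKernel (p : ℝ) : Continuous (stripKernel p) := by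
  unfold stripKernel
  refine Continuous.div (by fun_prop) (by fun_prop) fun t => (Real.cosh_pos _).ne'

theorem exp_abs_div_cosh_le {p : ℝ} (hp : |p| ≤ 1) (t : ℝ) :
    Real.exp (p * t) / Real.cosh (Real.pi * t) ≤ 2 * Real.exp (-(2 * |t|)) := by
  have h1 : Real.exp (Real.pi * |t|) ≤ 2 * Real.cosh (Real.pi * t) := by
    have : Real.cosh (Real.pi * t) = Real.cosh (Real.pi * |t|) := by
      rcases abs_cases t with h | h <;> simp [h.1]
    rw [this, Real.cosh_eq]
    have := Real.exp_pos (-(Real.pi * |t|))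
    linarith
  rw [div_le_iff₀ (Real.cosh_pos _)]
  have h2 : p * t ≤ |t| := by
    calc p * t ≤ |p * t| := le_abs_self _
      _ = |p| * |t| := abs_mul _ _
      _ ≤ 1 * |t| := by gcongr
      _ = |t| := one_mul _
  have h3 : Real.exp (p * t) ≤ Real.exp (-(2 * |t|)) * Real.exp (Real.pi * |t|) := by
    rw [← Real.exp_add]
    apply Real.exp_le_exp.2
    nlinarith [abs_nonneg t, Real.pi_gt_three]
  nlinarith [Real.exp_pos (-(2 * |t|))]

theorem exp_neg_abs_le (t : ℝ) : Real.exp (-|t|) ≤ 2 * (1 + t ^ 2)⁻¹ := by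
  have h := Real.quadratic_le_exp_of_nonneg (abs_nonneg t)
  rw [Real.exp_neg, ← div_eq_mul_inv, inv_eq_one_div, div_le_div_iff₀ (Real.exp_pos _) (by positivity)]
  have := sq_abs t
  nlinarith [abs_nonneg t]

theorem integrable_exp_neg_abs' : MeasureTheory.Integrable fun t : ℝ => Real.exp (-|t|) := by
  refine (integrable_inv_one_add_sq.const_mul 2).mono'
    (by fun_prop : Continuous fun t : ℝ => Real.exp (-|t|)).aestronglyMeasurable ?_
  filter_upwards with t
  rw [Real.norm_eq_abs, abs_of_pos (Real.exp_pos _)]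
  exact exp_neg_abs_le t

theorem stripKernel_le {p : ℝ} (hp : |p| ≤ 1) (t : ℝ) :
    stripKernel p t ≤ 2 * Real.exp (-|t|) := by
  have := exp_abs_div_cosh_le (p := -p) (by simpa using hp) t
  unfold stripKernel
  rw [← neg_mul]
  refine this.trans ?_
  have := Real.exp_le_exp.2 (show -(2 * |t|) ≤ -|t| by linarith [abs_nonneg t])
  linarith

theorem integrable_stripKernel_smul {E : Type*} [NormedAddCommGroup E] [NormedSpace ℝ E]
    {p : ℝ} (hp : |p| ≤ 1)
    {h : ℝ → E} (hc : Continuous h) {C : ℝ} (hb : ∀ t, ‖h t‖ ≤ C) :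
    MeasureTheory.Integrable fun t => stripKernel p t • h t := by
  refine (integrable_exp_neg_abs'.const_mul (2 * C)).mono'
    ((continuous_stripKernel p).smul hc).aestronglyMeasurable ?_
  filter_upwards with t
  rw [norm_smul, Real.norm_eq_abs, abs_of_pos (stripKernel_pos _ _)]
  have h1 := stripKernel_le hp t
  have h2 := (norm_nonneg _).trans (hb t)
  calc _ ≤ (2 * Real.exp (-|t|)) * C := by
        gcongr
        exact hb t
    _ = _ := by ring

theorem integrable_stripKernel {p : ℝ} (hp : |p| ≤ 1) :
    MeasureTheory.Integrable (stripKernel p) := by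
  simpa using integrable_stripKernel_smul hp (h := fun _ => (1 : ℝ)) continuous_const
    (C := 1) (by simp)

theorem integral_stripKernel_pos {p : ℝ} (hp : |p| ≤ 1) : 0 < ∫ t, stripKernel p t := by
  refine (MeasureTheory.integral_pos_iff_support_of_nonneg
    (fun t => (stripKernel_pos p t).le) (integrable_stripKernel hp)).2 ?_
  have : Function.support (stripKernel p) = Set.univ := by
    ext t; simpa using (stripKernel_pos p t).ne'
  simp [this]

theorem cosh_pi_mul_eq_zero {z : ℂ} (h0 : 0 ≤ z.im) (h1 : z.im ≤ 1)
    (h : Complex.cosh (Real.pi * z) = 0) : z = Complex.I / 2 := by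
  rw [← Complex.cos_mul_I, Complex.cos_eq_zero_iff] at h
  obtain ⟨k, hk⟩ := h
  have hpi : (Real.pi : ℂ) ≠ 0 := by exact_mod_cast Real.pi_ne_zero
  have hz : z * Complex.I = (2 * k + 1) / 2 := by
    apply mul_left_cancel₀ hpi
    rw [← mul_assoc, hk]; ring
  have hz2 : z = -((2 * k + 1) / 2) * Complex.I := by
    rw [← hz, neg_mul, mul_assoc, Complex.I_mul_I]; ring
  have him : z.im = -((2 * (k : ℝ) + 1) / 2) := by
    rw [hz2]; simp
  have hk1 : k = -1 := by
    rw [him] at h0 h1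
    have a1 : (k : ℝ) ≤ -1 / 2 := by linarith
    have a2 : (-3 / 2 : ℝ) ≤ k := by linarith
    have b1 : (k : ℝ) < 0 := by linarith
    have b2 : (-2 : ℝ) < k := by linarith
    have c1 : k < 0 := by exact_mod_cast b1
    have c2 : -2 < k := by exact_mod_cast b2
    omega
  rw [hz2, hk1]; push_cast; ring

theorem abs_sinh_le_norm_cosh (z : ℂ) : |Real.sinh z.re| ≤ ‖Complex.cosh z‖ := by
  have h : Complex.cosh z = (Real.cosh z.re * Real.cos z.im : ℝ) +
      (Real.sinh z.re * Real.sin z.im : ℝ) * Complex.I := by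
    conv_lhs => rw [← Complex.re_add_im z, Complex.cosh_add, Complex.cosh_mul_I, Complex.sinh_mul_I]
    push_cast; ring
  rw [← abs_norm, ← sq_le_sq, ← Complex.normSq_eq_norm_sq, h, Complex.normSq_add_mul_I]
  have := Real.cosh_sq z.re
  have := Real.sin_sq_add_cos_sq z.im
  nlinarith [sq_nonneg (Real.cos z.im), sq_nonneg (Real.sinh z.re)]

theorem sinh_pi_mul_ge {R : ℝ} (hR : 1 ≤ R) :
    Real.exp (2 * R) / 4 ≤ Real.sinh (Real.pi * R) := by
  rw [Real.sinh_eq]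
  have h1 : Real.exp (2 * R) ≤ Real.exp (Real.pi * R) :=
    Real.exp_le_exp.2 (by nlinarith [Real.pi_gt_three])
  have h2 : Real.exp (-(Real.pi * R)) ≤ 1 := Real.exp_le_one_iff.2 (by nlinarith [Real.pi_gt_three])
  have h3 : 2 ≤ Real.exp (2 * R) := by
    have := Real.add_one_le_exp (2 * R)
    linarith
  linarith

/-- The function `(f z - f (i/2)) e^{-pz} / cosh (π z)` with its singularity removed. -/
def stripQuot (p : ℝ) (f : ℂ → ℂ) (z : ℂ) : ℂ :=
  Complex.exp (-(p * z)) *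
    (dslope (fun z => f z - f (Complex.I / 2)) (Complex.I / 2) z /
      dslope (fun z => Complex.cosh (Real.pi * z)) (Complex.I / 2) z)

theorem cosh_pi_half : Complex.cosh (Real.pi * (Complex.I / 2)) = 0 := by
  rw [show (Real.pi * (Complex.I / 2) : ℂ) = (Real.pi / 2 : ℂ) * Complex.I by ring,
    Complex.cosh_mul_I, Complex.cos_pi_div_two]

theorem stripQuot_of_ne {p : ℝ} {f : ℂ → ℂ} {z : ℂ} (hz : z ≠ Complex.I / 2) :
    stripQuot p f z = Complex.exp (-(p * z)) *
      ((f z - f (Complex.I / 2)) / Complex.cosh (Real.pi * z)) := by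
  have hne : z - Complex.I / 2 ≠ 0 := sub_ne_zero.2 hz
  unfold stripQuot
  rw [dslope_of_ne _ hz, dslope_of_ne _ hz, slope_def_field, slope_def_field, cosh_pi_half,
    sub_self, sub_zero, sub_zero, div_div_div_cancel_right₀ hne]

theorem strip_mem_nhds : {z : ℂ | 0 ≤ z.im ∧ z.im ≤ 1} ∈ nhds (Complex.I / 2) := by
  have : IsOpen {z : ℂ | 0 < z.im ∧ z.im < 1} :=
    (isOpen_lt continuous_const Complex.continuous_im).inter
      (isOpen_lt Complex.continuous_im continuous_const)
  refine Filter.mem_of_superset (this.mem_nhds ?_) fun z hz => ⟨hz.1.le, hz.2.le⟩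
  constructor <;> norm_num

theorem isOpen_strip : IsOpen {z : ℂ | 0 < z.im ∧ z.im < 1} :=
  (isOpen_lt continuous_const Complex.continuous_im).inter
    (isOpen_lt Complex.continuous_im continuous_const)

theorem open_strip_mem_nhds : {z : ℂ | 0 < z.im ∧ z.im < 1} ∈ nhds (Complex.I / 2) :=
  isOpen_strip.mem_nhds (by constructor <;> norm_num)

theorem dslope_cosh_ne_zero {z : ℂ} (h0 : 0 ≤ z.im) (h1 : z.im ≤ 1) :
    dslope (fun z => Complex.cosh (Real.pi * z)) (Complex.I / 2) z ≠ 0 := by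
  by_cases hz : z = Complex.I / 2
  · subst hz
    rw [dslope_same]
    have hd : HasDerivAt (fun z : ℂ => Complex.cosh (Real.pi * z))
        (Complex.sinh (Real.pi * (Complex.I / 2)) * (Real.pi * 1)) (Complex.I / 2) :=
      ((hasDerivAt_id _).const_mul _).ccosh
    rw [hd.deriv, show (Real.pi * (Complex.I / 2) : ℂ) = (Real.pi / 2 : ℂ) * Complex.I by ring,
      Complex.sinh_mul_I, Complex.sin_pi_div_two]
    simp [Real.pi_ne_zero]
  · rw [dslope_of_ne _ hz, slope_def_field, cosh_pi_half, sub_zero]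
    exact div_ne_zero (fun h => hz (cosh_pi_mul_eq_zero h0 h1 h)) (sub_ne_zero.2 hz)

theorem continuousOn_stripQuot (p : ℝ) {f : ℂ → ℂ} (hf : IsStripFun f) :
    ContinuousOn (stripQuot p f) {z : ℂ | 0 ≤ z.im ∧ z.im ≤ 1} := by
  unfold stripQuot
  refine ContinuousOn.mul (by fun_prop) (ContinuousOn.div ?_ ?_ ?_)
  · refine (continuousOn_dslope strip_mem_nhds).2 ⟨hf.2.1.sub continuousOn_const, ?_⟩
    exact (hf.2.2 _ (by norm_num) (by norm_num)).sub_const _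
  · refine (continuousOn_dslope strip_mem_nhds).2 ⟨by fun_prop, by fun_prop⟩
  · exact fun z hz => dslope_cosh_ne_zero hz.1 hz.2

theorem differentiableOn_stripQuot (p : ℝ) {f : ℂ → ℂ} (hf : IsStripFun f) :
    DifferentiableOn ℂ (stripQuot p f) {z : ℂ | 0 < z.im ∧ z.im < 1} := by
  unfold stripQuot
  refine DifferentiableOn.mul (by fun_prop) (DifferentiableOn.div ?_ ?_ ?_)
  · refine (Complex.differentiableOn_dslope open_strip_mem_nhds).2 ?_
    exact fun z hz => ((hf.2.2 z hz.1 hz.2).sub_const _).differentiableWithinAt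
  · refine (Complex.differentiableOn_dslope open_strip_mem_nhds).2 (by fun_prop)
  · exact fun z hz => dslope_cosh_ne_zero hz.1.le hz.2.le

theorem norm_stripQuot_le {p : ℝ} (hp : |p| ≤ 1) {f : ℂ → ℂ} {C : ℝ}
    (hC : ∀ z : ℂ, 0 ≤ z.im → z.im ≤ 1 → ‖f z‖ ≤ C) {z : ℂ} (h0 : 0 ≤ z.im) (h1 : z.im ≤ 1)
    (hR : 1 ≤ |z.re|) : ‖stripQuot p f z‖ ≤ 8 * C * Real.exp (-|z.re|) := by
  have hz : z ≠ Complex.I / 2 := by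
    rintro rfl
    norm_num at hR
  have hC0 : 0 ≤ C := (norm_nonneg _).trans (hC z h0 h1)
  rw [stripQuot_of_ne hz, norm_mul, norm_div, Complex.norm_exp]
  have a1 : ‖f z - f (Complex.I / 2)‖ ≤ 2 * C := by
    refine (norm_sub_le _ _).trans ?_
    have := hC z h0 h1
    have := hC (Complex.I / 2) (by norm_num) (by norm_num)
    linarith
  have a2 : (-((p : ℂ) * z)).re ≤ |z.re| := by
    simp only [Complex.neg_re, Complex.mul_re, Complex.ofReal_re, Complex.ofReal_im, zero_mul,
      sub_zero]
    calc -(p * z.re) ≤ |p * z.re| := neg_le_abs _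
      _ = |p| * |z.re| := abs_mul _ _
      _ ≤ 1 * |z.re| := by gcongr
      _ = _ := one_mul _
  have a3 : Real.exp (2 * |z.re|) / 4 ≤ ‖Complex.cosh (Real.pi * z)‖ := by
    refine (sinh_pi_mul_ge hR).trans ?_
    have := abs_sinh_le_norm_cosh (Real.pi * z)
    simp only [Complex.mul_re, Complex.ofReal_re, Complex.ofReal_im, zero_mul, sub_zero] at this
    refine le_trans ?_ this
    rw [Real.abs_sinh, abs_mul, abs_of_pos Real.pi_pos]
  calc _ ≤ Real.exp |z.re| * ((2 * C) / (Real.exp (2 * |z.re|) / 4)) := by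
        gcongr
    _ = 8 * C * Real.exp (-|z.re|) := by
        rw [show 2 * |z.re| = |z.re| + |z.re| by ring, Real.exp_add, Real.exp_neg]
        field_simp
        ring

open Filter Topology MeasureTheory in
theorem tendsto_side_stripQuot {p : ℝ} (hp : |p| ≤ 1) {f : ℂ → ℂ} (hf : IsStripFun f)
    (s : ℝ) (hs : |s| = 1) :
    Tendsto (fun R : ℝ => ∫ y in (0 : ℝ)..1, stripQuot p f ((s * R : ℝ) + y * Complex.I)) atTop
      (𝓝 0) := by
  obtain ⟨C, hC⟩ := hf.1
  have hlim : Tendsto (fun R : ℝ => 8 * C * Real.exp (-R)) atTop (𝓝 0) := by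
    simpa using (Real.tendsto_exp_neg_atTop_nhds_zero.const_mul (8 * C))
  refine squeeze_zero_norm' ?_ hlim
  filter_upwards [eventually_ge_atTop 1] with R hR
  have := intervalIntegral.norm_integral_le_of_norm_le_const
    (f := fun y : ℝ => stripQuot p f ((s * R : ℝ) + y * Complex.I))
    (C := 8 * C * Real.exp (-R)) (a := 0) (b := 1) (fun y hy => by
      have hab : |s * R| = R := by rw [abs_mul, hs, one_mul, abs_of_pos (by linarith)]
      rw [Set.uIoc_of_le zero_le_one] at hy
      have := norm_stripQuot_le hp hC (z := (s * R : ℝ) + y * Complex.I)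
        (by simpa using hy.1.le) (by simpa using hy.2) (by simpa [hab] using hR)
      simpa [hab] using this)
  simpa using this

theorem cosh_pi_add_I (t : ℝ) : Complex.cosh (Real.pi * ((t : ℂ) + Complex.I)) =
    -(Real.cosh (Real.pi * t) : ℂ) := by
  rw [mul_add, Complex.cosh_add, Complex.cosh_mul_I, Complex.sinh_mul_I]
  simp

theorem stripQuot_bottom (p : ℝ) (f : ℂ → ℂ) (t : ℝ) :
    stripQuot p f t = stripKernel p t • (f t - f (Complex.I / 2)) := by
  rw [stripQuot_of_ne (by intro h; simpa using congrArg Complex.im h), Complex.real_smul,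
    stripKernel]
  push_cast
  ring

theorem stripQuot_top (p : ℝ) (f : ℂ → ℂ) (t : ℝ) :
    stripQuot p f (t + Complex.I) = -(stripKernel p t • (Complex.exp (-(p * Complex.I)) *
      (f (t + Complex.I) - f (Complex.I / 2)))) := by
  rw [stripQuot_of_ne (by intro h; have := congrArg Complex.im h; norm_num at this),
    Complex.real_smul, stripKernel, cosh_pi_add_I, mul_add, neg_add, Complex.exp_add]
  push_cast
  ring

theorem IsStripFun.continuous_bottom {f : ℂ → ℂ} (hf : IsStripFun f) :
    Continuous fun t : ℝ => f t :=
  hf.2.1.comp_continuous Complex.continuous_ofReal (by intro x; simp)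

theorem IsStripFun.continuous_top {f : ℂ → ℂ} (hf : IsStripFun f) :
    Continuous fun t : ℝ => f (t + Complex.I) :=
  hf.2.1.comp_continuous (by fun_prop) (by intro x; simp)

open Filter Topology MeasureTheory in
theorem IsStripFun.integral_sub_eq_zero {f : ℂ → ℂ} (hf : IsStripFun f) {p : ℝ} (hp : |p| ≤ 1) :
    ∫ t : ℝ, stripKernel p t • ((f t - f (Complex.I / 2)) + Complex.exp (-(p * Complex.I)) *
      (f (t + Complex.I) - f (Complex.I / 2))) = 0 := by
  obtain ⟨C, hC⟩ := hf.1
  set G : ℝ → ℂ := fun t => stripKernel p t • ((f t - f (Complex.I / 2)) +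
    Complex.exp (-(p * Complex.I)) * (f (t + Complex.I) - f (Complex.I / 2))) with hG
  have hGi : Integrable G := by
    refine integrable_stripKernel_smul hp (C := 4 * C) ?_ ?_
    · exact (hf.continuous_bottom.sub continuous_const).add
        (continuous_const.mul (hf.continuous_top.sub continuous_const))
    · intro t
      have e : ‖Complex.exp (-(p * Complex.I))‖ = 1 := by
        rw [Complex.norm_exp]; simp
      have h1 := hC t (by simp) (by simp)
      have h2 := hC (t + Complex.I) (by simp) (by simp)
      have h3 := hC (Complex.I / 2) (by norm_num) (by norm_num)
      calc _ ≤ (‖f t‖ + ‖f (Complex.I / 2)‖) + ‖Complex.exp (-(p * Complex.I))‖ *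
            (‖f (t + Complex.I)‖ + ‖f (Complex.I / 2)‖) := by
            refine (norm_add_le _ _).trans ?_
            rw [norm_mul]
            gcongr <;> exact norm_sub_le _ _
        _ ≤ 4 * C := by rw [e]; linarith
  have hlim := intervalIntegral_tendsto_integral hGi tendsto_neg_atTop_atBot tendsto_id
  refine tendsto_nhds_unique hlim ?_
  have key : ∀ R : ℝ, 0 ≤ R → ∫ t in (-R)..R, G t =
      Complex.I * (∫ y in (0 : ℝ)..1, stripQuot p f (((-1 : ℝ) * R : ℝ) + y * Complex.I)) -
      Complex.I * (∫ y in (0 : ℝ)..1, stripQuot p f (((1 : ℝ) * R : ℝ) + y * Complex.I)) := by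
    intro R hR
    have hrect := Complex.integral_boundary_rect_eq_zero_of_continuousOn_of_differentiableOn
      (stripQuot p f) (-R : ℝ) ((R : ℝ) + Complex.I) (by
        refine (continuousOn_stripQuot p hf).mono ?_
        intro z hz
        rw [Complex.mem_reProdIm] at hz
        simpa [Set.uIcc_of_le] using hz.2) (by
        refine (differentiableOn_stripQuot p hf).mono ?_
        intro z hz
        rw [Complex.mem_reProdIm] at hz
        simpa using hz.2)
    simp only [Complex.ofReal_re, Complex.add_re, Complex.I_re, add_zero, Complex.ofReal_im,
      Complex.ofReal_zero, zero_mul, Complex.add_im, Complex.I_im, zero_add, Complex.ofReal_one,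
      one_mul, smul_eq_mul] at hrect
    have hsum : ∫ t in (-R)..R, G t = (∫ x in (-R)..R, stripQuot p f x) -
        ∫ x in (-R)..R, stripQuot p f (x + Complex.I) := by
      rw [← intervalIntegral.integral_sub]
      · refine intervalIntegral.integral_congr fun t _ => ?_
        simp only [hG]
        rw [stripQuot_bottom, stripQuot_top, smul_add, sub_neg_eq_add]
      · exact ((continuousOn_stripQuot p hf).comp_continuous Complex.continuous_ofReal
          (by intro x; simp)).intervalIntegrable _ _
      · exact ((continuousOn_stripQuot p hf).comp_continuous (by fun_prop)
          (by intro x; simp)).intervalIntegrable _ _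
    rw [hsum]
    have e1 : ((((-1 : ℝ) * R : ℝ)) : ℂ) = ((-R : ℝ) : ℂ) := by simp
    have e2 : ((((1 : ℝ) * R : ℝ)) : ℂ) = (R : ℂ) := by simp
    rw [e1, e2]
    linear_combination hrect
  have hlim2 := ((tendsto_side_stripQuot hp hf (-1) (by simp)).const_mul Complex.I).sub
    ((tendsto_side_stripQuot hp hf 1 (by simp)).const_mul Complex.I)
  simp only [mul_zero, sub_zero] at hlim2
  refine hlim2.congr' ?_
  filter_upwards [eventually_ge_atTop 0] with R hR
  exact (key R hR).symm

/-- The normalisation constant of the kernel. -/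
def stripConst (p : ℝ) : ℝ := 2 * Real.cos (p / 2) * ∫ t, stripKernel p t

theorem stripConst_pos {p : ℝ} (hp : |p| ≤ 1) : 0 < stripConst p := by
  have h := integral_stripKernel_pos hp
  have : 0 < Real.cos (p / 2) := by
    apply Real.cos_pos_of_mem_Ioo
    rw [abs_le] at hp
    constructor <;> linarith [Real.pi_gt_three]
  unfold stripConst
  positivity

theorem exp_half_add (p : ℝ) : Complex.exp (p / 2 * Complex.I) + Complex.exp (-(p / 2 * Complex.I))
    = 2 * Real.cos (p / 2) := by
  rw [Complex.ofReal_cos, Complex.cos]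
  push_cast
  ring_nf

open MeasureTheory in
theorem IsStripFun.integral_eq {f : ℂ → ℂ} (hf : IsStripFun f) {p : ℝ} (hp : |p| ≤ 1) :
    ∫ t : ℝ, stripKernel p t • (Complex.exp (p / 2 * Complex.I) * f t +
      Complex.exp (-(p / 2 * Complex.I)) * f (t + Complex.I)) =
      stripConst p * f (Complex.I / 2) := by
  obtain ⟨C, hC⟩ := hf.1
  have h0 := hf.integral_sub_eq_zero hp
  have h1 : ∀ t : ℝ, stripKernel p t • (Complex.exp (p / 2 * Complex.I) * f t +
      Complex.exp (-(p / 2 * Complex.I)) * f (t + Complex.I)) =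
      Complex.exp (p / 2 * Complex.I) * (stripKernel p t • ((f t - f (Complex.I / 2)) +
        Complex.exp (-(p * Complex.I)) * (f (t + Complex.I) - f (Complex.I / 2)))) +
      (stripKernel p t : ℂ) * (2 * Real.cos (p / 2) * f (Complex.I / 2)) := by
    intro t
    rw [← exp_half_add]
    have : Complex.exp (-(p / 2 * Complex.I)) =
        Complex.exp (p / 2 * Complex.I) * Complex.exp (-(p * Complex.I)) := by
      rw [← Complex.exp_add]; ring_nf
    rw [this]
    simp only [Complex.real_smul]
    ring
  rw [integral_congr_ae (Filter.Eventually.of_forall h1), integral_add, integral_const_mul, h0,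
    mul_zero, zero_add, integral_mul_const, integral_complex_ofReal, stripConst]
  · push_cast; ring
  · refine Integrable.const_mul ?_ _
    refine integrable_stripKernel_smul hp (C := 4 * C) ?_ ?_
    · exact (hf.continuous_bottom.sub continuous_const).add
        (continuous_const.mul (hf.continuous_top.sub continuous_const))
    · intro t
      have e : ‖Complex.exp (-(p * Complex.I))‖ = 1 := by
        rw [Complex.norm_exp]; simp
      have h1 := hC t (by simp) (by simp)
      have h2 := hC (t + Complex.I) (by simp) (by simp)
      have h3 := hC (Complex.I / 2) (by norm_num) (by norm_num)
      calc _ ≤ (‖f t‖ + ‖f (Complex.I / 2)‖) + ‖Complex.exp (-(p * Complex.I))‖ *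
            (‖f (t + Complex.I)‖ + ‖f (Complex.I / 2)‖) := by
            refine (norm_add_le _ _).trans ?_
            rw [norm_mul]
            gcongr <;> exact norm_sub_le _ _
        _ ≤ 4 * C := by rw [e]; linarith
  · exact (integrable_stripKernel hp).ofReal.mul_const _

open Filter Topology MeasureTheory in
/-- The kernels `stripKernel p` separate bounded continuous functions. -/
theorem eq_zero_of_integral_stripKernel_eq_zero {h : ℝ → ℂ} (hc : Continuous h) {C : ℝ}
    (hb : ∀ t, ‖h t‖ ≤ C)
    (h0 : ∀ p : ℝ, |p| ≤ 1 → ∫ t, stripKernel p t • h t = 0) : h = 0 := by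
  have hC : 0 ≤ C := (norm_nonneg _).trans (hb 0)
  set g : ℝ → ℂ := fun t => (Real.cosh (Real.pi * t))⁻¹ • h t with hg
  have hgc : Continuous g := by
    have h1 : Continuous fun t : ℝ => (Real.cosh (Real.pi * t))⁻¹ :=
      Continuous.inv₀ (by fun_prop) fun t => (Real.cosh_pos _).ne'
    exact h1.smul hc
  set F : ℂ → ℝ → ℂ := fun w t => Complex.exp (-(w * t)) * g t with hF
  have hFc : ∀ w, Continuous (F w) := fun w => by
    simp only [hF]; fun_prop
  have hFb : ∀ w : ℂ, |w.re| ≤ 1 → ∀ t, ‖F w t‖ ≤ 2 * C * Real.exp (-(2 * |t|)) := by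
    intro w hw t
    have := exp_abs_div_cosh_le (p := -w.re) (by simpa using hw) t
    simp only [hF, hg, norm_mul, Complex.norm_exp, norm_smul, Complex.neg_re, Complex.mul_re,
      Complex.ofReal_re, Complex.ofReal_im, mul_zero, sub_zero, Real.norm_eq_abs]
    rw [abs_of_pos (inv_pos.2 (Real.cosh_pos _)), ← mul_assoc, ← div_eq_mul_inv, ← neg_mul]
    calc _ ≤ (2 * Real.exp (-(2 * |t|))) * C := by
          gcongr
          exact hb t
      _ = _ := by ring
  have hexp : ∀ t : ℝ, Real.exp (-(2 * |t|)) ≤ Real.exp (-|t|) := fun t =>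
    Real.exp_le_exp.2 (by linarith [abs_nonneg t])
  have htexp : ∀ t : ℝ, |t| * Real.exp (-(2 * |t|)) ≤ Real.exp (-|t|) := fun t => by
    rw [show -(2 * |t|) = -|t| + -|t| by ring, Real.exp_add, ← mul_assoc]
    have : |t| * Real.exp (-|t|) ≤ 1 := by
      rw [Real.exp_neg, ← div_eq_mul_inv, div_le_one (Real.exp_pos _)]
      linarith [Real.add_one_le_exp |t|]
    calc _ ≤ 1 * Real.exp (-|t|) := by gcongr
      _ = _ := one_mul _
  have hFi : ∀ w : ℂ, |w.re| ≤ 1 → Integrable (F w) := fun w hw => by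
    refine (integrable_exp_neg_abs'.const_mul (2 * C)).mono' (hFc w).aestronglyMeasurable ?_
    filter_upwards with t
    exact (hFb w hw t).trans (mul_le_mul_of_nonneg_left (hexp t) (by positivity))
  set U : Set ℂ := {w | |w.re| < 1} with hU
  have hUo : IsOpen U := isOpen_lt (by fun_prop) continuous_const
  have hUc : Convex ℝ U := by
    have : U = Complex.reLm ⁻¹' (Set.Ioo (-1) 1) := by
      ext w; simp [hU, abs_lt]
    rw [this]
    exact (convex_Ioo _ _).linear_preimage _
  have hd : DifferentiableOn ℂ (fun w => ∫ t, F w t) U := by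
    intro w hw
    refine DifferentiableAt.differentiableWithinAt ?_
    have := (hasDerivAt_integral_of_dominated_loc_of_deriv_le (μ := volume) (F := F)
      (F' := fun w t => (-(t : ℂ)) * F w t) (x₀ := w) (s := U)
      (bound := fun t => 2 * C * Real.exp (-|t|)) (hUo.mem_nhds hw)
      (Eventually.of_forall fun w => (hFc w).aestronglyMeasurable)
      (hFi w (le_of_lt hw)) ?_ ?_ (integrable_exp_neg_abs'.const_mul (2 * C)) ?_).2
    · exact this.differentiableAt
    · exact ((by fun_prop : Continuous fun t : ℝ => (-(t : ℂ))).mul (hFc w)).aestronglyMeasurable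
    · filter_upwards with t x hx
      rw [norm_mul, norm_neg, Complex.norm_real, Real.norm_eq_abs]
      calc _ ≤ |t| * (2 * C * Real.exp (-(2 * |t|))) := by
            gcongr
            exact hFb x (le_of_lt hx) t
        _ = 2 * C * (|t| * Real.exp (-(2 * |t|))) := by ring
        _ ≤ _ := by
            gcongr
            exact htexp t
    · filter_upwards with t x hx
      have h1 : HasDerivAt (fun x : ℂ => -(x * t)) (-(t : ℂ)) x := by
        have := ((hasDerivAt_id x).mul_const (t : ℂ)).neg
        rw [one_mul] at this
        exact this
      have := (h1.cexp).mul_const (g t)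
      refine this.congr_deriv ?_
      simp only [F]; ring
  have hzero : Set.EqOn (fun w => ∫ t, F w t) 0 U := by
    refine (hd.analyticOnNhd hUo).eqOn_zero_of_preconnected_of_frequently_eq_zero
      hUc.isPreconnected (z₀ := 0) (by simp [hU]) ?_
    have hreal : ∀ p : ℝ, |p| ≤ 1 → ∫ t, F p t = 0 := by
      intro p hp
      rw [← h0 p hp]
      refine integral_congr_ae (Eventually.of_forall fun t => ?_)
      simp only [hF, hg, stripKernel, Complex.real_smul]
      push_cast
      rw [div_eq_mul_inv, mul_assoc]
    have ht : Tendsto (fun n : ℕ => ((1 / ((n : ℝ) + 1) : ℝ) : ℂ)) atTop (𝓝[≠] 0) := by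
      refine tendsto_nhdsWithin_iff.2 ⟨?_, ?_⟩
      · have := (Complex.continuous_ofReal.tendsto 0).comp tendsto_one_div_add_atTop_nhds_zero_nat
        simpa [Function.comp_def] using this
      · refine Eventually.of_forall fun n => ?_
        simp only [Set.mem_compl_iff, Set.mem_singleton_iff, Complex.ofReal_eq_zero]
        positivity
    refine ht.frequently (Frequently.of_forall fun n => hreal _ ?_)
    rw [abs_of_pos (by positivity), div_le_one (by positivity)]
    linarith [(Nat.cast_nonneg n : (0 : ℝ) ≤ n)]
  have hgi : Integrable g := by
    have := hFi 0 (by simp)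
    simpa [hF] using this
  have hfour : FourierTransform.fourier g = 0 := by
    ext ξ
    rw [Real.fourier_real_eq_integral_exp_smul]
    have := hzero (x := ((2 * Real.pi * ξ : ℝ) : ℂ) * Complex.I) (by simp [hU])
    simp only [Pi.zero_apply] at this ⊢
    rw [← this]
    refine integral_congr_ae (Eventually.of_forall fun t => ?_)
    simp only [hF, smul_eq_mul]
    congr 2
    push_cast; ring
  have hinv := hgc.fourierInv_fourier_eq hgi (by rw [hfour]; exact integrable_zero _ _ _)
  ext t
  have h1 : g t = 0 := by
    rw [← hinv, hfour, Real.fourierInv_eq]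
    simp
  simp only [hg, smul_eq_zero, inv_eq_zero, (Real.cosh_pos _).ne', false_or] at h1
  simpa using h1

theorem IsStripFun.sub_const {f : ℂ → ℂ} (hf : IsStripFun f) (c : ℂ) :
    IsStripFun fun z => f z - c := by
  obtain ⟨⟨C, hC⟩, h2, h3⟩ := hf
  refine ⟨⟨C + ‖c‖, fun z hz hz' => (norm_sub_le _ _).trans ?_⟩, h2.sub continuousOn_const,
    fun z hz hz' => (h3 z hz hz').sub_const c⟩
  linarith [hC z hz hz']

/-- A strip function with equal boundary values is constant. -/
theorem IsStripFun.eq_const_of_periodic {f : ℂ → ℂ} (hf : IsStripFun f)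
    (h : ∀ t : ℝ, f (t + Complex.I) = f t) (t : ℝ) : f t = f (Complex.I / 2) := by
  have hg := hf.sub_const (f (Complex.I / 2))
  obtain ⟨C, hC⟩ := hg.1
  have := eq_zero_of_integral_stripKernel_eq_zero (hg.continuous_bottom) (C := C)
    (fun t => hC t (by simp) (by simp)) (fun p hp => by
      have h1 := hg.integral_eq hp
      simp only [sub_self, mul_zero] at h1
      have hcos : ((2 * Real.cos (p / 2) : ℝ) : ℂ) ≠ 0 := by
        rw [Complex.ofReal_ne_zero]
        have : 0 < Real.cos (p / 2) := by
          apply Real.cos_pos_of_mem_Ioo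
          rw [abs_le] at hp
          constructor <;> linarith [Real.pi_gt_three]
        positivity
      apply mul_left_cancel₀ hcos
      rw [mul_zero, ← h1, ← MeasureTheory.integral_const_mul]
      refine MeasureTheory.integral_congr_ae (Filter.Eventually.of_forall fun t => ?_)
      simp only [Complex.real_smul, h t]
      rw [← add_mul, exp_half_add]
      push_cast; ring)
  have := congrFun this t
  simpa [sub_eq_zero] using this

/-- Three lines theorem for strip functions. -/
theorem IsStripFun.norm_le_of_boundary {f : ℂ → ℂ} (hf : IsStripFun f) {C : ℝ}
    (h0 : ∀ t : ℝ, ‖f t‖ ≤ C) (h1 : ∀ t : ℝ, ‖f (t + Complex.I)‖ ≤ C) {z : ℂ}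
    (hz0 : 0 ≤ z.im) (hz1 : z.im ≤ 1) : ‖f z‖ ≤ C := by
  obtain ⟨D, hD⟩ := hf.1
  refine PhragmenLindelof.horizontal_strip (a := 0) (b := 1) (f := f) ?_ ?_ ?_ ?_ hz0 hz1
  · refine ⟨fun z hz => (hf.2.2 z hz.1 hz.2).differentiableWithinAt, hf.2.1.mono ?_⟩
    have : IsClosed {z : ℂ | 0 ≤ z.im ∧ z.im ≤ 1} :=
      (isClosed_le continuous_const Complex.continuous_im).inter
        (isClosed_le Complex.continuous_im continuous_const)
    refine closure_minimal ?_ this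
    intro z hz
    exact ⟨hz.1.le, hz.2.le⟩
  · refine ⟨0, by positivity, 0, ?_⟩
    refine Asymptotics.IsBigO.of_bound (max D 0) ?_
    rw [Filter.eventually_inf_principal]
    refine Filter.Eventually.of_forall fun z hz => ?_
    simp only [zero_mul, Real.exp_zero, norm_one, mul_one]
    exact (hD z hz.1.le hz.2.le).trans (le_max_left _ _)
  · intro z hz
    have : z = (z.re : ℂ) := by
      apply Complex.ext <;> simp [hz]
    rw [this]; exact h0 _
  · intro z hz
    have : z = (z.re : ℂ) + Complex.I := by
      apply Complex.ext <;> simp [hz]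
    rw [this]; exact h1 _

theorem IsStripFun.sub {f g : ℂ → ℂ} (hf : IsStripFun f) (hg : IsStripFun g) :
    IsStripFun fun z => f z - g z := by
  obtain ⟨⟨C, hC⟩, h2, h3⟩ := hf
  obtain ⟨⟨C', hC'⟩, h2', h3'⟩ := hg
  exact ⟨⟨C + C', fun z hz hz' => (norm_sub_le _ _).trans
    (add_le_add (hC z hz hz') (hC' z hz hz'))⟩, h2.sub h2',
    fun z hz hz' => (h3 z hz hz').sub (h3' z hz hz')⟩

open Filter Topology in
/-- If strip functions converge uniformly on the boundary, the boundary limit extends to a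
strip function. -/
theorem exists_isStripFun_of_tendsto {f : ℕ → ℂ → ℂ} (hf : ∀ n, IsStripFun (f n))
    {a b : ℝ → ℂ} {ε : ℕ → ℝ} (hε : Tendsto ε atTop (𝓝 0))
    (h0 : ∀ n (t : ℝ), ‖f n t - a t‖ ≤ ε n)
    (h1 : ∀ n (t : ℝ), ‖f n (t + Complex.I) - b t‖ ≤ ε n) :
    ∃ F : ℂ → ℂ, IsStripFun F ∧ (∀ t : ℝ, F t = a t) ∧ ∀ t : ℝ, F (t + Complex.I) = b t := by
  set S : Set ℂ := {z : ℂ | 0 ≤ z.im ∧ z.im ≤ 1} with hS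
  have hdist : ∀ m n, ∀ z ∈ S, ‖f m z - f n z‖ ≤ ε m + ε n := by
    intro m n z hz
    refine ((hf m).sub (hf n)).norm_le_of_boundary ?_ ?_ hz.1 hz.2
    · intro t
      have e : f m t - f n t = (f m t - a t) - (f n t - a t) := by ring
      rw [e]
      exact (norm_sub_le _ _).trans (add_le_add (h0 m t) (h0 n t))
    · intro t
      have e : f m (t + Complex.I) - f n (t + Complex.I) =
        (f m (t + Complex.I) - b t) - (f n (t + Complex.I) - b t) := by ring
      rw [e]
      exact (norm_sub_le _ _).trans (add_le_add (h1 m t) (h1 n t))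
  have hlim : ∀ z, ∃ w, z ∈ S → Tendsto (fun n => f n z) atTop (𝓝 w) := by
    intro z
    by_cases hz : z ∈ S
    · have : CauchySeq fun n => f n z := by
        rw [Metric.cauchySeq_iff]
        intro δ hδ
        obtain ⟨N, hN⟩ := Filter.eventually_atTop.1
          (hε.eventually (gt_mem_nhds (half_pos hδ)))
        refine ⟨N, fun m hm n hn => ?_⟩
        rw [dist_eq_norm]
        linarith [hdist m n z hz, hN m hm, hN n hn]
      obtain ⟨w, hw⟩ := cauchySeq_tendsto_of_complete this
      exact ⟨w, fun _ => hw⟩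
    · exact ⟨0, fun h => absurd h hz⟩
  choose F hF using hlim
  have hunif : ∀ n, ∀ z ∈ S, ‖f n z - F z‖ ≤ ε n := by
    intro n z hz
    have t1 : Tendsto (fun m => ‖f n z - f m z‖) atTop (𝓝 ‖f n z - F z‖) :=
      (tendsto_const_nhds.sub (hF z hz)).norm
    have t2 : Tendsto (fun m => ε n + ε m) atTop (𝓝 (ε n + 0)) := tendsto_const_nhds.add hε
    rw [add_zero] at t2
    exact le_of_tendsto_of_tendsto' t1 t2 fun m => hdist n m z hz
  have hTU : TendstoUniformlyOn f F atTop S := by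
    rw [Metric.tendstoUniformlyOn_iff]
    intro δ hδ
    filter_upwards [hε.eventually (gt_mem_nhds hδ)] with n hn z hz
    rw [dist_comm, dist_eq_norm]
    exact (hunif n z hz).trans_lt hn
  have hcont : ContinuousOn F S :=
    hTU.continuousOn (Frequently.of_forall fun n => (hf n).2.1)
  have hopen : IsOpen {z : ℂ | 0 < z.im ∧ z.im < 1} :=
    (isOpen_lt continuous_const Complex.continuous_im).inter
      (isOpen_lt Complex.continuous_im continuous_const)
  have hdiff : DifferentiableOn ℂ F {z : ℂ | 0 < z.im ∧ z.im < 1} := by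
    refine TendstoLocallyUniformlyOn.differentiableOn (φ := atTop) (F := f)
      (hTU.mono ?_).tendstoLocallyUniformlyOn ?_ hopen
    · intro z hz; exact ⟨hz.1.le, hz.2.le⟩
    · exact Eventually.of_forall fun n z hz =>
        ((hf n).2.2 z hz.1 hz.2).differentiableWithinAt
  refine ⟨F, ⟨?_, hcont, fun z hz hz' => hdiff.differentiableAt (hopen.mem_nhds ⟨hz, hz'⟩)⟩,
    ?_, ?_⟩
  · obtain ⟨D, hD⟩ := (hf 0).1
    refine ⟨D + ε 0, fun z hz hz' => ?_⟩
    have e : F z = f 0 z - (f 0 z - F z) := by ring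
    rw [e]
    exact (norm_sub_le _ _).trans (add_le_add (hD z hz hz') (hunif 0 z ⟨hz, hz'⟩))
  · intro t
    refine tendsto_nhds_unique (hF t ⟨by simp, by simp⟩) ?_
    exact tendsto_iff_norm_sub_tendsto_zero.2
      (squeeze_zero (fun _ => norm_nonneg _) (fun n => h0 n t) hε)
  · intro t
    refine tendsto_nhds_unique (hF (t + Complex.I) ⟨by simp, by simp⟩) ?_
    exact tendsto_iff_norm_sub_tendsto_zero.2
      (squeeze_zero (fun _ => norm_nonneg _) (fun n => h1 n t) hε)

section Intertwine

variable {E : Type*} [NormedAddCommGroup E] [InnerProductSpace ℂ E] [CompleteSpace E]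

theorem intertwine_pow {B : E →L[ℝ] E} {X Y : E →L[ℂ] E} (h : ∀ v, B (X v) = Y (B v)) (n : ℕ)
    (v : E) : B ((X ^ n) v) = (Y ^ n) (B v) := by
  induction n generalizing v with
  | zero => rfl
  | succ n ih => rw [pow_succ, pow_succ, mul_apply_eq_comp, ih, h]; rfl

theorem intertwine_aeval {B : E →L[ℝ] E} {X Y : E →L[ℂ] E} (h : ∀ v, B (X v) = Y (B v))
    (q : Polynomial ℝ) (v : E) :
    B ((Polynomial.aeval X q) v) = (Polynomial.aeval Y q) (B v) := by
  induction q using Polynomial.induction_on' with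
  | add p q hp hq => simp [hp, hq]
  | monomial n a =>
    simp only [Polynomial.aeval_monomial, mul_apply_eq_comp,
      Algebra.algebraMap_eq_smul_one, smul_apply,
      one_apply_eq_self, map_smul, intertwine_pow h]

open Filter Topology in
theorem intertwine_exp {B : E →L[ℝ] E} {X Y : E →L[ℂ] E} (h : ∀ v, B (X v) = Y (B v)) (v : E) :
    B (NormedSpace.exp X v) = NormedSpace.exp Y (B v) := by
  have h1 := (NormedSpace.exp_series_hasSum_exp' (𝕂 := ℝ) X).mapL
    ((ContinuousLinearMap.apply ℂ E v).restrictScalars ℝ)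
  have h2 := (NormedSpace.exp_series_hasSum_exp' (𝕂 := ℝ) Y).mapL
    ((ContinuousLinearMap.apply ℂ E (B v)).restrictScalars ℝ)
  have h3 := h1.mapL B
  refine h3.unique (Eq.mp (congrArg (fun F => HasSum F _) (funext fun n => Eq.symm ?_)) h2)
  change B (((n.factorial : ℝ)⁻¹) • (X ^ n) v) = ((n.factorial : ℝ)⁻¹) • (Y ^ n) (B v)
  rw [map_smul, intertwine_pow h]

theorem exists_polynomial_cfc_near {X Y : E →L[ℂ] E} (hX : IsSelfAdjoint X)
    (hY : IsSelfAdjoint Y) {f : ℝ → ℝ} (hf : Continuous f) {ε : ℝ} (hε : 0 < ε) :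
    ∃ q : Polynomial ℝ, ‖cfc f X - Polynomial.aeval X q‖ ≤ ε ∧
      ‖cfc f Y - Polynomial.aeval Y q‖ ≤ ε := by
  obtain ⟨R, hR⟩ := ((spectrum.isCompact (𝕜 := ℝ) X).union
    (spectrum.isCompact (𝕜 := ℝ) Y)).isBounded.subset_closedBall 0
  obtain ⟨q, hq⟩ := exists_polynomial_near_of_continuousOn (-R) R f hf.continuousOn ε hε
  have key : ∀ x ∈ Metric.closedBall (0 : ℝ) R, ‖f x - q.eval x‖ ≤ ε := by
    intro x hx
    rw [Real.closedBall_eq_Icc] at hx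
    have := hq x (by simpa using hx)
    rw [Real.norm_eq_abs, abs_sub_comm]
    exact this.le
  refine ⟨q, ?_, ?_⟩
  · rw [← cfc_polynomial q X, ← cfc_sub f q.eval X hf.continuousOn (by fun_prop)]
    exact norm_cfc_le hε.le fun x hx => key x (hR (Or.inl hx))
  · rw [← cfc_polynomial q Y, ← cfc_sub f q.eval Y hf.continuousOn (by fun_prop)]
    exact norm_cfc_le hε.le fun x hx => key x (hR (Or.inr hx))

theorem intertwine_cfc {B : E →L[ℝ] E} {X Y : E →L[ℂ] E} (hX : IsSelfAdjoint X)
    (hY : IsSelfAdjoint Y) (h : ∀ v, B (X v) = Y (B v)) {f : ℝ → ℝ} (hf : Continuous f) (v : E) :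
    B (cfc f X v) = cfc f Y (B v) := by
  rw [← sub_eq_zero, ← norm_le_zero_iff]
  refine le_of_forall_pos_le_add fun ε hε => ?_
  rw [zero_add]
  set D : ℝ := ‖B‖ * ‖v‖ + ‖B v‖ + 1 with hD
  have hDp : 0 < D := by positivity
  obtain ⟨q, h1, h2⟩ := exists_polynomial_cfc_near hX hY hf (div_pos hε hDp)
  have e : B (cfc f X v) - cfc f Y (B v) =
      B ((cfc f X - Polynomial.aeval X q) v) - (cfc f Y - Polynomial.aeval Y q) (B v) := by
    simp [intertwine_aeval h]
  rw [e]
  calc _ ≤ ‖B‖ * (ε / D * ‖v‖) + ε / D * ‖B v‖ := by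
        refine (norm_sub_le _ _).trans (add_le_add ?_ ?_)
        · refine (B.le_opNorm _).trans ?_
          gcongr
          exact (ContinuousLinearMap.le_opNorm _ _).trans (by gcongr)
        · exact (ContinuousLinearMap.le_opNorm _ _).trans (by gcongr)
    _ = ε / D * (D - 1) := by rw [hD]; ring
    _ ≤ ε / D * D := by
        have := div_pos hε hDp
        nlinarith
    _ = ε := by field_simp

/-- Bundled complex-linear operators as real-linear ones. -/
theorem commute_cfc_apply {B X : E →L[ℂ] E} (hX : IsSelfAdjoint X)
    (h : ∀ v, B (X v) = X (B v)) {f : ℝ → ℝ} (hf : Continuous f) (v : E) :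
    B (cfc f X v) = cfc f X (B v) :=
  intertwine_cfc (B := B.restrictScalars ℝ) hX hX h hf v

end Intertwine

/-- The data attached to a standard real subspace, in bounded form. -/
structure IsModularPair {E : Type*} [NormedAddCommGroup E] [InnerProductSpace ℂ E]
    [CompleteSpace E] (P : E →L[ℂ] E) (K : E →L[ℝ] E) : Prop where
  nonneg : 0 ≤ P
  le_one : P ≤ 1
  inj : ∀ v, P v = 0 → v = 0
  inj' : ∀ v, P v = v → v = 0
  conj_smul : ∀ v, K (Complex.I • v) = -(Complex.I • K v)
  inner_comm : ∀ a b, ⟪a, K b⟫_ℂ = ⟪b, K a⟫_ℂ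
  apply_P : ∀ v, K (P v) = K v - P (K v)
  apply_apply : ∀ v, K (K v) = P (v - P v)

/-- The function whose functional calculus is the truncated logarithm of the modular operator. -/
def modLogFun (n : ℕ) (x : ℝ) : ℝ :=
  Real.log (max (1 - x) (1 / (n + 1))) - Real.log (max x (1 / (n + 1)))

/-- A cutoff away from the endpoints of `[0, 1]`. -/
def cutoffFun (n : ℕ) (x : ℝ) : ℝ := max 0 (min 1 ((n + 1) * (x * (1 - x)) - 1))

theorem continuous_modLogFun (n : ℕ) : Continuous (modLogFun n) := by
  have hp : (0 : ℝ) < 1 / (n + 1) := by positivity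
  unfold modLogFun
  refine Continuous.sub (Continuous.log (by fun_prop) fun x => ?_)
    (Continuous.log (by fun_prop) fun x => ?_)
  · exact (lt_max_of_lt_right hp).ne'
  · exact (lt_max_of_lt_right hp).ne'

theorem continuous_cutoffFun (n : ℕ) : Continuous (cutoffFun n) := by
  unfold cutoffFun; fun_prop

theorem modLogFun_one_sub (n : ℕ) (x : ℝ) : modLogFun n (1 - x) = -modLogFun n x := by
  unfold modLogFun
  rw [sub_sub_cancel]; ring

theorem cutoffFun_one_sub (n : ℕ) (x : ℝ) : cutoffFun n (1 - x) = cutoffFun n x := by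
  unfold cutoffFun
  rw [sub_sub_cancel, mul_comm x]

theorem lt_of_cutoffFun_ne_zero {n : ℕ} {x : ℝ} (h0 : 0 ≤ x) (h1 : x ≤ 1)
    (h : cutoffFun n x ≠ 0) : 1 / ((n : ℝ) + 1) < x ∧ 1 / ((n : ℝ) + 1) < 1 - x := by
  have h2 : 0 < (n + 1) * (x * (1 - x)) - 1 := by
    by_contra hc
    push Not at hc
    exact h (max_eq_left ((min_le_right _ _).trans hc))
  have hn : (0 : ℝ) < n + 1 := by positivity
  have h3 : 1 / ((n : ℝ) + 1) < x * (1 - x) := by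
    rw [div_lt_iff₀ hn]; linarith
  constructor <;> nlinarith

theorem modLogFun_eq {n m : ℕ} (hnm : n ≤ m) {x : ℝ} (h0 : 0 ≤ x) (h1 : x ≤ 1)
    (h : cutoffFun n x ≠ 0) : modLogFun m x = Real.log (1 - x) - Real.log x := by
  obtain ⟨h2, h3⟩ := lt_of_cutoffFun_ne_zero h0 h1 h
  have h4 : 1 / ((m : ℝ) + 1) ≤ 1 / ((n : ℝ) + 1) := by
    have : (n : ℝ) ≤ m := by exact_mod_cast hnm
    gcongr
  unfold modLogFun
  rw [max_eq_left (by linarith), max_eq_left (by linarith)]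

theorem abs_one_sub_cutoffFun_mul_le {n : ℕ} {x : ℝ} (h0 : 0 ≤ x) (h1 : x ≤ 1) :
    |(1 - cutoffFun n x) * (x * (1 - x))| ≤ 2 / ((n : ℝ) + 1) := by
  have hn : (0 : ℝ) < n + 1 := by positivity
  have hw : 0 ≤ x * (1 - x) := mul_nonneg h0 (by linarith)
  have c0 : 0 ≤ cutoffFun n x := le_max_left _ _
  have c1 : cutoffFun n x ≤ 1 := max_le zero_le_one (min_le_left _ _)
  rw [abs_of_nonneg (mul_nonneg (by linarith) hw)]
  by_cases hc : 2 ≤ (n + 1) * (x * (1 - x))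
  · have : cutoffFun n x = 1 := by
      unfold cutoffFun
      rw [min_eq_left (by linarith), max_eq_right zero_le_one]
    rw [this]; simp; positivity
  · push Not at hc
    have : x * (1 - x) ≤ 2 / ((n : ℝ) + 1) := by
      rw [le_div_iff₀ hn]; linarith
    nlinarith

theorem abs_cutoffFun_le_one (n : ℕ) (x : ℝ) : |cutoffFun n x| ≤ 1 := by
  have c0 : 0 ≤ cutoffFun n x := le_max_left _ _
  rw [abs_of_nonneg c0]
  exact max_le zero_le_one (min_le_left _ _)

section ModularOperators

variable {E : Type*} [NormedAddCommGroup E] [InnerProductSpace ℂ E] [CompleteSpace E]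

theorem denseRange_of_isSelfAdjoint {X : E →L[ℂ] E} (hX : IsSelfAdjoint X)
    (h : ∀ v, X v = 0 → v = 0) : DenseRange X := by
  have h1 : (LinearMap.range (X : E →ₗ[ℂ] E))ᗮ = ⊥ := by
    rw [eq_bot_iff]
    intro v hv
    refine h v ?_
    have h2 : ⟪X (X v), v⟫_ℂ = 0 := (Submodule.mem_orthogonal _ _).1 hv _ ⟨X v, rfl⟩
    have h3 : ⟪X v, X v⟫_ℂ = 0 := by
      rw [← h2, ← ContinuousLinearMap.adjoint_inner_left, ← ContinuousLinearMap.star_eq_adjoint,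
        hX.star_eq]
    exact inner_self_eq_zero.1 h3
  have h2 := (Submodule.topologicalClosure_eq_top_iff).2 h1
  intro v
  have h3 : v ∈ (LinearMap.range (X : E →ₗ[ℂ] E)).topologicalClosure := by rw [h2]; trivial
  exact h3

theorem inner_apply_comm_of_isSelfAdjoint {X : E →L[ℂ] E} (hX : IsSelfAdjoint X) (a b : E) :
    ⟪X a, b⟫_ℂ = ⟪a, X b⟫_ℂ := by
  rw [← ContinuousLinearMap.adjoint_inner_right, ← ContinuousLinearMap.star_eq_adjoint,
    hX.star_eq]

theorem cfc_apply_of_eigen {X : E →L[ℂ] E} (hX : IsSelfAdjoint X) {v : E} {r : ℝ}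
    (hv : X v = (r : ℂ) • v) {f : ℝ → ℝ} (hf : Continuous f) : cfc f X v = (f r : ℂ) • v := by
  set B : E →L[ℂ] E := (innerSL ℂ v).smulRight v with hB
  have hBa : ∀ a, B a = ⟪v, a⟫_ℂ • v := fun a => by simp [hB]
  have h1 : ∀ a, B.restrictScalars ℝ (X a) =
      (algebraMap ℝ (E →L[ℂ] E) r) (B.restrictScalars ℝ a) := by
    intro a
    change B (X a) = (algebraMap ℝ (E →L[ℂ] E) r) (B a)
    rw [hBa, hBa, ← inner_apply_comm_of_isSelfAdjoint hX, hv, Algebra.algebraMap_eq_smul_one,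
      inner_smul_left, smul_apply, one_apply_eq_self, Complex.conj_ofReal, mul_smul]
    simp
  refine ext_inner_right ℂ fun a => ?_
  have h2 := intertwine_cfc hX (IsSelfAdjoint.algebraMap (E →L[ℂ] E) (IsSelfAdjoint.all r)) h1 hf a
  change B (cfc f X a) = (cfc f (algebraMap ℝ (E →L[ℂ] E) r)) (B a) at h2
  rw [cfc_algebraMap, hBa, hBa, Algebra.algebraMap_eq_smul_one, smul_apply,
    one_apply_eq_self] at h2
  rw [inner_apply_comm_of_isSelfAdjoint (cfc_predicate f X), inner_smul_left,
    Complex.conj_ofReal]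
  by_cases h0 : v = 0
  · simp [h0]
  have h3 : (⟪v, cfc f X a⟫_ℂ - (f r : ℂ) * ⟪v, a⟫_ℂ) • v = 0 := by
    rw [sub_smul, h2, mul_smul, sub_eq_zero]
    simp
  exact sub_eq_zero.1 ((smul_eq_zero.1 h3).resolve_right h0)

/-- The operator `(P (1 - P)) ^ (1/2)`. -/
def modSqrt (P : E →L[ℂ] E) : E →L[ℂ] E := cfc (fun x : ℝ => √(x * (1 - x))) P

/-- Truncated logarithm of the modular operator `(1 - P) / P`. -/
def modLog (P : E →L[ℂ] E) (n : ℕ) : E →L[ℂ] E := cfc (modLogFun n) P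

/-- Spectral cutoffs. -/
def cutoff (P : E →L[ℂ] E) (n : ℕ) : E →L[ℂ] E := cfc (cutoffFun n) P

/-- Truncated complex powers of the modular operator. -/
def modExp (P : E →L[ℂ] E) (n : ℕ) (z : ℂ) : E →L[ℂ] E := NormedSpace.exp (z • modLog P n)

theorem isSelfAdjoint_modSqrt (P : E →L[ℂ] E) : IsSelfAdjoint (modSqrt P) := cfc_predicate _ P

theorem isSelfAdjoint_modLog (P : E →L[ℂ] E) (n : ℕ) : IsSelfAdjoint (modLog P n) :=
  cfc_predicate _ P

theorem continuous_sqrt_mul_one_sub : Continuous fun x : ℝ => √(x * (1 - x)) := by fun_prop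

theorem modExp_add (P : E →L[ℂ] E) (n : ℕ) (z w : ℂ) (v : E) :
    modExp P n (z + w) v = modExp P n z (modExp P n w v) := by
  have hc : Commute (z • modLog P n) (w • modLog P n) :=
    ((Commute.refl (modLog P n)).smul_left z).smul_right w
  letI : NormedAlgebra ℚ (E →L[ℂ] E) := NormedAlgebra.restrictScalars ℚ ℂ (E →L[ℂ] E)
  unfold modExp
  rw [add_smul, NormedSpace.exp_add_of_commute hc]
  rfl

theorem modExp_zero (P : E →L[ℂ] E) (n : ℕ) (v : E) : modExp P n 0 v = v := by
  simp [modExp]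

theorem star_modExp (P : E →L[ℂ] E) (n : ℕ) (z : ℂ) :
    star (modExp P n z) = modExp P n (starRingEnd ℂ z) := by
  unfold modExp
  rw [NormedSpace.star_exp, star_smul, (isSelfAdjoint_modLog P n).star_eq]
  rfl

theorem modExp_inner (P : E →L[ℂ] E) (n : ℕ) (z : ℂ) (a b : E) :
    ⟪modExp P n z a, b⟫_ℂ = ⟪a, modExp P n (starRingEnd ℂ z) b⟫_ℂ := by
  rw [← star_modExp, ContinuousLinearMap.star_eq_adjoint,
    ContinuousLinearMap.adjoint_inner_right]

theorem norm_modExp_mul_I (P : E →L[ℂ] E) (n : ℕ) (t : ℝ) (v : E) :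
    ‖modExp P n (-(t * Complex.I)) v‖ = ‖v‖ := by
  have : ⟪modExp P n (-(t * Complex.I)) v, modExp P n (-(t * Complex.I)) v⟫_ℂ = ⟪v, v⟫_ℂ := by
    rw [modExp_inner, ← modExp_add]
    simp [modExp_zero]
  rw [inner_self_eq_norm_sq_to_K, inner_self_eq_norm_sq_to_K] at this
  have h2 : ‖modExp P n (-(t * Complex.I)) v‖ ^ 2 = ‖v‖ ^ 2 := by exact_mod_cast this
  exact (sq_eq_sq₀ (norm_nonneg _) (norm_nonneg _)).1 h2

theorem differentiable_modExp (P : E →L[ℂ] E) (n : ℕ) : Differentiable ℂ (modExp P n) :=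
  fun z => (hasDerivAt_exp_smul_const (modLog P n) z).differentiableAt

theorem modExp_ofReal {P : E →L[ℂ] E} (hP : IsSelfAdjoint P) (n : ℕ) (s : ℝ) :
    modExp P n s = cfc (fun x => Real.exp (s * modLogFun n x)) P := by
  have hc : Continuous fun x => s * modLogFun n x := continuous_const.mul (continuous_modLogFun n)
  have h1 : (s : ℂ) • modLog P n = cfc (fun x => s * modLogFun n x) P := by
    rw [cfc_const_mul s (modLogFun n) P (continuous_modLogFun n).continuousOn]
    ext v; simp [modLog]
  unfold modExp
  rw [h1, ← CFC.real_exp_eq_normedSpace_exp (cfc_predicate _ P)]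
  exact (cfc_comp' Real.exp (fun x => s * modLogFun n x) P (by fun_prop) hc.continuousOn hP).symm

theorem comm_modExp {B : E →L[ℂ] E} {P : E →L[ℂ] E} (hP : IsSelfAdjoint P)
    (h : ∀ v, B (P v) = P (B v)) (n : ℕ) (z : ℂ) (v : E) :
    B (modExp P n z v) = modExp P n z (B v) := by
  refine intertwine_exp (B := B.restrictScalars ℝ) (fun v => ?_) v
  change B (z • modLog P n v) = z • modLog P n (B v)
  rw [map_smul, modLog, commute_cfc_apply hP h (continuous_modLogFun n)]

namespace IsModularPair

variable {P : E →L[ℂ] E} {K : E →L[ℝ] E} (h : IsModularPair P K)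
include h

theorem isSelfAdjoint : IsSelfAdjoint P := IsSelfAdjoint.of_nonneg h.nonneg

theorem spectrum_subset {x : ℝ} (hx : x ∈ spectrum ℝ P) : 0 ≤ x ∧ x ≤ 1 :=
  ⟨spectrum_nonneg_of_nonneg h.nonneg hx, (CFC.le_one_iff P h.isSelfAdjoint).1 h.le_one x hx⟩

theorem cfc_congr' {f g : ℝ → ℝ} (hfg : ∀ x, 0 ≤ x → x ≤ 1 → f x = g x) :
    cfc f P = cfc g P :=
  cfc_congr fun x hx => hfg x (h.spectrum_subset hx).1 (h.spectrum_subset hx).2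

theorem isSelfAdjoint_one_sub : IsSelfAdjoint (1 - P) := (IsSelfAdjoint.one _).sub h.isSelfAdjoint

theorem cfc_one_sub : cfc (fun x : ℝ => 1 - x) P = 1 - P := by
  rw [cfc_sub (fun _ : ℝ => (1 : ℝ)) (fun x => x) P, cfc_id' ℝ P h.isSelfAdjoint,
    cfc_const_one ℝ P h.isSelfAdjoint]

theorem apply_cfc {f : ℝ → ℝ} (hf : Continuous f) (v : E) :
    K (cfc f P v) = cfc (fun x => f (1 - x)) P (K v) := by
  rw [intertwine_cfc h.isSelfAdjoint h.isSelfAdjoint_one_sub (B := K) (fun v => by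
    simp [h.apply_P]) hf, cfc_comp' f (fun x => 1 - x) P (hf.continuousOn) (by fun_prop)
    h.isSelfAdjoint, h.cfc_one_sub]

theorem apply_apply_cfc (v : E) : P (v - P v) = cfc (fun x : ℝ => x * (1 - x)) P v := by
  rw [cfc_mul (fun x => x) (fun x : ℝ => 1 - x) P, h.cfc_one_sub, cfc_id' ℝ P h.isSelfAdjoint]
  simp

theorem cfc_apply_cfc {f g : ℝ → ℝ} (hf : Continuous f) (hg : Continuous g) (v : E) :
    cfc f P (cfc g P v) = cfc (fun x => f x * g x) P v := by
  rw [cfc_mul f g P hf.continuousOn hg.continuousOn]; rfl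

theorem modSqrt_modSqrt (v : E) : modSqrt P (modSqrt P v) = P (v - P v) := by
  rw [h.apply_apply_cfc, modSqrt,
    h.cfc_apply_cfc continuous_sqrt_mul_one_sub continuous_sqrt_mul_one_sub]
  congr 1
  refine h.cfc_congr' fun x h0 h1 => ?_
  exact Real.mul_self_sqrt (mul_nonneg h0 (by linarith))

theorem eq_zero_of_weight {v : E} (hv : P (v - P v) = 0) : v = 0 :=
  h.inj' v (sub_eq_zero.1 (h.inj _ hv)).symm

theorem modSqrt_inj {v : E} (hv : modSqrt P v = 0) : v = 0 :=
  h.eq_zero_of_weight (by rw [← h.modSqrt_modSqrt, hv, map_zero])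

theorem denseRange_modSqrt : DenseRange (modSqrt P) :=
  denseRange_of_isSelfAdjoint (isSelfAdjoint_modSqrt P) fun _ => h.modSqrt_inj

theorem apply_modSqrt (v : E) : K (modSqrt P v) = modSqrt P (K v) := by
  unfold modSqrt
  rw [h.apply_cfc continuous_sqrt_mul_one_sub]
  congr 3
  ext x
  rw [sub_sub_cancel, mul_comm]

theorem apply_cutoff (n : ℕ) (v : E) : K (cutoff P n v) = cutoff P n (K v) := by
  unfold cutoff
  rw [h.apply_cfc (continuous_cutoffFun n)]
  simp only [cutoffFun_one_sub]

theorem apply_modLog (n : ℕ) (v : E) : K (modLog P n v) = -modLog P n (K v) := by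
  unfold modLog
  rw [h.apply_cfc (continuous_modLogFun n)]
  simp only [modLogFun_one_sub]
  rw [cfc_neg]
  rfl

theorem apply_smul (z : ℂ) (v : E) : K (z • v) = starRingEnd ℂ z • K v := by
  conv_lhs => rw [← Complex.re_add_im z]
  conv_rhs => rw [← Complex.re_add_im z]
  rw [add_smul, map_add, mul_smul]
  have : ∀ (r : ℝ) (w : E), (r : ℂ) • w = r • w := fun r w => by simp
  rw [this, this, map_smul, map_smul, h.conj_smul]
  simp only [map_add, map_mul, Complex.conj_ofReal, Complex.conj_I, add_smul, mul_smul, this,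
    neg_smul, smul_neg, mul_neg]

theorem apply_modExp (n : ℕ) (z : ℂ) (v : E) :
    K (modExp P n z v) = modExp P n (-starRingEnd ℂ z) (K v) := by
  refine intertwine_exp (fun v => ?_) v
  rw [smul_apply, smul_apply, h.apply_smul, h.apply_modLog, neg_smul, smul_neg]

theorem norm_cutoff_le (n : ℕ) (v : E) : ‖cutoff P n v‖ ≤ ‖v‖ := by
  refine (ContinuousLinearMap.le_of_opNorm_le _ (c := 1) ?_ v).trans (one_mul _).le
  exact norm_cfc_le zero_le_one fun x _ => abs_cutoffFun_le_one n x

theorem norm_sub_cutoff_weight_le (n : ℕ) (v : E) :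
    ‖P (v - P v) - cutoff P n (P (v - P v))‖ ≤ 2 / ((n : ℝ) + 1) * ‖v‖ := by
  have e : P (v - P v) - cutoff P n (P (v - P v)) =
      cfc (fun x => (1 - cutoffFun n x) * (x * (1 - x))) P v := by
    rw [h.apply_apply_cfc, ← h.cfc_apply_cfc (f := fun x => 1 - cutoffFun n x)
      (g := fun x => x * (1 - x)) (continuous_const.sub (continuous_cutoffFun n))
      (by fun_prop), cfc_sub (fun _ => (1 : ℝ)) (cutoffFun n) P (by fun_prop)
      (continuous_cutoffFun n).continuousOn, cfc_const_one ℝ P h.isSelfAdjoint]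
    rfl
  rw [e]
  refine ContinuousLinearMap.le_of_opNorm_le _ ?_ v
  refine norm_cfc_le (by positivity) fun x hx => ?_
  exact abs_one_sub_cutoffFun_mul_le (h.spectrum_subset hx).1 (h.spectrum_subset hx).2

open Filter Topology in
theorem tendsto_cutoff (v : E) : Tendsto (fun n => cutoff P n v) atTop (𝓝 v) := by
  have hd : DenseRange fun v => P (v - P v) := by
    have := denseRange_of_isSelfAdjoint (X := cfc (fun x : ℝ => x * (1 - x)) P)
      (cfc_predicate _ P) (fun v hv => h.eq_zero_of_weight (by rw [h.apply_apply_cfc, hv]))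
    convert this using 2 with v
    exact h.apply_apply_cfc v
  rw [Metric.tendsto_atTop]
  intro ε hε
  obtain ⟨w, hw⟩ := hd.exists_dist_lt v (show 0 < ε / 3 by positivity)
  have hlim : Tendsto (fun n : ℕ => 2 / ((n : ℝ) + 1) * ‖w‖) atTop (𝓝 0) := by
    have := (tendsto_one_div_add_atTop_nhds_zero_nat (𝕜 := ℝ)).const_mul (2 * ‖w‖)
    rw [mul_zero] at this
    refine this.congr fun n => ?_
    ring
  obtain ⟨N, hN⟩ := eventually_atTop.1 (hlim.eventually (gt_mem_nhds (show 0 < ε / 3 by positivity)))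
  refine ⟨N, fun n hn => ?_⟩
  have h1 := (h.norm_sub_cutoff_weight_le n w).trans_lt (hN n hn)
  set y := P (w - P w)
  rw [dist_eq_norm] at hw ⊢
  have e : cutoff P n v - v = cutoff P n (v - y) - (v - y) - (y - cutoff P n y) := by
    rw [map_sub]; abel
  rw [e]
  have h2 := h.norm_cutoff_le n (v - y)
  calc _ ≤ ‖cutoff P n (v - y)‖ + ‖v - y‖ + ‖y - cutoff P n y‖ :=
        (norm_sub_le _ _).trans (by gcongr; exact norm_sub_le _ _)
    _ < ε := by linarith

theorem modExp_cutoff {n m : ℕ} (hnm : n ≤ m) (z : ℂ) (v : E) :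
    modExp P m z (cutoff P n v) = cutoff P n (modExp P n z v) := by
  symm
  refine intertwine_exp (B := (cutoff P n).restrictScalars ℝ) (fun v => ?_) v
  change cutoff P n (z • modLog P n v) = z • modLog P m (cutoff P n v)
  rw [map_smul, modLog, modLog, cutoff, h.cfc_apply_cfc (continuous_cutoffFun n)
    (continuous_modLogFun n), h.cfc_apply_cfc (continuous_modLogFun m) (continuous_cutoffFun n)]
  congr 2
  refine h.cfc_congr' fun x h0 h1 => ?_
  by_cases hx : cutoffFun n x = 0
  · simp [hx]
  · rw [modLogFun_eq le_rfl h0 h1 hx, modLogFun_eq hnm h0 h1 hx, mul_comm]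

theorem weight_modExp_cutoff {f g : ℝ → ℝ} (hf : Continuous f) (hg : Continuous g) (s : ℝ)
    (hfg : ∀ x, 0 < x → x < 1 → f x * Real.exp (s * (Real.log (1 - x) - Real.log x)) = g x)
    (n : ℕ) (v : E) : cfc f P (modExp P n s (cutoff P n v)) = cfc g P (cutoff P n v) := by
  have hc : Continuous fun x => Real.exp (s * modLogFun n x) :=
    (continuous_const.mul (continuous_modLogFun n)).rexp
  rw [modExp_ofReal h.isSelfAdjoint, cutoff, h.cfc_apply_cfc hc (continuous_cutoffFun n),
    h.cfc_apply_cfc (g := fun x => Real.exp (s * modLogFun n x) * cutoffFun n x) hf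
      (hc.mul (continuous_cutoffFun n)),
    h.cfc_apply_cfc hg (continuous_cutoffFun n)]
  congr 1
  refine h.cfc_congr' fun x h0 h1 => ?_
  by_cases hx : cutoffFun n x = 0
  · simp [hx]
  · obtain ⟨h2, h3⟩ := lt_of_cutoffFun_ne_zero h0 h1 hx
    have hn : (0 : ℝ) < 1 / ((n : ℝ) + 1) := by positivity
    rw [modLogFun_eq le_rfl h0 h1 hx, ← mul_assoc, hfg x (by linarith) (by linarith)]

theorem P_modExp_cutoff (n : ℕ) (v : E) :
    P (modExp P n 1 (cutoff P n v)) = cutoff P n v - P (cutoff P n v) := by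
  have := h.weight_modExp_cutoff (f := fun x => x) (g := fun x => 1 - x) (by fun_prop)
    (by fun_prop) 1 (fun x h0 h1 => by
      rw [one_mul, Real.exp_sub, Real.exp_log h0, Real.exp_log (by linarith)]
      field_simp) n v
  rw [cfc_id' ℝ P h.isSelfAdjoint, h.cfc_one_sub] at this
  simpa using this

theorem modSqrt_modExp_half (n : ℕ) (v : E) :
    modSqrt P (modExp P n (1 / 2) (cutoff P n v)) = cutoff P n v - P (cutoff P n v) := by
  have := h.weight_modExp_cutoff (g := fun x => 1 - x) continuous_sqrt_mul_one_sub
    (by fun_prop) (1 / 2) (fun x h0 h1 => by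
      have h1' : 0 < 1 - x := by linarith
      rw [Real.sqrt_eq_rpow, ← Real.exp_log (mul_pos h0 h1'), ← Real.exp_mul, ← Real.exp_add,
        Real.log_mul h0.ne' h1'.ne']
      conv_rhs => rw [← Real.exp_log h1']
      congr 1; ring) n v
  rw [h.cfc_one_sub] at this
  simpa [modSqrt] using this

theorem modSqrt_modExp_neg_half (n : ℕ) (v : E) :
    modSqrt P (modExp P n (-(1 / 2)) (cutoff P n v)) = P (cutoff P n v) := by
  have := h.weight_modExp_cutoff (g := fun x => x) continuous_sqrt_mul_one_sub
    (by fun_prop) (-(1 / 2)) (fun x h0 h1 => by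
      have h1' : 0 < 1 - x := by linarith
      rw [Real.sqrt_eq_rpow, ← Real.exp_log (mul_pos h0 h1'), ← Real.exp_mul, ← Real.exp_add,
        Real.log_mul h0.ne' h1'.ne']
      conv_rhs => rw [← Real.exp_log h0]
      congr 1; ring) n v
  rw [cfc_id' ℝ P h.isSelfAdjoint] at this
  simpa [modSqrt] using this

end IsModularPair

end ModularOperators

section ModularGroup

variable {E : Type*} [NormedAddCommGroup E] [InnerProductSpace ℂ E] [CompleteSpace E]

open Filter Topology in
/-- The modular unitary group: the strong limit of the truncated imaginary powers. -/
def modU (P : E →L[ℂ] E) (t : ℝ) : E →L[ℂ] E :=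
  Classical.epsilon fun U : E →L[ℂ] E =>
    ∀ v, Tendsto (fun n => modExp P n (-(t * Complex.I)) v) atTop (𝓝 (U v))

/-- The modular conjugation. -/
def modJ (P : E →L[ℂ] E) (K : E →L[ℝ] E) : E →L[ℝ] E :=
  (K : E →ₗ[ℝ] E).extendOfNorm ((modSqrt P).restrictScalars ℝ : E →ₗ[ℝ] E)

namespace IsModularPair

variable {P : E →L[ℂ] E} {K : E →L[ℝ] E} (h : IsModularPair P K)
include h

open Filter Topology in
theorem tendsto_modU (t : ℝ) (v : E) :
    Tendsto (fun n => modExp P n (-(t * Complex.I)) v) atTop (𝓝 (modU P t v)) := by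
  suffices hex : ∃ U : E →L[ℂ] E, ∀ v,
      Tendsto (fun n => modExp P n (-(t * Complex.I)) v) atTop (𝓝 (U v)) from
    Classical.epsilon_spec hex v
  have hlim : ∀ v, ∃ w, Tendsto (fun n => modExp P n (-(t * Complex.I)) v) atTop (𝓝 w) := by
    intro v
    refine cauchySeq_tendsto_of_complete ?_
    rw [Metric.cauchySeq_iff']
    intro ε hε
    obtain ⟨k, hk⟩ := ((h.tendsto_cutoff v).eventually
      (Metric.ball_mem_nhds v (half_pos hε))).exists
    refine ⟨k, fun n hn => ?_⟩
    rw [dist_eq_norm] at hk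
    set A := modExp P n (-(t * Complex.I))
    set B := modExp P k (-(t * Complex.I))
    have e : A v - B v = -(A (cutoff P k v - v)) + B (cutoff P k v - v) := by
      have : A (cutoff P k v) = B (cutoff P k v) := by
        simp only [A, B]
        rw [h.modExp_cutoff hn, h.modExp_cutoff le_rfl]
      rw [map_sub, map_sub, this]; abel
    rw [dist_eq_norm, e]
    refine (norm_add_le _ _).trans_lt ?_
    rw [norm_neg, norm_modExp_mul_I, norm_modExp_mul_I]
    linarith
  choose U hU using hlim
  refine ⟨LinearMap.mkContinuous
    { toFun := U
      map_add' := fun a b => tendsto_nhds_unique (hU (a + b)) (by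
        simpa only [map_add] using (hU a).add (hU b))
      map_smul' := fun c a => tendsto_nhds_unique (hU (c • a)) (by
        simp only [map_smul]; exact (hU a).const_smul c) } 1 fun v => ?_, fun v => hU v⟩
  have := (hU v).norm
  simp only [norm_modExp_mul_I] at this
  rw [one_mul]
  exact (tendsto_nhds_unique tendsto_const_nhds this).ge

theorem norm_modU (t : ℝ) (v : E) : ‖modU P t v‖ = ‖v‖ := by
  have := (h.tendsto_modU t v).norm
  simp only [norm_modExp_mul_I] at this
  exact (tendsto_nhds_unique tendsto_const_nhds this).symm

theorem modU_zero (v : E) : modU P 0 v = v := by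
  have := h.tendsto_modU 0 v
  simp only [Complex.ofReal_zero, zero_mul, neg_zero, modExp_zero] at this
  exact tendsto_nhds_unique this tendsto_const_nhds

open Filter Topology in
theorem tendsto_modExp_of_tendsto (t : ℝ) {w : ℕ → E} {v : E} (hw : Tendsto w atTop (𝓝 v)) :
    Tendsto (fun n => modExp P n (-(t * Complex.I)) (w n)) atTop (𝓝 (modU P t v)) := by
  have h1 : Tendsto (fun n => modExp P n (-(t * Complex.I)) (w n - v)) atTop (𝓝 0) := by
    rw [tendsto_zero_iff_norm_tendsto_zero]
    simp only [norm_modExp_mul_I]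
    exact tendsto_iff_norm_sub_tendsto_zero.1 hw
  have := h1.add (h.tendsto_modU t v)
  simpa using this

theorem modU_add (s t : ℝ) (v : E) : modU P (s + t) v = modU P s (modU P t v) := by
  have h1 := h.tendsto_modExp_of_tendsto s (h.tendsto_modU t v)
  refine tendsto_nhds_unique (h.tendsto_modU (s + t) v) (h1.congr fun n => ?_)
  rw [← modExp_add]
  congr 2
  push_cast; ring

theorem modU_neg_apply (t : ℝ) (v : E) : modU P (-t) (modU P t v) = v := by
  rw [← h.modU_add, neg_add_cancel, h.modU_zero]

theorem modU_apply_neg (t : ℝ) (v : E) : modU P t (modU P (-t) v) = v := by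
  rw [← h.modU_add, add_neg_cancel, h.modU_zero]

theorem modU_inner (t : ℝ) (a b : E) : ⟪modU P t a, b⟫_ℂ = ⟪a, modU P (-t) b⟫_ℂ := by
  refine tendsto_nhds_unique ((h.tendsto_modU t a).inner tendsto_const_nhds) ?_
  refine (tendsto_const_nhds.inner (h.tendsto_modU (-t) b)).congr fun n => ?_
  rw [modExp_inner]
  congr 3
  simp

theorem comm_modU {B : E →L[ℂ] E} (hB : ∀ v, B (P v) = P (B v)) (t : ℝ) (v : E) :
    B (modU P t v) = modU P t (B v) := by
  refine tendsto_nhds_unique (((B.continuous.tendsto _).comp (h.tendsto_modU t v)))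
    ((h.tendsto_modU t (B v)).congr fun n => ?_)
  exact (comm_modExp h.isSelfAdjoint hB n _ v).symm

theorem P_modU (t : ℝ) (v : E) : P (modU P t v) = modU P t (P v) :=
  h.comm_modU (fun _ => rfl) t v

theorem apply_modU (t : ℝ) (v : E) : K (modU P t v) = modU P t (K v) := by
  refine tendsto_nhds_unique (((K.continuous.tendsto _).comp (h.tendsto_modU t v)))
    ((h.tendsto_modU t (K v)).congr fun n => ?_)
  rw [Function.comp_apply, h.apply_modExp]
  congr 2
  simp

theorem cutoff_comm_P (n : ℕ) (v : E) : cutoff P n (P v) = P (cutoff P n v) :=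
  (commute_cfc_apply h.isSelfAdjoint (B := P) (fun _ => rfl) (continuous_cutoffFun n) v).symm

theorem modSqrt_comm_P (v : E) : modSqrt P (P v) = P (modSqrt P v) :=
  (commute_cfc_apply h.isSelfAdjoint (B := P) (fun _ => rfl) continuous_sqrt_mul_one_sub v).symm

theorem cutoff_modU (n : ℕ) (t : ℝ) (v : E) :
    cutoff P n (modU P t v) = modU P t (cutoff P n v) :=
  h.comm_modU (h.cutoff_comm_P n) t v

theorem modSqrt_modU (t : ℝ) (v : E) : modSqrt P (modU P t v) = modU P t (modSqrt P v) :=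
  h.comm_modU h.modSqrt_comm_P t v

theorem cutoff_modExp (n : ℕ) (z : ℂ) (v : E) :
    cutoff P n (modExp P n z v) = modExp P n z (cutoff P n v) :=
  (h.modExp_cutoff le_rfl z v).symm

theorem modU_cutoff (n : ℕ) (t : ℝ) (v : E) :
    modU P t (cutoff P n v) = modExp P n (-(t * Complex.I)) (cutoff P n v) := by
  refine tendsto_nhds_unique (h.tendsto_modU t _) ?_
  refine tendsto_const_nhds.congr' ?_
  filter_upwards [Filter.eventually_ge_atTop n] with m hm
  rw [h.modExp_cutoff hm, h.cutoff_modExp]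

open Filter Topology in
theorem continuous_modU (v : E) : Continuous fun t => modU P t v := by
  have h1 : ∀ n, Continuous fun t => modU P t (cutoff P n v) := by
    intro n
    simp only [h.modU_cutoff]
    have h2 : Continuous fun t : ℝ => modExp P n (-(t * Complex.I)) :=
      (differentiable_modExp P n).continuous.comp (by fun_prop)
    exact h2.clm_apply continuous_const
  have h3 : TendstoUniformly (fun n t => modU P t (cutoff P n v)) (fun t => modU P t v) atTop := by
    rw [Metric.tendstoUniformly_iff]
    intro ε hε
    filter_upwards [(h.tendsto_cutoff v).eventually (Metric.ball_mem_nhds v hε)] with n hn t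
    rw [dist_comm, dist_eq_norm, ← map_sub, h.norm_modU, ← dist_eq_norm]
    exact hn
  exact h3.continuous (Frequently.of_forall h1)

theorem modU_eq_self {v : E} (hv : P v = (1 / 2 : ℂ) • v) (t : ℝ) : modU P t v = v := by
  have hL : ∀ n, modLog P n v = 0 := by
    intro n
    have := cfc_apply_of_eigen h.isSelfAdjoint (r := 1 / 2) (by simpa using hv)
      (continuous_modLogFun n)
    have h2 : modLogFun n (1 / 2) = 0 := by
      unfold modLogFun; norm_num
    rw [modLog, this, h2]; simp
  have h0 : ∀ n (z : ℂ), modExp P n z v = v := by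
    intro n z
    have hd : ∀ w, HasDerivAt (fun z => modExp P n z v) 0 w := by
      intro w
      have := (hasDerivAt_exp_smul_const (modLog P n) w)
      have h2 := this.clm_apply (hasDerivAt_const w v)
      simp only [map_zero, add_zero, mul_apply_eq_comp, hL] at h2
      exact h2
    have := is_const_of_deriv_eq_zero (𝕜 := ℂ) (f := fun z => modExp P n z v)
      (fun w => (hd w).differentiableAt) (fun w => (hd w).deriv) z 0
    simpa [modExp_zero] using this
  have := h.tendsto_modU t v
  simp only [h0] at this
  exact tendsto_nhds_unique this tendsto_const_nhds

theorem norm_apply (v : E) : ‖K v‖ = ‖modSqrt P v‖ := by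
  have h1 : ⟪K v, K v⟫_ℂ = ⟪modSqrt P v, modSqrt P v⟫_ℂ := by
    rw [h.inner_comm, h.apply_apply, inner_apply_comm_of_isSelfAdjoint (isSelfAdjoint_modSqrt P),
      h.modSqrt_modSqrt]
  rw [inner_self_eq_norm_sq_to_K, inner_self_eq_norm_sq_to_K] at h1
  have h2 : ‖K v‖ ^ 2 = ‖modSqrt P v‖ ^ 2 := by exact_mod_cast h1
  exact (sq_eq_sq₀ (norm_nonneg _) (norm_nonneg _)).1 h2

theorem modJ_modSqrt (v : E) : modJ P K (modSqrt P v) = K v :=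
  LinearMap.extendOfNorm_eq (f := (K : E →ₗ[ℝ] E))
    (e := ((modSqrt P).restrictScalars ℝ : E →ₗ[ℝ] E)) h.denseRange_modSqrt
    ⟨1, fun x => by rw [one_mul]; exact (h.norm_apply x).le⟩ v

theorem modSqrt_modJ (v : E) : modSqrt P (modJ P K v) = K v := by
  have : (fun v => modSqrt P (modJ P K v)) = fun v => K v := by
    refine h.denseRange_modSqrt.equalizer (by fun_prop) (by fun_prop) ?_
    ext v
    simp only [Function.comp_apply]
    rw [h.modJ_modSqrt, h.apply_modSqrt]
  exact congrFun this v

theorem modJ_modJ (v : E) : modJ P K (modJ P K v) = v := by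
  have h1 : modSqrt P (modSqrt P (modJ P K (modJ P K v) - v)) = 0 := by
    rw [map_sub, map_sub, h.modSqrt_modJ, ← h.apply_modSqrt, h.modSqrt_modJ, h.apply_apply,
      h.modSqrt_modSqrt, sub_self]
  exact sub_eq_zero.1 (h.modSqrt_inj (h.modSqrt_inj h1))

theorem modJ_inner_comm (a b : E) : ⟪a, modJ P K b⟫_ℂ = ⟪b, modJ P K a⟫_ℂ := by
  have key : ∀ x b, ⟪modSqrt P x, modJ P K b⟫_ℂ = ⟪b, modJ P K (modSqrt P x)⟫_ℂ := by
    intro x b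
    rw [h.modJ_modSqrt, inner_apply_comm_of_isSelfAdjoint (isSelfAdjoint_modSqrt P),
      h.modSqrt_modJ, h.inner_comm]
  have : (fun a => ⟪a, modJ P K b⟫_ℂ) = fun a => ⟪b, modJ P K a⟫_ℂ := by
    refine h.denseRange_modSqrt.equalizer (by fun_prop) (by fun_prop) ?_
    ext x
    exact key x b
  exact congrFun this a

theorem modJ_smul (z : ℂ) (v : E) : modJ P K (z • v) = starRingEnd ℂ z • modJ P K v := by
  refine ext_inner_left ℂ fun a => ?_
  rw [h.modJ_inner_comm, inner_smul_left, inner_smul_right, h.modJ_inner_comm v a]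

theorem modJ_inner_modJ (a b : E) : ⟪modJ P K a, modJ P K b⟫_ℂ = ⟪b, a⟫_ℂ := by
  rw [h.modJ_inner_comm, h.modJ_modJ]

theorem modJ_eq_self {v : E} (hv : P v = (1 / 2 : ℂ) • v) (hK : K v = (1 / 2 : ℂ) • v) :
    modJ P K v = v := by
  have h1 := cfc_apply_of_eigen h.isSelfAdjoint (r := 1 / 2) (by simpa using hv)
    continuous_sqrt_mul_one_sub
  have h2 : √((1 / 2 : ℝ) * (1 - 1 / 2)) = 1 / 2 := by
    rw [show (1 / 2 : ℝ) * (1 - 1 / 2) = (1 / 2) ^ 2 by norm_num]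
    exact Real.sqrt_sq (by norm_num)
  have h3 : modSqrt P v = (1 / 2 : ℂ) • v := by
    rw [modSqrt, h1, h2]; norm_num
  have h4 := h.modJ_modSqrt v
  rw [h3, h.modJ_smul, hK] at h4
  have h5 : starRingEnd ℂ (1 / 2 : ℂ) = 1 / 2 := by
    rw [map_div₀, map_one, map_ofNat]
  rw [h5] at h4
  exact smul_right_injective E (by norm_num : (1 / 2 : ℂ) ≠ 0) h4

end IsModularPair

end ModularGroup

section ModularPairOfAlgebra

variable {E : Type*} [NormedAddCommGroup E] [InnerProductSpace ℂ E] [CompleteSpace E]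

namespace VonNeumannAlgebra

variable {M : VonNeumannAlgebra E}

theorem smul_mem_of_mem {a : E →L[ℂ] E} (ha : a ∈ M) (c : ℂ) : c • a ∈ M :=
  M.toStarSubalgebra.smul_mem ha c

theorem mem_of_forall_commutant {x : E →L[ℂ] E}
    (hx : ∀ y ∈ M.commutant, ∀ v, y (x v) = x (y v)) : x ∈ M := by
  rw [← commutant_commutant M, mem_commutant_iff]
  exact fun y hy => ContinuousLinearMap.ext fun v => hx y hy v

theorem mem_commutant_of_forall {x : E →L[ℂ] E}
    (hx : ∀ y ∈ M, ∀ v, y (x v) = x (y v)) : x ∈ M.commutant :=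
  mem_commutant_iff.2 fun y hy => ContinuousLinearMap.ext fun v => hx y hy v

theorem apply_comm {a y : E →L[ℂ] E} (ha : a ∈ M) (hy : y ∈ M.commutant) (v : E) :
    a (y v) = y (a v) :=
  DFunLike.congr_fun (mem_commutant_iff.1 hy a ha) v

theorem cfc_mem {a : E →L[ℂ] E} (ha : a ∈ M) (hs : IsSelfAdjoint a) {f : ℝ → ℝ}
    (hf : Continuous f) : cfc f a ∈ M :=
  mem_of_forall_commutant fun _ hy v =>
    commute_cfc_apply hs (fun v => (apply_comm ha hy v).symm) hf v

theorem exists_selfAdjoint_decomp {a : E →L[ℂ] E} (ha : a ∈ M) :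
    ∃ b ∈ M, ∃ c ∈ M, star b = b ∧ star c = c ∧ a = b + Complex.I • c ∧
      star a = b - Complex.I • c := by
  refine ⟨(1 / 2 : ℂ) • (a + star a), smul_mem_of_mem (add_mem ha (star_mem ha)) _,
    (-(Complex.I / 2)) • (a - star a), smul_mem_of_mem (sub_mem ha (star_mem ha)) _, ?_, ?_, ?_, ?_⟩
  · simp [star_add, add_comm]
  · rw [star_smul, star_sub, star_star, ← neg_sub a (star a), smul_neg, ← neg_smul]
    congr 1
    simp [neg_div]
  · rw [smul_smul, show Complex.I * -(Complex.I / 2) = 1 / 2 by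
      linear_combination (-1 / 2) * Complex.I_sq]
    module
  · rw [smul_smul, show Complex.I * -(Complex.I / 2) = 1 / 2 by
      linear_combination (-1 / 2) * Complex.I_sq]
    module

theorem inner_apply_left (a : E →L[ℂ] E) (v w : E) : ⟪a v, w⟫_ℂ = ⟪v, star a w⟫_ℂ := by
  rw [ContinuousLinearMap.star_eq_adjoint, ContinuousLinearMap.adjoint_inner_right]

theorem inner_apply_right (a : E →L[ℂ] E) (v w : E) : ⟪v, a w⟫_ℂ = ⟪star a v, w⟫_ℂ := by
  rw [ContinuousLinearMap.star_eq_adjoint, ContinuousLinearMap.adjoint_inner_left]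

end VonNeumannAlgebra

open VonNeumannAlgebra

/-- The unit vector `Ω` is cyclic for `M` and for its commutant. -/
structure IsCyclicSeparating (M : VonNeumannAlgebra E) (Ω : E) : Prop where
  norm_eq : ‖Ω‖ = 1
  dense : Dense {w | ∃ a ∈ M, a Ω = w}
  dense' : Dense {w | ∃ a ∈ M.commutant, a Ω = w}

/-- A real-linear bounded operator commuting with multiplication by `I`, as a complex-linear one. -/
def clmOfReal (B : E →L[ℝ] E) (hB : ∀ v, B (Complex.I • v) = Complex.I • B v) : E →L[ℂ] E where
  toFun := B
  map_add' := map_add B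
  map_smul' z v := by
    conv_lhs => rw [← Complex.re_add_im z, add_smul, mul_smul, map_add]
    conv_rhs => rw [RingHom.id_apply, ← Complex.re_add_im z, add_smul, mul_smul]
    have h1 : ∀ (r : ℝ) w, B ((r : ℂ) • w) = (r : ℂ) • B w := fun r w => by
      simpa using map_smul B r w
    rw [h1, h1, hB]
  cont := B.continuous

/-- The real subspace of vectors `a Ω` with `a ∈ M` self-adjoint. -/
def saOrbit (M : VonNeumannAlgebra E) (Ω : E) : Submodule ℝ E where
  carrier := {w | ∃ a ∈ M, star a = a ∧ a Ω = w}
  add_mem' := by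
    rintro _ _ ⟨a, ha, ha', rfl⟩ ⟨b, hb, hb', rfl⟩
    exact ⟨a + b, add_mem ha hb, by rw [star_add, ha', hb'], rfl⟩
  zero_mem' := ⟨0, zero_mem M, star_zero _, rfl⟩
  smul_mem' := by
    rintro c _ ⟨a, ha, ha', rfl⟩
    refine ⟨(c : ℂ) • a, smul_mem_of_mem ha _, by simp [ha'], ?_⟩
    simp

attribute [local instance] InnerProductSpace.complexToReal

instance (M : VonNeumannAlgebra E) (Ω : E) :
    CompleteSpace (saOrbit M Ω).topologicalClosure :=
  (saOrbit M Ω).isClosed_topologicalClosure.completeSpace_coe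

/-- The real orthogonal projection onto the closure of the self-adjoint orbit. -/
def saProj (M : VonNeumannAlgebra E) (Ω : E) : E →L[ℝ] E :=
  (saOrbit M Ω).topologicalClosure.starProjection

/-- The conjugate of `saProj` by multiplication by `I`. -/
def saProjI (M : VonNeumannAlgebra E) (Ω : E) : E →L[ℝ] E :=
  -((Complex.I • ContinuousLinearMap.id ℂ E).restrictScalars ℝ ∘L saProj M Ω ∘L
    (Complex.I • ContinuousLinearMap.id ℂ E).restrictScalars ℝ)

section Algebra

variable (M : VonNeumannAlgebra E) (Ω : E)

theorem saProjI_apply (v : E) :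
    saProjI M Ω v = -(Complex.I • saProj M Ω (Complex.I • v)) := rfl

theorem saProj_I_smul (v : E) :
    saProj M Ω (Complex.I • v) = Complex.I • saProjI M Ω v := by
  rw [saProjI_apply, smul_neg, smul_smul, Complex.I_mul_I, neg_one_smul, neg_neg]

theorem saProjI_I_smul (v : E) :
    saProjI M Ω (Complex.I • v) = Complex.I • saProj M Ω v := by
  rw [saProjI_apply, smul_smul, Complex.I_mul_I, neg_one_smul, map_neg, smul_neg, neg_neg]

/-- Half the sum of the two real projections attached to `(M, Ω)`. -/
def modP : E →L[ℂ] E :=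
  clmOfReal ((1 / 2 : ℝ) • (saProj M Ω + saProjI M Ω)) fun v => by
    simp only [smul_apply, add_apply, saProj_I_smul, saProjI_I_smul]
    rw [smul_comm Complex.I, smul_add Complex.I, add_comm (Complex.I • saProjI M Ω v)]

/-- Half the difference of the two real projections attached to `(M, Ω)`. -/
def modK : E →L[ℝ] E := (1 / 2 : ℝ) • (saProj M Ω - saProjI M Ω)

theorem modP_apply (v : E) : modP M Ω v = (1 / 2 : ℝ) • (saProj M Ω v + saProjI M Ω v) := rfl

theorem modK_apply (v : E) : modK M Ω v = (1 / 2 : ℝ) • (saProj M Ω v - saProjI M Ω v) := rfl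

theorem modP_add_modK (v : E) : modP M Ω v + modK M Ω v = saProj M Ω v := by
  rw [modP_apply, modK_apply]; module

theorem modP_sub_modK (v : E) : modP M Ω v - modK M Ω v = saProjI M Ω v := by
  rw [modP_apply, modK_apply]; module

theorem saProj_mem_closure (v : E) : saProj M Ω v ∈ closure (saOrbit M Ω : Set E) :=
  Submodule.starProjection_apply_mem (saOrbit M Ω).topologicalClosure v

theorem saProj_saProj (v : E) : saProj M Ω (saProj M Ω v) = saProj M Ω v :=
  Submodule.starProjection_eq_self_iff.2 (Submodule.starProjection_apply_mem _ _)

theorem saProjI_saProjI (v : E) : saProjI M Ω (saProjI M Ω v) = saProjI M Ω v := by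
  rw [saProjI_apply M Ω (saProjI M Ω v), ← saProj_I_smul, saProj_saProj, saProjI_apply]

theorem re_inner_saProj (v w : E) : (⟪saProj M Ω v, w⟫_ℂ).re = (⟪v, saProj M Ω w⟫_ℂ).re :=
  Submodule.inner_starProjection_left_eq_right (saOrbit M Ω).topologicalClosure v w

theorem re_inner_saProjI (v w : E) : (⟪saProjI M Ω v, w⟫_ℂ).re = (⟪v, saProjI M Ω w⟫_ℂ).re := by
  have h1 : ∀ a b : E, (⟪-(Complex.I • a), b⟫_ℂ).re = (⟪a, Complex.I • b⟫_ℂ).re := by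
    intro a b
    rw [inner_neg_left, inner_smul_left, inner_smul_right]
    simp
  have h2 : ∀ a b : E, (⟪Complex.I • a, b⟫_ℂ).re = (⟪a, -(Complex.I • b)⟫_ℂ).re := by
    intro a b
    rw [inner_neg_right, inner_smul_left, inner_smul_right]
    simp
  rw [saProjI_apply, h1, re_inner_saProj, h2, ← saProjI_apply]

theorem saProj_eq_self_of_mem {a : E →L[ℂ] E} (ha : a ∈ M) (hs : star a = a) :
    saProj M Ω (a Ω) = a Ω :=
  Submodule.starProjection_eq_self_iff.2
    ((saOrbit M Ω).le_topologicalClosure ⟨a, ha, hs, rfl⟩)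

theorem im_inner_saProj_commutant {y : E →L[ℂ] E} (hy : y ∈ M.commutant) (hs : star y = y)
    (v : E) : (⟪saProj M Ω v, y Ω⟫_ℂ).im = 0 := by
  have hcl : IsClosed {w : E | (⟪w, y Ω⟫_ℂ).im = 0} :=
    isClosed_eq (by fun_prop) continuous_const
  have hsub : ((saOrbit M Ω : Submodule ℝ E) : Set E) ⊆ {w : E | (⟪w, y Ω⟫_ℂ).im = 0} := by
    rintro _ ⟨a, ha, ha', rfl⟩
    have : starRingEnd ℂ ⟪a Ω, y Ω⟫_ℂ = ⟪a Ω, y Ω⟫_ℂ := by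
      rw [inner_conj_symm, inner_apply_left, hs, inner_apply_left a, ha', apply_comm ha hy]
    exact Complex.conj_eq_iff_im.1 this
  exact closure_minimal hsub hcl (saProj_mem_closure M Ω v)

theorem re_inner_saProjI_commutant {y : E →L[ℂ] E} (hy : y ∈ M.commutant) (hs : star y = y)
    (v : E) : (⟪saProjI M Ω v, y Ω⟫_ℂ).re = 0 := by
  have := im_inner_saProj_commutant M Ω hy hs (Complex.I • v)
  rw [saProj_I_smul, inner_smul_left] at this
  simpa using this

theorem saProjI_commutant {y : E →L[ℂ] E} (hy : y ∈ M.commutant) (hs : star y = y) :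
    saProjI M Ω (y Ω) = 0 := by
  have h3 : (⟪saProjI M Ω (y Ω), saProjI M Ω (y Ω)⟫_ℂ).re = 0 := by
    rw [← re_inner_saProjI, saProjI_saProjI]
    exact re_inner_saProjI_commutant M Ω hy hs (y Ω)
  have h4 : RCLike.re ⟪saProjI M Ω (y Ω), saProjI M Ω (y Ω)⟫_ℂ = 0 := h3
  rw [inner_self_eq_norm_sq] at h4
  exact norm_eq_zero.1 (pow_eq_zero_iff two_ne_zero |>.1 h4)

theorem modK_conj_smul (v : E) : modK M Ω (Complex.I • v) = -(Complex.I • modK M Ω v) := by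
  rw [modK_apply, modK_apply, saProj_I_smul, saProjI_I_smul, smul_comm Complex.I, ← smul_neg,
    ← smul_sub, ← smul_neg, neg_sub]

theorem modK_apply_of_mem {a : E →L[ℂ] E} (ha : a ∈ M) :
    modK M Ω (a Ω) = star a Ω - modP M Ω (star a Ω) := by
  have key : ∀ b ∈ M, star b = b → modK M Ω (b Ω) = b Ω - modP M Ω (b Ω) := by
    intro b hb hs
    rw [eq_sub_iff_add_eq, add_comm, modP_add_modK, saProj_eq_self_of_mem M Ω hb hs]
  obtain ⟨b, hb, c, hc, hbs, hcs, e1, e2⟩ := exists_selfAdjoint_decomp ha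
  rw [e2, e1]
  simp only [add_apply, sub_apply, smul_apply, map_add, map_sub, map_smul, modK_conj_smul,
    key b hb hbs, key c hc hcs]
  module

theorem modK_apply_of_mem_commutant {y : E →L[ℂ] E} (hy : y ∈ M.commutant) :
    modK M Ω (y Ω) = modP M Ω (star y Ω) := by
  have key : ∀ b ∈ M.commutant, star b = b → modK M Ω (b Ω) = modP M Ω (b Ω) := by
    intro b hb hs
    rw [eq_comm, ← sub_eq_zero, modP_sub_modK, saProjI_commutant M Ω hb hs]
  obtain ⟨b, hb, c, hc, hbs, hcs, e1, e2⟩ := exists_selfAdjoint_decomp hy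
  rw [e2, e1]
  simp only [add_apply, sub_apply, smul_apply, map_add, map_sub, map_smul, modK_conj_smul,
    key b hb hbs, key c hc hcs]
  module

theorem modP_inner (a b : E) : ⟪modP M Ω a, b⟫_ℂ = ⟪a, modP M Ω b⟫_ℂ := by
  have hre : ∀ a b, (⟪modP M Ω a, b⟫_ℂ).re = (⟪a, modP M Ω b⟫_ℂ).re := by
    intro a b
    have e : ∀ v, modP M Ω v = ((1 / 2 : ℝ) : ℂ) • (saProj M Ω v + saProjI M Ω v) := fun v => by
      rw [modP_apply, Complex.coe_smul]
    rw [e, e, inner_smul_left, inner_smul_right, Complex.conj_ofReal, Complex.re_ofReal_mul,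
      Complex.re_ofReal_mul, inner_add_left, inner_add_right, Complex.add_re, Complex.add_re,
      re_inner_saProj, re_inner_saProjI]
  refine Complex.ext (hre a b) ?_
  have := hre (Complex.I • a) b
  rw [map_smul, inner_smul_left, inner_smul_left] at this
  simpa using this

theorem modK_inner_comm (a b : E) : ⟪a, modK M Ω b⟫_ℂ = ⟪b, modK M Ω a⟫_ℂ := by
  have hre : ∀ a b, (⟪a, modK M Ω b⟫_ℂ).re = (⟪b, modK M Ω a⟫_ℂ).re := by
    intro a b
    have e : ∀ v, modK M Ω v = ((1 / 2 : ℝ) : ℂ) • (saProj M Ω v - saProjI M Ω v) := fun v => by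
      rw [modK_apply, Complex.coe_smul]
    have hs : ∀ x y : E, (⟪x, y⟫_ℂ).re = (⟪y, x⟫_ℂ).re := fun x y => by
      rw [← inner_conj_symm, Complex.conj_re]
    rw [e, e, inner_smul_right, inner_smul_right, Complex.re_ofReal_mul,
      Complex.re_ofReal_mul, inner_sub_right, inner_sub_right, Complex.sub_re, Complex.sub_re,
      ← re_inner_saProj, ← re_inner_saProjI, hs b, hs b]
  refine Complex.ext (hre a b) ?_
  have := hre (Complex.I • a) b
  rw [modK_conj_smul, inner_neg_right, inner_smul_left, inner_smul_right] at this
  simpa using this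

theorem re_inner_modP (v : E) :
    (⟪v, modP M Ω v⟫_ℂ).re = (‖saProj M Ω v‖ ^ 2 + ‖saProjI M Ω v‖ ^ 2) / 2 := by
  have e : modP M Ω v = ((1 / 2 : ℝ) : ℂ) • (saProj M Ω v + saProjI M Ω v) := by
    rw [modP_apply, Complex.coe_smul]
  have h1 : (⟪v, saProj M Ω v⟫_ℂ).re = ‖saProj M Ω v‖ ^ 2 := by
    rw [← saProj_saProj M Ω v, ← re_inner_saProj, saProj_saProj]
    exact inner_self_eq_norm_sq (𝕜 := ℂ) _
  have h2 : (⟪v, saProjI M Ω v⟫_ℂ).re = ‖saProjI M Ω v‖ ^ 2 := by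
    rw [← saProjI_saProjI M Ω v, ← re_inner_saProjI, saProjI_saProjI]
    exact inner_self_eq_norm_sq (𝕜 := ℂ) _
  rw [e, inner_smul_right, Complex.re_ofReal_mul, inner_add_right, Complex.add_re, h1, h2]
  ring

theorem norm_saProj_le (v : E) : ‖saProj M Ω v‖ ≤ ‖v‖ :=
  Submodule.norm_starProjection_apply_le _ v

theorem norm_saProjI_le (v : E) : ‖saProjI M Ω v‖ ≤ ‖v‖ := by
  rw [saProjI_apply, norm_neg, norm_smul, Complex.norm_I, one_mul]
  refine (norm_saProj_le M Ω _).trans ?_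
  rw [norm_smul, Complex.norm_I, one_mul]

theorem eq_self_of_norm_saProj {v : E} (hv : ‖saProj M Ω v‖ = ‖v‖) : saProj M Ω v = v := by
  have h1 : (⟪v, saProj M Ω v⟫_ℂ).re = ‖saProj M Ω v‖ ^ 2 := by
    rw [← saProj_saProj M Ω v, ← re_inner_saProj, saProj_saProj]
    exact inner_self_eq_norm_sq (𝕜 := ℂ) _
  have h2 := norm_sub_sq (𝕜 := ℂ) v (saProj M Ω v)
  rw [show RCLike.re ⟪v, saProj M Ω v⟫_ℂ = ‖saProj M Ω v‖ ^ 2 from h1, hv] at h2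
  have h3 : ‖v - saProj M Ω v‖ ^ 2 = 0 := by rw [h2]; ring
  exact (sub_eq_zero.1 (norm_eq_zero.1 (pow_eq_zero_iff two_ne_zero |>.1 h3))).symm

end Algebra

theorem IsCyclicSeparating.isModularPair {M : VonNeumannAlgebra E} {Ω : E}
    (h : IsCyclicSeparating M Ω) : IsModularPair (modP M Ω) (modK M Ω) where
  nonneg := by
    rw [ContinuousLinearMap.nonneg_iff_isPositive, ContinuousLinearMap.isPositive_def']
    refine ⟨?_, fun v => ?_⟩
    · rw [ContinuousLinearMap.isSelfAdjoint_iff_isSymmetric]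
      exact modP_inner M Ω
    · rw [ContinuousLinearMap.reApplyInnerSelf_apply, modP_inner]
      have := re_inner_modP M Ω v
      change 0 ≤ (⟪v, modP M Ω v⟫_ℂ).re
      rw [this]; positivity
  le_one := by
    rw [← sub_nonneg, ContinuousLinearMap.nonneg_iff_isPositive,
      ContinuousLinearMap.isPositive_def']
    refine ⟨?_, fun v => ?_⟩
    · refine (IsSelfAdjoint.one _).sub ?_
      rw [ContinuousLinearMap.isSelfAdjoint_iff_isSymmetric]
      exact modP_inner M Ω
    · rw [ContinuousLinearMap.reApplyInnerSelf_apply, sub_apply, one_apply_eq_self,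
        inner_sub_left, modP_inner, map_sub, inner_self_eq_norm_sq]
      have := re_inner_modP M Ω v
      change 0 ≤ ‖v‖ ^ 2 - (⟪v, modP M Ω v⟫_ℂ).re
      rw [this]
      have h1 := pow_le_pow_left₀ (norm_nonneg _) (norm_saProj_le M Ω v) 2
      have h2 := pow_le_pow_left₀ (norm_nonneg _) (norm_saProjI_le M Ω v) 2
      linarith
  inj v hv := by
    have h1 := re_inner_modP M Ω v
    rw [hv, inner_zero_right, Complex.zero_re] at h1
    have h2 : saProj M Ω v = 0 := by
      rw [← norm_eq_zero, ← sq_eq_zero_iff]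
      nlinarith [sq_nonneg ‖saProj M Ω v‖, sq_nonneg ‖saProjI M Ω v‖]
    have h3 : saProjI M Ω v = 0 := by
      rw [← norm_eq_zero, ← sq_eq_zero_iff]
      nlinarith [sq_nonneg ‖saProj M Ω v‖, sq_nonneg ‖saProjI M Ω v‖]
    have key : ∀ a ∈ M, star a = a → ⟪v, a Ω⟫_ℂ = 0 := by
      intro a ha hs
      refine Complex.ext ?_ ?_
      · rw [← saProj_eq_self_of_mem M Ω ha hs, ← re_inner_saProj, h2, inner_zero_left]
      · have : (⟪saProj M Ω (Complex.I • v), a Ω⟫_ℂ).re = 0 := by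
          rw [saProj_I_smul, h3]; simp
        rw [re_inner_saProj, saProj_eq_self_of_mem M Ω ha hs, inner_smul_left] at this
        simpa using this
    have key2 : ∀ w ∈ {w | ∃ a ∈ M, a Ω = w}, ⟪v, w⟫_ℂ = 0 := by
      rintro _ ⟨a, ha, rfl⟩
      obtain ⟨b, hb, c, hc, hbs, hcs, e1, e2⟩ := exists_selfAdjoint_decomp ha
      rw [e1, add_apply, smul_apply, inner_add_right, inner_smul_right,
        key b hb hbs, key c hc hcs]
      simp
    exact h.dense.eq_zero_of_inner_left ℂ key2
  inj' v hv := by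
    have h1 := re_inner_modP M Ω v
    rw [hv, show (⟪v, v⟫_ℂ).re = ‖v‖ ^ 2 from inner_self_eq_norm_sq (𝕜 := ℂ) v] at h1
    have h2 := pow_le_pow_left₀ (norm_nonneg _) (norm_saProj_le M Ω v) 2
    have h3 := pow_le_pow_left₀ (norm_nonneg _) (norm_saProjI_le M Ω v) 2
    have h4 : saProj M Ω v = v := eq_self_of_norm_saProj M Ω <|
      (sq_eq_sq₀ (norm_nonneg _) (norm_nonneg _)).1 (by linarith)
    have h5 : saProjI M Ω v = v := by
      rw [modP_apply, h4] at hv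
      have : (1 / 2 : ℝ) • saProjI M Ω v = (1 / 2 : ℝ) • v := by
        rw [smul_add] at hv
        nth_rewrite 3 [show v = (1 / 2 : ℝ) • v + (1 / 2 : ℝ) • v by module] at hv
        exact add_left_cancel hv
      exact smul_right_injective E (by norm_num : (1 / 2 : ℝ) ≠ 0) this
    have key : ∀ a ∈ M.commutant, star a = a → ⟪v, a Ω⟫_ℂ = 0 := by
      intro a ha hs
      refine Complex.ext ?_ ?_
      · rw [← h5]; exact re_inner_saProjI_commutant M Ω ha hs v
      · rw [← h4]; exact im_inner_saProj_commutant M Ω ha hs v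
    have key2 : ∀ w ∈ {w | ∃ a ∈ M.commutant, a Ω = w}, ⟪v, w⟫_ℂ = 0 := by
      rintro _ ⟨a, ha, rfl⟩
      obtain ⟨b, hb, c, hc, hbs, hcs, e1, e2⟩ := exists_selfAdjoint_decomp ha
      rw [e1, add_apply, smul_apply, inner_add_right, inner_smul_right,
        key b hb hbs, key c hc hcs]
      simp
    exact h.dense'.eq_zero_of_inner_left ℂ key2
  conj_smul := modK_conj_smul M Ω
  inner_comm := modK_inner_comm M Ω
  apply_P v := by
    simp only [modP_apply, modK_apply, map_smul, map_add, map_sub, saProj_saProj, saProjI_saProjI]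
    module
  apply_apply v := by
    simp only [modP_apply, modK_apply, map_smul, map_add, map_sub, saProj_saProj, saProjI_saProjI]
    module

theorem modP_base (M : VonNeumannAlgebra E) (Ω : E) : modP M Ω Ω = (1 / 2 : ℂ) • Ω := by
  have h1 := modK_apply_of_mem M Ω (one_mem M)
  have h2 := modK_apply_of_mem_commutant M Ω (one_mem M.commutant)
  simp only [star_one, one_apply_eq_self] at h1 h2
  rw [h1, sub_eq_iff_eq_add, ← two_smul ℂ] at h2
  conv_rhs => rw [h2]
  rw [smul_smul]; norm_num

theorem modK_base (M : VonNeumannAlgebra E) (Ω : E) : modK M Ω Ω = (1 / 2 : ℂ) • Ω := by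
  have h2 := modK_apply_of_mem_commutant M Ω (one_mem M.commutant)
  simp only [star_one, one_apply_eq_self] at h2
  rw [h2, modP_base]

end ModularPairOfAlgebra

section RadonNikodym

variable {E : Type*} [NormedAddCommGroup E] [InnerProductSpace ℂ E] [CompleteSpace E]

open VonNeumannAlgebra

namespace IsCyclicSeparating

variable {M : VonNeumannAlgebra E} {Ω : E} (h : IsCyclicSeparating M Ω)
include h

theorem ext_commutant {x y : E →L[ℂ] E}
    (hxy : ∀ z ∈ M.commutant, x (z Ω) = y (z Ω)) : x = y :=
  ContinuousLinearMap.coeFn_injective <|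
    x.continuous.ext_on h.dense' y.continuous (by rintro _ ⟨z, hz, rfl⟩; exact hxy z hz)

theorem ext_inner_commutant {v w : E}
    (hvw : ∀ z ∈ M.commutant, ⟪v, z Ω⟫_ℂ = ⟪w, z Ω⟫_ℂ) : v = w :=
  h.dense'.eq_of_inner_left ℂ (by rintro _ ⟨z, hz, rfl⟩; exact hvw z hz)

theorem exists_mem_apply_eq {v : E} {r : ℝ} (hr : 0 ≤ r)
    (hv : ∀ y ∈ M.commutant, ‖y v‖ ≤ r * ‖y Ω‖) :
    ∃ x ∈ M, x Ω = v ∧ ‖x‖ ≤ r := by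
  let ev : E → (↥M.commutant.toStarSubalgebra →ₗ[ℂ] E) := fun w =>
    { toFun := fun y => (y : E →L[ℂ] E) w
      map_add' := fun _ _ => rfl
      map_smul' := fun _ _ => rfl }
  have hd : DenseRange (ev Ω) := by
    refine h.dense'.mono ?_
    rintro _ ⟨y, hy, rfl⟩
    exact ⟨⟨y, hy⟩, rfl⟩
  have hb : ∀ y, ‖ev v y‖ ≤ r * ‖ev Ω y‖ := fun y => hv y y.2
  set x := (ev v).extendOfNorm (ev Ω)
  have hx : ∀ y ∈ M.commutant, x (y Ω) = y v := fun y hy =>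
    LinearMap.extendOfNorm_eq hd ⟨r, hb⟩ ⟨y, hy⟩
  refine ⟨x, mem_of_forall_commutant fun y hy w => ?_, ?_, ?_⟩
  · have : y * x = x * y := h.ext_commutant fun z hz => by
      rw [mul_apply_eq_comp, mul_apply_eq_comp, hx z hz, ← mul_apply_eq_comp y z Ω,
        hx _ (mul_mem hy hz), mul_apply_eq_comp]
    exact DFunLike.congr_fun this w
  · exact hx 1 (one_mem _)
  · exact LinearMap.opNorm_extendOfNorm_le hd hr hb

end IsCyclicSeparating

/-- The vectors `x Ω` with `x ∈ M` self-adjoint of norm at most `r`, described by means of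
the commutant. -/
def saBall (M : VonNeumannAlgebra E) (Ω : E) (r : ℝ) : Set E :=
  {v | ∀ y ∈ M.commutant, ‖y v‖ ≤ r * ‖y Ω‖ ∧ ⟪v, y Ω⟫_ℂ = ⟪star y Ω, v⟫_ℂ}

theorem isClosed_saBall (M : VonNeumannAlgebra E) (Ω : E) (r : ℝ) : IsClosed (saBall M Ω r) := by
  have : saBall M Ω r = ⋂ y ∈ M.commutant,
      ({v : E | ‖y v‖ ≤ r * ‖y Ω‖} ∩ {v : E | ⟪v, y Ω⟫_ℂ = ⟪star y Ω, v⟫_ℂ}) := by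
    ext v
    simp only [saBall, Set.mem_iInter, Set.mem_inter_iff, Set.mem_ofPred_eq]
  rw [this]
  refine isClosed_iInter fun y => isClosed_iInter fun _ => ?_
  exact (isClosed_le (by fun_prop) continuous_const).inter (isClosed_eq (by fun_prop) (by fun_prop))

theorem convex_saBall (M : VonNeumannAlgebra E) (Ω : E) (r : ℝ) : Convex ℝ (saBall M Ω r) := by
  intro v hv w hw a b ha hb hab y hy
  refine ⟨?_, ?_⟩
  · rw [map_add]
    refine (norm_add_le _ _).trans ?_
    rw [← Complex.coe_smul, ← Complex.coe_smul, map_smul, map_smul, norm_smul, norm_smul,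
      Complex.norm_real, Complex.norm_real, Real.norm_of_nonneg ha, Real.norm_of_nonneg hb]
    calc a * ‖y v‖ + b * ‖y w‖ ≤ a * (r * ‖y Ω‖) + b * (r * ‖y Ω‖) := by
          gcongr
          exacts [(hv y hy).1, (hw y hy).1]
      _ = r * ‖y Ω‖ := by rw [← add_mul, hab, one_mul]
  · rw [← Complex.coe_smul, ← Complex.coe_smul, inner_add_left, inner_add_right, inner_smul_left,
      inner_smul_left, inner_smul_right, inner_smul_right, (hv y hy).2, (hw y hy).2,
      Complex.conj_ofReal, Complex.conj_ofReal]

theorem apply_mem_saBall {M : VonNeumannAlgebra E} {Ω : E} {r : ℝ} {x : E →L[ℂ] E} (hx : x ∈ M)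
    (hs : star x = x) (hr : ‖x‖ ≤ r) : x Ω ∈ saBall M Ω r := by
  intro y hy
  refine ⟨?_, ?_⟩
  · rw [← apply_comm hx hy]
    exact (x.le_opNorm _).trans (by gcongr)
  · rw [inner_apply_left, hs, apply_comm hx hy, inner_apply_right y]

namespace IsCyclicSeparating

variable {M : VonNeumannAlgebra E} {Ω : E} (h : IsCyclicSeparating M Ω)
include h

theorem exists_of_mem_saBall {r : ℝ} (hr : 0 ≤ r) {v : E} (hv : v ∈ saBall M Ω r) :
    ∃ x ∈ M, star x = x ∧ x Ω = v := by
  obtain ⟨x, hx, rfl, -⟩ := h.exists_mem_apply_eq hr fun y hy => (hv y hy).1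
  refine ⟨x, hx, ?_, rfl⟩
  refine h.ext_commutant fun y hy => h.ext_inner_commutant fun z hz => ?_
  have e := (hv (star y * z) (mul_mem (star_mem hy) hz)).2
  rw [star_mul, star_star, mul_apply_eq_comp, mul_apply_eq_comp, inner_apply_left (star z),
    star_star] at e
  rw [inner_apply_left, star_star, apply_comm hx hz, apply_comm hx hy, ← e, ← inner_apply_left y]

theorem exists_saBall_near {x' : E →L[ℂ] E} (hx' : x' ∈ M.commutant)
    {l : ℂ} (hl : 0 < l.re) {a : E →L[ℂ] E} (ha : a ∈ M) (hs : star a = a)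
    {ε : ℝ} (hε : 0 < ε) :
    ∃ s ∈ saBall M Ω (‖x'‖ / (2 * l.re)),
      (⟪a Ω, x' Ω⟫_ℂ).re ≤ (⟪a Ω, (2 * starRingEnd ℂ l) • s⟫_ℂ).re + ‖x'‖ * ε := by
  have has : IsSelfAdjoint a := hs
  set r := ‖x'‖ / (2 * l.re) with hrdef
  have hr : 0 ≤ r := by positivity
  have hden : ∀ t : ℝ, |t| + ε ≠ 0 := fun t => by positivity
  have hfc : Continuous fun t : ℝ => t / (|t| + ε) :=
    continuous_id.div (by fun_prop) hden
  have hgc : Continuous fun t : ℝ => √|t| := by fun_prop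
  have hhc : Continuous fun t : ℝ => √(max t 0) - √(max (-t) 0) := by fun_prop
  set f := cfc (fun t : ℝ => t / (|t| + ε)) a with hf
  set g := cfc (fun t : ℝ => √|t|) a with hg
  set k := cfc (fun t : ℝ => √(max t 0) - √(max (-t) 0)) a with hk
  have hfs : star f = f := (cfc_predicate (R := ℝ) _ a)
  have hgs : star g = g := (cfc_predicate (R := ℝ) _ a)
  have hks : star k = k := (cfc_predicate (R := ℝ) _ a)
  have hgk : g * k = a := by
    rw [hg, hk, ← cfc_mul (R := ℝ) (fun t : ℝ => √|t|)
      (fun t : ℝ => √(max t 0) - √(max (-t) 0)) a hgc.continuousOn hhc.continuousOn]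
    conv_rhs => rw [← cfc_id' ℝ a]
    refine congrArg (fun u : ℝ → ℝ => cfc u a) (funext fun t => ?_)
    rcases le_total 0 t with ht | ht
    · rw [abs_of_nonneg ht, max_eq_left ht, max_eq_right (by linarith), Real.sqrt_zero, sub_zero,
        Real.mul_self_sqrt ht]
    · rw [abs_of_nonpos ht, max_eq_right ht, max_eq_left (by linarith), Real.sqrt_zero, zero_sub,
        mul_neg, Real.mul_self_sqrt (by linarith), neg_neg]
  have hgg : g * g = cfc (fun t : ℝ => |t|) a := by
    rw [hg, ← cfc_mul (R := ℝ) (fun t : ℝ => √|t|) (fun t : ℝ => √|t|) a hgc.continuousOn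
      hgc.continuousOn]
    refine congrArg (fun u : ℝ → ℝ => cfc u a) (funext fun t => ?_)
    exact Real.mul_self_sqrt (abs_nonneg t)
  have hkk : k * k = cfc (fun t : ℝ => |t|) a := by
    rw [hk, ← cfc_mul (R := ℝ) (fun t : ℝ => √(max t 0) - √(max (-t) 0))
      (fun t : ℝ => √(max t 0) - √(max (-t) 0)) a hhc.continuousOn hhc.continuousOn]
    refine congrArg (fun u : ℝ → ℝ => cfc u a) (funext fun t => ?_)
    rcases le_total 0 t with ht | ht
    · rw [abs_of_nonneg ht, max_eq_left ht, max_eq_right (by linarith), Real.sqrt_zero, sub_zero,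
        Real.mul_self_sqrt ht]
    · rw [abs_of_nonpos ht, max_eq_right ht, max_eq_left (by linarith), Real.sqrt_zero, zero_sub,
        neg_mul_neg, Real.mul_self_sqrt (by linarith)]
  have hgf : g ∈ M := cfc_mem ha has hgc
  have hfM : f ∈ M := cfc_mem ha has hfc
  have hfn : ‖f‖ ≤ 1 := norm_cfc_le zero_le_one fun t _ => by
    rw [norm_div, Real.norm_eq_abs, Real.norm_eq_abs, abs_of_pos (by positivity : 0 < |t| + ε),
      div_le_one (by positivity)]
    linarith
  have hdiff : ‖cfc (fun t : ℝ => |t|) a - a * f‖ ≤ ε := by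
    have : cfc (fun t : ℝ => |t|) a - a * f
        = cfc (fun t : ℝ => |t| - t * (t / (|t| + ε))) a := by
      rw [cfc_sub (R := ℝ) (fun t : ℝ => |t|) (fun t : ℝ => t * (t / (|t| + ε))) a
        (by fun_prop) (continuous_id.mul hfc).continuousOn,
        cfc_mul (R := ℝ) (fun t : ℝ => t) (fun t : ℝ => t / (|t| + ε)) a (by fun_prop)
        hfc.continuousOn, cfc_id' ℝ a]
    rw [this]
    refine norm_cfc_le hε.le fun t _ => ?_
    have h1 : |t| - t * (t / (|t| + ε)) = ε * |t| / (|t| + ε) := by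
      have := hden t
      field_simp
      rw [← sq_abs t]; ring
    rw [h1, Real.norm_of_nonneg (by positivity), div_le_iff₀ (by positivity)]
    nlinarith [abs_nonneg t]
  have hgn : ((‖g Ω‖ ^ 2 : ℝ) : ℂ) = ⟪Ω, cfc (fun t : ℝ => |t|) a Ω⟫_ℂ := by
    rw [← hgg, mul_apply_eq_comp, inner_apply_right, hgs, inner_self_eq_norm_sq_to_K]
    push_cast; rfl
  have hkn : ((‖k Ω‖ ^ 2 : ℝ) : ℂ) = ⟪Ω, cfc (fun t : ℝ => |t|) a Ω⟫_ℂ := by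
    rw [← hkk, mul_apply_eq_comp, inner_apply_right, hks, inner_self_eq_norm_sq_to_K]
    push_cast; rfl
  have hgkn : ‖g Ω‖ = ‖k Ω‖ := by
    have : ‖g Ω‖ ^ 2 = ‖k Ω‖ ^ 2 := by exact_mod_cast hgn.trans hkn.symm
    exact (sq_eq_sq₀ (norm_nonneg _) (norm_nonneg _)).1 this
  have hfc' : a * f = f * a := by
    conv_lhs => rw [← cfc_id' ℝ a]
    conv_rhs => rw [← cfc_id' ℝ a]
    exact cfc_commute_cfc (fun t : ℝ => t) (fun t : ℝ => t / (|t| + ε)) a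
  have hreal : (⟪Ω, (a * f) Ω⟫_ℂ).im = 0 := by
    refine Complex.conj_eq_iff_im.1 ?_
    rw [inner_conj_symm, inner_apply_left, star_mul, hs, hfs, hfc']
  have hgn2 : ‖g Ω‖ ^ 2 ≤ (⟪Ω, (a * f) Ω⟫_ℂ).re + ε := by
    have h1 : ‖g Ω‖ ^ 2 = (⟪Ω, cfc (fun t : ℝ => |t|) a Ω⟫_ℂ).re := by
      rw [← hgn, Complex.ofReal_re]
    have h2 : (⟪Ω, (cfc (fun t : ℝ => |t|) a - a * f) Ω⟫_ℂ).re ≤ ε := by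
      refine (Complex.re_le_norm _).trans ((norm_inner_le_norm _ _).trans ?_)
      rw [h.norm_eq, one_mul]
      refine (ContinuousLinearMap.le_opNorm _ _).trans ?_
      rw [h.norm_eq, mul_one]; exact hdiff
    rw [sub_apply, inner_sub_right, Complex.sub_re] at h2
    linarith
  refine ⟨(r : ℂ) • f Ω, ?_, ?_⟩
  · have := apply_mem_saBall (Ω := Ω) (r := r) (smul_mem_of_mem hfM r) (by simp [hfs])
      (by rw [norm_smul, Complex.norm_real, Real.norm_of_nonneg hr]; nlinarith)
    exact this
  · have h1 : (⟪a Ω, x' Ω⟫_ℂ).re ≤ ‖x'‖ * ‖g Ω‖ ^ 2 := by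
      rw [← hgk, mul_apply_eq_comp, inner_apply_left, hgs, apply_comm hgf hx']
      refine (Complex.re_le_norm _).trans ((norm_inner_le_norm _ _).trans ?_)
      rw [← hgkn]
      calc ‖g Ω‖ * ‖x' (g Ω)‖ ≤ ‖g Ω‖ * (‖x'‖ * ‖g Ω‖) := by gcongr; exact x'.le_opNorm _
        _ = _ := by ring
    have h2 : (⟪a Ω, (2 * starRingEnd ℂ l) • (r : ℂ) • f Ω⟫_ℂ).re
        = ‖x'‖ * (⟪Ω, (a * f) Ω⟫_ℂ).re := by
      rw [inner_smul_right, inner_smul_right, inner_apply_left, hs, ← mul_apply_eq_comp,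
        ← Complex.re_add_im ⟪Ω, (a * f) Ω⟫_ℂ, hreal]
      simp [Complex.mul_re]
      rw [hrdef]; field_simp
    rw [h2]
    calc _ ≤ _ := h1
      _ ≤ ‖x'‖ * ((⟪Ω, (a * f) Ω⟫_ℂ).re + ε) := by gcongr
      _ = _ := by ring

attribute [local instance] InnerProductSpace.complexToReal

theorem exists_saProj_eq {x' : E →L[ℂ] E} (hx' : x' ∈ M.commutant) {l : ℂ} (hl : 0 < l.re) :
    ∃ x ∈ M, star x = x ∧ saProj M Ω ((2 * starRingEnd ℂ l) • x Ω) = saProj M Ω (x' Ω) := by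
  set r := ‖x'‖ / (2 * l.re) with hrdef
  have hr : 0 ≤ r := by positivity
  set c : ℂ := 2 * starRingEnd ℂ l with hc
  let B : E →L[ℝ] E := saProj M Ω ∘L (c • ContinuousLinearMap.id ℂ E).restrictScalars ℝ
  have hB : ∀ v, B v = saProj M Ω (c • v) := fun v => rfl
  set S := saBall M Ω r with hS
  have hSK : S ⊆ ((saOrbit M Ω).topologicalClosure : Set E) := by
    intro v hv
    obtain ⟨x, hx, hxs, rfl⟩ := h.exists_of_mem_saBall hr hv
    exact (saOrbit M Ω).le_topologicalClosure ⟨x, hx, hxs, rfl⟩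
  suffices hmem : saProj M Ω (x' Ω) ∈ B '' S by
    obtain ⟨v, hv, e⟩ := hmem
    obtain ⟨x, hx, hxs, rfl⟩ := h.exists_of_mem_saBall hr hv
    exact ⟨x, hx, hxs, e⟩
  have hpK : ∀ v ∈ (saOrbit M Ω).topologicalClosure, saProj M Ω v = v := fun v hv =>
    Submodule.starProjection_eq_self_iff.2 hv
  have hclosed : IsClosed (B '' S) := by
    let B' := B ∘L (saOrbit M Ω).topologicalClosure.subtypeL
    have hbound : ∀ v, ‖v‖ ≤ ((2 * l.re)⁻¹.toNNReal : NNReal) * ‖B' v‖ := by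
      intro v
      rw [Real.coe_toNNReal _ (by positivity)]
      have h1 : (⟪(v : E), B' v⟫_ℂ).re = 2 * l.re * ‖v‖ ^ 2 := by
        change (⟪(v : E), saProj M Ω (c • (v : E))⟫_ℂ).re = _
        rw [← re_inner_saProj, hpK v v.2, inner_smul_right, inner_self_eq_norm_sq_to_K, hc]
        simp [Complex.mul_re, ← Complex.ofReal_pow]
      have h2 : (⟪(v : E), B' v⟫_ℂ).re ≤ ‖v‖ * ‖B' v‖ :=
        (Complex.re_le_norm _).trans (norm_inner_le_norm _ _)
      rw [h1] at h2
      rcases eq_or_lt_of_le (norm_nonneg v) with h0 | h0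
      · rw [← h0]; positivity
      · rw [inv_mul_eq_div, le_div_iff₀ (by positivity)]
        nlinarith
    have hemb := (ContinuousLinearMap.antilipschitz_of_bound B' hbound).isClosedEmbedding
      B'.uniformContinuous
    have himg : B '' S = B' '' (Subtype.val ⁻¹' S) := by
      ext w
      constructor
      · rintro ⟨v, hv, rfl⟩
        exact ⟨⟨v, hSK hv⟩, hv, rfl⟩
      · rintro ⟨v, hv, rfl⟩
        exact ⟨v, hv, rfl⟩
    rw [himg]
    exact hemb.isClosedMap _ ((isClosed_saBall M Ω r).preimage continuous_subtype_val)
  by_contra hnot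
  obtain ⟨φ, u, hφ, hu⟩ := geometric_hahn_banach_closed_point
    ((convex_saBall M Ω r).linear_image (B : E →ₗ[ℝ] E)) hclosed hnot
  set w := (InnerProductSpace.toDual ℝ E).symm φ with hw
  have hφw : ∀ v, φ (saProj M Ω v) = (⟪saProj M Ω w, v⟫_ℂ).re := by
    intro v
    rw [re_inner_saProj]
    exact (InnerProductSpace.toDual_symm_apply (𝕜 := ℝ) (x := saProj M Ω v) (y := φ)).symm
  rw [hφw] at hu
  set q := saProj M Ω w with hq
  set gap := (⟪q, x' Ω⟫_ℂ).re - u with hgap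
  have hgap0 : 0 < gap := by simp only [hgap]; linarith
  set C := ‖c‖ * r + ‖x' Ω‖ with hC
  have hC0 : 0 ≤ C := by positivity
  obtain ⟨_, ⟨a, ha, has, rfl⟩, hd⟩ := Metric.mem_closure_iff.1 (saProj_mem_closure M Ω w)
    (gap / 2 / (C + 1)) (by positivity)
  rw [dist_eq_norm] at hd
  obtain ⟨s, hs, hle⟩ := h.exists_saBall_near hx' hl ha has
    (ε := gap / 2 / (‖x'‖ + 1)) (by positivity)
  have hs1 : ‖s‖ ≤ r := by
    have := (hs 1 (one_mem _)).1
    simpa [h.norm_eq] using this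
  have hlt : (⟪q, c • s⟫_ℂ).re < u := by
    rw [← hφw]; exact hφ _ ⟨s, hs, rfl⟩
  have e1 : (⟪q - a Ω, x' Ω⟫_ℂ).re ≤ ‖q - a Ω‖ * ‖x' Ω‖ :=
    (Complex.re_le_norm _).trans (norm_inner_le_norm _ _)
  have e2 : -(⟪q - a Ω, c • s⟫_ℂ).re ≤ ‖q - a Ω‖ * (‖c‖ * r) := by
    rw [← Complex.neg_re, ← inner_neg_right]
    refine (Complex.re_le_norm _).trans ((norm_inner_le_norm _ _).trans ?_)
    rw [norm_neg, norm_smul]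
    gcongr
  rw [inner_sub_left, Complex.sub_re] at e1 e2
  have e3 : ‖q - a Ω‖ * C ≤ gap / 2 := by
    calc ‖q - a Ω‖ * C ≤ gap / 2 / (C + 1) * (C + 1) := by gcongr; linarith
      _ = gap / 2 := by field_simp
  have e4 : ‖x'‖ * (gap / 2 / (‖x'‖ + 1)) ≤ gap / 2 := by
    rw [mul_div_assoc', div_le_iff₀ (by positivity)]
    nlinarith [norm_nonneg x']
  rw [hC, mul_add] at e3
  linarith

/-- A linear Radon-Nikodym theorem comparing `M` with its commutant. -/
theorem exists_radonNikodym {x' : E →L[ℂ] E} (hx' : x' ∈ M.commutant) (hs : star x' = x')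
    {l : ℂ} (hl : 0 < l.re) :
    ∃ x ∈ M, star x = x ∧ ∀ a ∈ M,
      ⟪Ω, x' (a Ω)⟫_ℂ = l * ⟪Ω, x (a Ω)⟫_ℂ + starRingEnd ℂ l * ⟪Ω, a (x Ω)⟫_ℂ := by
  obtain ⟨x, hx, hxs, e⟩ := h.exists_saProj_eq hx' hl
  refine ⟨x, hx, hxs, ?_⟩
  have key : ∀ a ∈ M, star a = a →
      ⟪Ω, x' (a Ω)⟫_ℂ = l * ⟪Ω, x (a Ω)⟫_ℂ + starRingEnd ℂ l * ⟪Ω, a (x Ω)⟫_ℂ := by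
    intro a ha has
    have h1 : (⟪(2 * starRingEnd ℂ l) • x Ω, a Ω⟫_ℂ).re = (⟪x' Ω, a Ω⟫_ℂ).re := by
      rw [← saProj_eq_self_of_mem M Ω ha has, ← re_inner_saProj, e, re_inner_saProj]
    have h2 : ⟪Ω, x (a Ω)⟫_ℂ = starRingEnd ℂ ⟪Ω, a (x Ω)⟫_ℂ := by
      rw [inner_conj_symm, inner_apply_left a, has, inner_apply_left x, hxs]
    have h3 : starRingEnd ℂ ⟪Ω, x' (a Ω)⟫_ℂ = ⟪Ω, x' (a Ω)⟫_ℂ := by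
      rw [inner_conj_symm, inner_apply_left, hs, inner_apply_left, has, apply_comm ha hx']
    have h4 : ((⟪Ω, x' (a Ω)⟫_ℂ).re : ℂ) = ⟪Ω, x' (a Ω)⟫_ℂ := Complex.conj_eq_iff_re.1 h3
    rw [← h4, inner_apply_right x', hs, ← h1, inner_smul_left, inner_apply_left x, hxs, h2]
    generalize ⟪Ω, a (x Ω)⟫_ℂ = w
    apply Complex.ext <;> simp [Complex.mul_re, Complex.mul_im] <;> ring
  intro a ha
  obtain ⟨b, hb, c, hc, hbs, hcs, e1, -⟩ := exists_selfAdjoint_decomp ha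
  have h1 := key b hb hbs
  have h2 := key c hc hcs
  simp only [e1, add_apply, smul_apply, map_add, map_smul, inner_add_right, inner_smul_right,
    h1, h2]
  ring

end IsCyclicSeparating

end RadonNikodym

section StripIntegral

variable {E : Type*} [NormedAddCommGroup E] [InnerProductSpace ℂ E] [CompleteSpace E]

theorem exists_norm_modExp_le (P : E →L[ℂ] E) (n : ℕ) :
    ∃ C : ℝ, 0 ≤ C ∧ ∀ z : ℂ, |z.re| ≤ 1 → ∀ v, ‖modExp P n z v‖ ≤ C * ‖v‖ := by
  have hc : Continuous fun s : ℝ => ‖modExp P n s‖ :=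
    ((differentiable_modExp P n).continuous.comp Complex.continuous_ofReal).norm
  obtain ⟨C, hC⟩ := (isCompact_Icc (a := (-1 : ℝ)) (b := 1)).exists_bound_of_continuousOn
    hc.continuousOn
  have hC0 : 0 ≤ C := (norm_nonneg _).trans (hC 0 (by simp))
  refine ⟨C, hC0, fun z hz v => ?_⟩
  have e : z = (z.re : ℂ) + -((-z.im : ℝ) * Complex.I) := by
    apply Complex.ext <;> simp
  rw [e, modExp_add]
  refine (ContinuousLinearMap.le_opNorm _ _).trans ?_
  rw [norm_modExp_mul_I]
  have := hC z.re (abs_le.1 hz)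
  rw [norm_norm] at this
  gcongr

namespace IsModularPair

variable {P : E →L[ℂ] E} {K : E →L[ℝ] E} (h : IsModularPair P K)
include h

theorem modSqrt_modExp (n : ℕ) (z : ℂ) (v : E) :
    modSqrt P (modExp P n z v) = modExp P n z (modSqrt P v) :=
  comm_modExp h.isSelfAdjoint h.modSqrt_comm_P n z v

theorem isStripFun_inner_modExp (n : ℕ) (x : E →L[ℂ] E) (η ξ : E) :
    IsStripFun fun z => ⟪η, modExp P n (1 / 2 + Complex.I * z)
      (x (modExp P n (-(1 / 2) - Complex.I * z) ξ))⟫_ℂ := by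
  have hd : Differentiable ℂ fun z => ⟪η, modExp P n (1 / 2 + Complex.I * z)
      (x (modExp P n (-(1 / 2) - Complex.I * z) ξ))⟫_ℂ := by
    have h1 : Differentiable ℂ fun z => modExp P n (1 / 2 + Complex.I * z) :=
      (differentiable_modExp P n).comp (by fun_prop)
    have h2 : Differentiable ℂ fun z => modExp P n (-(1 / 2) - Complex.I * z) :=
      (differentiable_modExp P n).comp (by fun_prop)
    exact (innerSL ℂ η).differentiable.comp
      (h1.clm_apply (x.differentiable.comp (h2.clm_apply (differentiable_const ξ))))
  refine ⟨?_, hd.continuous.continuousOn, fun z _ _ => hd z⟩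
  obtain ⟨C, hC0, hC⟩ := exists_norm_modExp_le P n
  refine ⟨‖η‖ * (C * (‖x‖ * (C * ‖ξ‖))), fun z h0 h1 => ?_⟩
  refine (norm_inner_le_norm _ _).trans ?_
  gcongr
  refine (hC _ (by simp [abs_le]; constructor <;> linarith) _).trans ?_
  gcongr
  refine (x.le_opNorm _).trans ?_
  gcongr
  exact hC _ (by simp [abs_le]; constructor <;> linarith) _

theorem continuous_inner_modU (y : E →L[ℂ] E) (η ξ : E) :
    Continuous fun t => ⟪modU P t η, y (modU P t ξ)⟫_ℂ :=
  (h.continuous_modU η).inner (y.continuous.comp (h.continuous_modU ξ))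

theorem norm_inner_modU_le (y : E →L[ℂ] E) (η ξ : E) (t : ℝ) :
    ‖⟪modU P t η, y (modU P t ξ)⟫_ℂ‖ ≤ ‖η‖ * (‖y‖ * ‖ξ‖) := by
  refine (norm_inner_le_norm _ _).trans ?_
  rw [h.norm_modU]
  gcongr
  exact (y.le_opNorm _).trans_eq (by rw [h.norm_modU])

theorem continuous_integral_inner_modU {p : ℝ} (hp : |p| ≤ 1) (y : E →L[ℂ] E) :
    Continuous fun w : E × E =>
      ∫ t, stripKernel p t • ⟪modU P t w.1, y (modU P t w.2)⟫_ℂ := by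
  rw [continuous_iff_continuousAt]
  intro w₀
  refine MeasureTheory.continuousAt_of_dominated
    (bound := fun t => stripKernel p t * ((‖w₀.1‖ + 1) * (‖y‖ * (‖w₀.2‖ + 1)))) ?_ ?_ ?_ ?_
  · exact .of_forall fun w => ((continuous_stripKernel p).smul
      (h.continuous_inner_modU y w.1 w.2)).aestronglyMeasurable
  · have e1 : ∀ᶠ w : E × E in nhds w₀, ‖w.1‖ < ‖w₀.1‖ + 1 :=
      (continuous_fst.norm.tendsto w₀).eventually_lt_const (lt_add_one _)
    have e2 : ∀ᶠ w : E × E in nhds w₀, ‖w.2‖ < ‖w₀.2‖ + 1 :=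
      (continuous_snd.norm.tendsto w₀).eventually_lt_const (lt_add_one _)
    filter_upwards [e1, e2] with w h1 h2
    refine .of_forall fun t => ?_
    rw [norm_smul, Real.norm_of_nonneg (stripKernel_pos p t).le]
    have := (stripKernel_pos p t).le
    refine mul_le_mul_of_nonneg_left ((h.norm_inner_modU_le y _ _ t).trans ?_) this
    gcongr
  · exact (integrable_stripKernel hp).mul_const _
  · refine .of_forall fun t => Continuous.continuousAt ?_
    fun_prop

/-- An operator determined by another one through the modular weights is a strip average. -/
theorem integral_stripKernel_inner_modU {p : ℝ} (hp : |p| ≤ 1) {x y : E →L[ℂ] E}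
    (hxy : ∀ η ξ, ⟪modSqrt P η, y (modSqrt P ξ)⟫_ℂ =
      Complex.exp (p / 2 * Complex.I) * ⟪η - P η, x (P ξ)⟫_ℂ +
      Complex.exp (-(p / 2 * Complex.I)) * ⟪P η, x (ξ - P ξ)⟫_ℂ) (η ξ : E) :
    ∫ t, stripKernel p t • ⟪modU P t η, y (modU P t ξ)⟫_ℂ = stripConst p * ⟪η, x ξ⟫_ℂ := by
  have hcl : IsClosed {w : E × E | ∫ t, stripKernel p t • ⟪modU P t w.1, y (modU P t w.2)⟫_ℂ =
      stripConst p * ⟪w.1, x w.2⟫_ℂ} := by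
    refine isClosed_eq (h.continuous_integral_inner_modU hp y) ?_
    fun_prop
  have hbase : ∀ n a b, (modSqrt P (cutoff P n a), modSqrt P (cutoff P n b)) ∈
      {w : E × E | ∫ t, stripKernel p t • ⟪modU P t w.1, y (modU P t w.2)⟫_ℂ =
      stripConst p * ⟪w.1, x w.2⟫_ℂ} := by
    intro n a b
    have h0 : (⟪modSqrt P (cutoff P n a), x (modSqrt P (cutoff P n b))⟫_ℂ) =
        (fun z => ⟪modSqrt P (cutoff P n a), modExp P n (1 / 2 + Complex.I * z)
      (x (modExp P n (-(1 / 2) - Complex.I * z) (modSqrt P (cutoff P n b))))⟫_ℂ)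
        (Complex.I / 2) := by
      have e1 : 1 / 2 + Complex.I * (Complex.I / 2) = 0 := by
        linear_combination (1 / 2) * Complex.I_mul_I
      have e2 : -(1 / 2) - Complex.I * (Complex.I / 2) = 0 := by
        linear_combination (-1 / 2) * Complex.I_mul_I
      simp only [e1, e2, modExp_zero]
    simp only [Set.mem_ofPred_eq]
    rw [h0, ← (h.isStripFun_inner_modExp n x _ _).integral_eq hp]
    congr 1
    ext t
    congr 1
    have key : ∀ (c : ℂ) v, modExp P n (c - t * Complex.I) (modSqrt P (cutoff P n v)) =
        modSqrt P (modExp P n c (cutoff P n (modU P t v))) := by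
      intro c v
      rw [sub_eq_add_neg, modExp_add, h.modSqrt_modExp, ← h.modSqrt_modExp, ← h.modU_cutoff,
        ← h.cutoff_modU, ← h.modSqrt_modExp]
    have e1 : starRingEnd ℂ (1 / 2 + Complex.I * t) = 1 / 2 - t * Complex.I := by
      simp [Complex.conj_ofNat]; ring
    have e2 : starRingEnd ℂ (1 / 2 + Complex.I * (t + Complex.I)) = -(1 / 2) - t * Complex.I := by
      rw [mul_add, Complex.I_mul_I]; simp [Complex.conj_ofNat]; ring
    have e3 : -(1 / 2) - Complex.I * t = -(1 / 2) - t * Complex.I := by ring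
    have e4 : -(1 / 2) - Complex.I * (t + Complex.I) = 1 / 2 - t * Complex.I := by
      linear_combination (-1) * Complex.I_mul_I
    have m : ∀ z v w, ⟪v, modExp P n z w⟫_ℂ = ⟪modExp P n (starRingEnd ℂ z) v, w⟫_ℂ := by
      intro z v w; rw [modExp_inner, Complex.conj_conj]
    simp only [m, e1, e2, e3, e4, key]
    rw [h.modSqrt_modExp_half, h.modSqrt_modExp_neg_half, h.modSqrt_modExp_half,
      h.modSqrt_modExp_neg_half, ← hxy, h.cutoff_modU, h.cutoff_modU, h.modSqrt_modU,
      h.modSqrt_modU]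
  have hT : ∀ a b, (modSqrt P a, modSqrt P b) ∈
      {w : E × E | ∫ t, stripKernel p t • ⟪modU P t w.1, y (modU P t w.2)⟫_ℂ =
      stripConst p * ⟪w.1, x w.2⟫_ℂ} := fun a b =>
    hcl.mem_of_tendsto ((((modSqrt P).continuous.tendsto a).comp (h.tendsto_cutoff a)).prodMk_nhds
      (((modSqrt P).continuous.tendsto b).comp (h.tendsto_cutoff b)))
      (.of_forall fun n => hbase n a b)
  have hd : Dense (Set.range fun w : E × E => (modSqrt P w.1, modSqrt P w.2)) :=
    h.denseRange_modSqrt.prodMap h.denseRange_modSqrt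
  exact hcl.closure_subset_iff.2 (by rintro _ ⟨w, rfl⟩; exact hT w.1 w.2) (hd (η, ξ))

end IsModularPair

end StripIntegral

section ModularAlgebra

variable {E : Type*} [NormedAddCommGroup E] [InnerProductSpace ℂ E] [CompleteSpace E]

open VonNeumannAlgebra

namespace IsModularPair

variable {P : E →L[ℂ] E} {K : E →L[ℝ] E} (h : IsModularPair P K)

/-- Conjugation of an operator by the modular conjugation. -/
def conj (h : IsModularPair P K) (x : E →L[ℂ] E) : E →L[ℂ] E :=
  clmOfReal ((modJ P K).comp ((x.restrictScalars ℝ).comp (modJ P K))) fun v => by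
    change modJ P K (x (modJ P K (Complex.I • v))) = Complex.I • modJ P K (x (modJ P K v))
    rw [h.modJ_smul, map_smul, h.modJ_smul, Complex.conj_conj]

theorem conj_apply (x : E →L[ℂ] E) (v : E) : h.conj x v = modJ P K (x (modJ P K v)) := rfl

theorem inner_conj_apply (x : E →L[ℂ] E) (v w : E) :
    ⟪v, h.conj x w⟫_ℂ = ⟪h.conj (star x) v, w⟫_ℂ := by
  rw [conj_apply, conj_apply, h.modJ_inner_comm, inner_apply_left, ← inner_conj_symm,
    h.modJ_inner_comm, inner_conj_symm]

theorem conj_conj (x : E →L[ℂ] E) : h.conj (h.conj x) = x := by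
  ext v
  simp [conj_apply, h.modJ_modJ]

theorem conj_add_smul (x y : E →L[ℂ] E) (c : ℂ) :
    h.conj (x + c • y) = h.conj x + starRingEnd ℂ c • h.conj y := by
  ext v
  simp [conj_apply, h.modJ_smul]

theorem inner_apply_K (x : E →L[ℂ] E) (ξ η : E) :
    ⟪K ξ, x (K η)⟫_ℂ = ⟪modSqrt P η, h.conj (star x) (modSqrt P ξ)⟫_ℂ := by
  rw [conj_apply, h.modJ_inner_comm, h.modJ_modSqrt, h.modJ_modSqrt, inner_apply_left, star_star]

end IsModularPair

namespace IsCyclicSeparating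

variable {M : VonNeumannAlgebra E} {Ω : E} (h : IsCyclicSeparating M Ω)
include h

theorem exists_lift {y : E →L[ℂ] E} (hy : y ∈ M.commutant) :
    ∃ x ∈ M, x Ω = modP M Ω (y Ω) ∧ star x Ω = modP M Ω (star y Ω) := by
  have key : ∀ y ∈ M.commutant, star y = y → ∃ x ∈ M, star x = x ∧ x Ω = modP M Ω (y Ω) := by
    intro y hy hs
    obtain ⟨x, hx, hxs, e⟩ := h.exists_saProj_eq hy (l := 1 / 2) (by norm_num)
    refine ⟨(1 / 2 : ℂ) • x, smul_mem_of_mem hx _, by rw [star_smul, hxs]; simp [Complex.conj_ofNat], ?_⟩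
    have e1 : (2 * starRingEnd ℂ (1 / 2 : ℂ)) • x Ω = x Ω := by simp [Complex.conj_ofNat]
    rw [e1, saProj_eq_self_of_mem M Ω hx hxs, ← modP_add_modK,
      modK_apply_of_mem_commutant M Ω hy, hs, ← two_smul ℂ] at e
    rw [smul_apply, e, smul_smul]
    norm_num
  obtain ⟨b, hb, c, hc, hbs, hcs, rfl, e⟩ := exists_selfAdjoint_decomp hy
  obtain ⟨b', hb', hbs', eb⟩ := key b hb hbs
  obtain ⟨c', hc', hcs', ec⟩ := key c hc hcs
  refine ⟨b' + Complex.I • c', add_mem hb' (smul_mem_of_mem hc' _), ?_, ?_⟩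
  · simp [eb, ec]
  · rw [e, star_add, star_smul, hbs', hcs']
    simp [eb, ec, sub_eq_add_neg]

theorem inner_modK_radonNikodym {x' x : E →L[ℂ] E} (hx' : x' ∈ M.commutant) (hx : x ∈ M)
    (hxs : star x = x) {l : ℂ}
    (e : ∀ a ∈ M,
      ⟪Ω, x' (a Ω)⟫_ℂ = l * ⟪Ω, x (a Ω)⟫_ℂ + starRingEnd ℂ l * ⟪Ω, a (x Ω)⟫_ℂ) (ξ η : E) :
    ⟪modK M Ω ξ, x' (modK M Ω η)⟫_ℂ =
      l * ⟪η - modP M Ω η, x (modP M Ω ξ)⟫_ℂ +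
      starRingEnd ℂ l * ⟪modP M Ω η, x (ξ - modP M Ω ξ)⟫_ℂ := by
  have hm := h.isModularPair
  have base : ∀ z' ∈ M.commutant, ∀ y' ∈ M.commutant,
      ⟪modK M Ω (z' Ω), x' (modK M Ω (y' Ω))⟫_ℂ =
      l * ⟪y' Ω - modP M Ω (y' Ω), x (modP M Ω (z' Ω))⟫_ℂ +
      starRingEnd ℂ l * ⟪modP M Ω (y' Ω), x (z' Ω - modP M Ω (z' Ω))⟫_ℂ := by
    intro z' hz' y' hy'
    obtain ⟨z, hz, ez, ezs⟩ := h.exists_lift hz'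
    obtain ⟨y, hy, ey, eys⟩ := h.exists_lift hy'
    have kz : modK M Ω (z' Ω) = star z Ω := by
      rw [modK_apply_of_mem_commutant M Ω hz', ezs]
    have ky : modK M Ω (y' Ω) = star y Ω := by
      rw [modK_apply_of_mem_commutant M Ω hy', eys]
    have hP : ∀ a b : E, ⟪a - modP M Ω a, b⟫_ℂ = ⟪a, b - modP M Ω b⟫_ℂ := by
      intro a b; rw [inner_sub_left, inner_sub_right, modP_inner]
    have h1 : ⟪y' Ω - modP M Ω (y' Ω), x (modP M Ω (z' Ω))⟫_ℂ = ⟪Ω, x (z (star y Ω))⟫_ℂ := by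
      have : x (z Ω) - modP M Ω (x (z Ω)) = modK M Ω (star (x * z) Ω) := by
        rw [modK_apply_of_mem M Ω (star_mem (mul_mem hx hz)), star_star]
        rfl
      rw [← ez, hP, this, hm.inner_comm, ky, star_mul, hxs, mul_apply_eq_comp,
        inner_apply_left (star z), star_star, inner_apply_left x, hxs]
    have h2 : ⟪modP M Ω (y' Ω), x (z' Ω - modP M Ω (z' Ω))⟫_ℂ = ⟪Ω, z (star y (x Ω))⟫_ℂ := by
      have : x (y Ω) - modP M Ω (x (y Ω)) = modK M Ω (star (x * y) Ω) := by
        rw [modK_apply_of_mem M Ω (star_mem (mul_mem hx hy)), star_star]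
        rfl
      rw [← ey, inner_apply_right x, hxs, ← hP, this, ← inner_conj_symm, hm.inner_comm,
        inner_conj_symm, kz, star_mul, hxs, inner_apply_right z]
      rfl
    rw [kz, ky, h1, h2, inner_apply_left, star_star, ← mul_apply_eq_comp z (star y) Ω]
    have hzy := mul_mem hz (star_mem hy)
    rw [apply_comm hz hx', mul_apply_eq_comp, ← mul_apply_eq_comp z (star y), e _ hzy]
    rfl
  have hc1 : ∀ y' ∈ M.commutant, ∀ ξ,
      ⟪modK M Ω ξ, x' (modK M Ω (y' Ω))⟫_ℂ =
      l * ⟪y' Ω - modP M Ω (y' Ω), x (modP M Ω ξ)⟫_ℂ +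
      starRingEnd ℂ l * ⟪modP M Ω (y' Ω), x (ξ - modP M Ω ξ)⟫_ℂ := by
    intro y' hy' ξ
    have := Continuous.ext_on h.dense'
      (f := fun ξ => ⟪modK M Ω ξ, x' (modK M Ω (y' Ω))⟫_ℂ)
      (g := fun ξ => l * ⟪y' Ω - modP M Ω (y' Ω), x (modP M Ω ξ)⟫_ℂ +
      starRingEnd ℂ l * ⟪modP M Ω (y' Ω), x (ξ - modP M Ω ξ)⟫_ℂ) (by fun_prop) (by fun_prop)
      (by rintro _ ⟨z', hz', rfl⟩; exact base z' hz' y' hy')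
    exact congrFun this ξ
  have := Continuous.ext_on h.dense'
      (f := fun η => ⟪modK M Ω ξ, x' (modK M Ω η)⟫_ℂ)
      (g := fun η => l * ⟪η - modP M Ω η, x (modP M Ω ξ)⟫_ℂ +
      starRingEnd ℂ l * ⟪modP M Ω η, x (ξ - modP M Ω ξ)⟫_ℂ) (by fun_prop) (by fun_prop)
      (by rintro _ ⟨y', hy', rfl⟩; exact hc1 y' hy' ξ)
  exact congrFun this η

theorem modU_conj_modU_mem_of_star_eq {x' : E →L[ℂ] E} (hx' : x' ∈ M.commutant)
    (hs : star x' = x') (t : ℝ) :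
    modU (modP M Ω) (-t) * h.isModularPair.conj x' * modU (modP M Ω) t ∈ M := by
  have hm := h.isModularPair
  refine mem_of_forall_commutant fun z' hz' ξ => ?_
  refine ext_inner_left ℂ fun η => ?_
  set y := hm.conj x'
  have hrn : ∀ p : ℝ, |p| ≤ 1 → ∃ x ∈ M, ∀ η ξ,
      ∫ t, stripKernel p t • ⟪modU (modP M Ω) t η, y (modU (modP M Ω) t ξ)⟫_ℂ =
        stripConst p * ⟪η, x ξ⟫_ℂ := by
    intro p hp
    have hl : 0 < (Complex.exp (p / 2 * Complex.I)).re := by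
      rw [show (p / 2 * Complex.I : ℂ) = ((p / 2 : ℝ) : ℂ) * Complex.I by push_cast; ring,
        Complex.exp_ofReal_mul_I_re]
      apply Real.cos_pos_of_mem_Ioo
      rw [abs_le] at hp
      constructor <;> linarith [Real.pi_gt_three]
    have hlc : starRingEnd ℂ (Complex.exp (p / 2 * Complex.I)) =
        Complex.exp (-(p / 2 * Complex.I)) := by
      rw [← Complex.exp_conj]; simp [Complex.conj_ofNat]
    obtain ⟨x, hx, hxs, e⟩ := h.exists_radonNikodym hx' hs hl
    refine ⟨x, hx, hm.integral_stripKernel_inner_modU hp fun η ξ => ?_⟩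
    rw [← hlc, ← h.inner_modK_radonNikodym hx' hx hxs e, hm.inner_apply_K, hs]
  have hz := eq_zero_of_integral_stripKernel_eq_zero
    (h := fun t => ⟪modU (modP M Ω) t η, y (modU (modP M Ω) t (z' ξ))⟫_ℂ -
      ⟪modU (modP M Ω) t (star z' η), y (modU (modP M Ω) t ξ)⟫_ℂ)
    ((hm.continuous_inner_modU y _ _).sub (hm.continuous_inner_modU y _ _))
    (fun t => (norm_sub_le _ _).trans
      (add_le_add (hm.norm_inner_modU_le y _ _ t) (hm.norm_inner_modU_le y _ _ t))) ?_
  · have := congrFun hz t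
    simp only [Pi.zero_apply, sub_eq_zero] at this
    simp only [mul_apply_eq_comp]
    rw [inner_apply_right z', ← hm.modU_inner, ← hm.modU_inner, this]
  · intro p hp
    obtain ⟨x, hx, e⟩ := hrn p hp
    simp only [smul_sub]
    rw [MeasureTheory.integral_sub
      (integrable_stripKernel_smul hp (hm.continuous_inner_modU y _ _)
        (hm.norm_inner_modU_le y _ _))
      (integrable_stripKernel_smul hp (hm.continuous_inner_modU y _ _)
        (hm.norm_inner_modU_le y _ _)), e, e, inner_apply_left (star z'), star_star,
      apply_comm hx hz', sub_self]

theorem modU_conj_modU_mem {x' : E →L[ℂ] E} (hx' : x' ∈ M.commutant) (t : ℝ) :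
    modU (modP M Ω) (-t) * h.isModularPair.conj x' * modU (modP M Ω) t ∈ M := by
  obtain ⟨b, hb, c, hc, hbs, hcs, rfl, -⟩ := exists_selfAdjoint_decomp hx'
  rw [h.isModularPair.conj_add_smul, mul_add, add_mul, mul_smul_comm, smul_mul_assoc]
  exact add_mem (h.modU_conj_modU_mem_of_star_eq hb hbs t)
    (smul_mem_of_mem (h.modU_conj_modU_mem_of_star_eq hc hcs t) _)

theorem conj_commutant_mem {x' : E →L[ℂ] E} (hx' : x' ∈ M.commutant) :
    h.isModularPair.conj x' ∈ M := by
  have := h.modU_conj_modU_mem hx' 0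
  convert this using 1
  ext v
  simp [mul_apply_eq_comp, h.isModularPair.modU_zero]

theorem modJ_base : modJ (modP M Ω) (modK M Ω) Ω = Ω :=
  h.isModularPair.modJ_eq_self (modP_base M Ω) (modK_base M Ω)

theorem inner_modJ_star_eq {x y : E →L[ℂ] E} (hx : x ∈ M) (hy : y ∈ M) :
    ⟪modJ (modP M Ω) (modK M Ω) (star x Ω), y Ω⟫_ℂ =
      ⟪modSqrt (modP M Ω) (x Ω), y Ω⟫_ℂ + ⟪modSqrt (modP M Ω) (star y Ω), star x Ω⟫_ℂ := by
  have hm := h.isModularPair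
  set J := modJ (modP M Ω) (modK M Ω)
  have e1 : modP M Ω (J (star x Ω)) = modSqrt (modP M Ω) (x Ω) := by
    rw [← sub_eq_zero]
    refine hm.modSqrt_inj ?_
    rw [map_sub, hm.modSqrt_comm_P, hm.modSqrt_modJ, modK_apply_of_mem M Ω (star_mem hx),
      star_star, hm.modSqrt_modSqrt, sub_self]
  have e2 : y Ω = modP M Ω (y Ω) + J (modSqrt (modP M Ω) (star y Ω)) := by
    rw [hm.modJ_modSqrt, modK_apply_of_mem M Ω (star_mem hy), star_star]
    abel
  conv_lhs => rw [e2]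
  rw [inner_add_right, ← modP_inner, e1, hm.modJ_inner_modJ]

theorem inner_modJ_star {x y : E →L[ℂ] E} (hx : x ∈ M) (hy : y ∈ M) :
    ⟪modJ (modP M Ω) (modK M Ω) (star x Ω), y Ω⟫_ℂ =
      ⟪star y Ω, modJ (modP M Ω) (modK M Ω) (x Ω)⟫_ℂ := by
  have hm := h.isModularPair
  have hT := inner_apply_comm_of_isSelfAdjoint (isSelfAdjoint_modSqrt (modP M Ω))
  rw [h.inner_modJ_star_eq hx hy, hm.modJ_inner_comm, ← inner_conj_symm (x Ω),
    h.inner_modJ_star_eq hy hx, map_add, inner_conj_symm, inner_conj_symm, hT, hT (star y Ω)]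

theorem conj_mem {x : E →L[ℂ] E} (hx : x ∈ M) : h.isModularPair.conj x ∈ M.commutant := by
  have hm := h.isModularPair
  have hcomm : ∀ a ∈ M, ∀ m ∈ M.commutant, ∀ v,
      hm.conj a (hm.conj m v) = hm.conj m (hm.conj a v) := by
    intro a ha m hmm v
    simp only [hm.conj_apply, hm.modJ_modJ, apply_comm ha hmm]
  have hbase : ∀ a, hm.conj a Ω = modJ (modP M Ω) (modK M Ω) (a Ω) := by
    intro a
    rw [hm.conj_apply, h.modJ_base]
  have hd : Dense {w | ∃ m ∈ M.commutant, hm.conj m Ω = w} := by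
    have : DenseRange (modJ (modP M Ω) (modK M Ω)) :=
      Function.Surjective.denseRange fun v => ⟨_, hm.modJ_modJ v⟩
    refine (this.dense_image (modJ (modP M Ω) (modK M Ω)).continuous h.dense').mono ?_
    rintro _ ⟨_, ⟨m, hmm, rfl⟩, rfl⟩
    exact ⟨m, hmm, hbase m⟩
  refine mem_commutant_of_forall fun y hy => ?_
  have key : ∀ m₂ ∈ M.commutant, y (hm.conj x (hm.conj m₂ Ω)) = hm.conj x (y (hm.conj m₂ Ω)) := by
    intro m₂ h₂
    refine hd.eq_of_inner_right ℂ ?_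
    rintro _ ⟨m₁, h₁, rfl⟩
    have i₁ := h.conj_commutant_mem h₁
    have i₂ := h.conj_commutant_mem h₂
    have hy' : star (hm.conj m₁) * y * hm.conj m₂ ∈ M := mul_mem (mul_mem (star_mem i₁) hy) i₂
    have := h.inner_modJ_star hx hy'
    simp only [star_mul, star_star, mul_apply_eq_comp] at this
    rw [hm.inner_conj_apply, hcomm _ (star_mem hx) _ h₁, hbase (star x),
      inner_apply_left (hm.conj m₁) (modJ _ _ _), this, inner_apply_left (star _), star_star,
      inner_apply_left (star _), star_star, hcomm _ hx _ h₂, hbase x]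
  intro v
  exact congrFun (Continuous.ext_on hd (y.continuous.comp (hm.conj x).continuous)
    ((hm.conj x).continuous.comp y.continuous)
    (by rintro _ ⟨m, hmm, rfl⟩; exact key m hmm)) v

theorem modU_mul_mem {x : E →L[ℂ] E} (hx : x ∈ M) (t : ℝ) :
    modU (modP M Ω) (-t) * x * modU (modP M Ω) t ∈ M := by
  have := h.modU_conj_modU_mem (h.conj_mem hx) t
  rwa [h.isModularPair.conj_conj] at this

end IsCyclicSeparating

end ModularAlgebra

section ModularKMS

variable {E : Type*} [NormedAddCommGroup E] [InnerProductSpace ℂ E] [CompleteSpace E]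

open VonNeumannAlgebra Filter Topology

theorem IsModularPair.isStripFun_inner_modExp_I {P : E →L[ℂ] E} {K : E →L[ℝ] E}
    (h : IsModularPair P K) (n : ℕ) (η ξ : E) :
    IsStripFun fun z => ⟪η, modExp P n (-(z * Complex.I)) ξ⟫_ℂ := by
  have hd : Differentiable ℂ fun z => ⟪η, modExp P n (-(z * Complex.I)) ξ⟫_ℂ := by
    have h1 : Differentiable ℂ fun z => modExp P n (-(z * Complex.I)) :=
      (differentiable_modExp P n).comp (by fun_prop)
    exact (innerSL ℂ η).differentiable.comp (h1.clm_apply (differentiable_const ξ))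
  refine ⟨?_, hd.continuous.continuousOn, fun z _ _ => hd z⟩
  obtain ⟨C, hC0, hC⟩ := exists_norm_modExp_le P n
  refine ⟨‖η‖ * (C * ‖ξ‖), fun z h0 h1 => ?_⟩
  refine (norm_inner_le_norm _ _).trans ?_
  gcongr
  exact hC _ (by simp [abs_le]; constructor <;> linarith) _

namespace IsCyclicSeparating

variable {M : VonNeumannAlgebra E} {Ω : E} (h : IsCyclicSeparating M Ω)
include h

theorem exists_isStripFun_modU {a b : E →L[ℂ] E} (ha : a ∈ M) (hb : b ∈ M) :
    ∃ F, IsStripFun F ∧ (∀ t : ℝ, F t = ⟪star b Ω, modU (modP M Ω) t (a Ω)⟫_ℂ) ∧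
      ∀ t : ℝ, F (t + Complex.I) = ⟪modU (modP M Ω) t (star a Ω), b Ω⟫_ℂ := by
  have hm := h.isModularPair
  set P := modP M Ω
  set K := modK M Ω
  have hKb : K (b Ω) = star b Ω - P (star b Ω) := modK_apply_of_mem M Ω hb
  have hKb' : K (star b Ω) = b Ω - P (b Ω) := by
    simpa using modK_apply_of_mem M Ω (star_mem hb)
  have hKa' : K (star a Ω) = a Ω - P (a Ω) := by
    simpa using modK_apply_of_mem M Ω (star_mem ha)
  have hPi : ∀ v w, ⟪P v, w⟫_ℂ = ⟪v, P w⟫_ℂ := modP_inner M Ω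
  have hKc : ∀ n v, K (cutoff P n v) = cutoff P n (K v) := hm.apply_cutoff
  refine exists_isStripFun_of_tendsto
    (f := fun n z => ⟪star b Ω, modExp P n (-(z * Complex.I)) (cutoff P n (a Ω))⟫_ℂ)
    (ε := fun n => ‖star b Ω‖ * ‖cutoff P n (a Ω) - a Ω‖ +
      ‖cutoff P n (star a Ω) - star a Ω‖ * ‖b Ω‖)
    (fun n => hm.isStripFun_inner_modExp_I n _ _) ?_ ?_ ?_
  · have e1 := (tendsto_iff_norm_sub_tendsto_zero.1 (hm.tendsto_cutoff (a Ω))).const_mul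
      ‖star b Ω‖
    have e2 := (tendsto_iff_norm_sub_tendsto_zero.1 (hm.tendsto_cutoff (star a Ω))).mul_const
      ‖b Ω‖
    simpa using e1.add e2
  · intro n t
    rw [← hm.modU_cutoff, ← inner_sub_right, ← map_sub]
    refine (norm_inner_le_norm _ _).trans ?_
    rw [hm.norm_modU]
    exact le_add_of_nonneg_right (by positivity)
  · intro n t
    set ξ := cutoff P n (modU P t (star a Ω)) with hξ
    set v := modExp P n 1 (cutoff P n (modU P t (a Ω))) with hv
    have e0 : modExp P n (-((t + Complex.I) * Complex.I)) (cutoff P n (a Ω)) = v := by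
      have : -((t + Complex.I) * Complex.I) = 1 + -(t * Complex.I) := by
        linear_combination (-1) * Complex.I_mul_I
      rw [this, modExp_add, ← hm.modU_cutoff, ← hm.cutoff_modU]
    have e1 : P v = K ξ := by
      rw [hv, hm.P_modExp_cutoff, hξ, hKc, hm.apply_modU, hKa', map_sub, map_sub, ← hm.P_modU,
        hm.cutoff_comm_P]
    have e2 : K v = P ξ := by
      have := hm.apply_P v
      rw [e1, hm.apply_apply] at this
      rw [← sub_eq_zero]
      refine hm.inj' _ ?_
      have e : K v = P ξ - P (P ξ) + P (K v) := by rw [← map_sub, this]; abel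
      rw [map_sub]
      conv_rhs => rw [e]
      abel
    have e3 : ⟪star b Ω, v⟫_ℂ = ⟪ξ, b Ω⟫_ℂ := by
      have s1 : star b Ω = P (star b Ω) + K (b Ω) := by rw [hKb]; abel
      have s2 : b Ω = K (star b Ω) + P (b Ω) := by rw [hKb']; abel
      rw [s1, inner_add_left, hPi, e1, hm.inner_comm, ← inner_conj_symm (K (b Ω)),
        hm.inner_comm v, e2, inner_conj_symm, hPi, ← inner_add_right, ← s2]
    rw [e0, e3, hξ, hm.cutoff_modU, ← inner_sub_left, ← map_sub]
    refine (norm_inner_le_norm _ _).trans ?_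
    rw [hm.norm_modU]
    exact le_add_of_nonneg_left (by positivity)

end IsCyclicSeparating

/-- A strongly continuous isometric family whose matrix coefficients, weighted by `P` and
`1 - P`, are the boundary values of strip functions. -/
structure IsStripFamily (P : E →L[ℂ] E) (v : ℝ → E →L[ℂ] E) : Prop where
  norm_apply : ∀ t w, ‖v t w‖ = ‖w‖
  zero_apply : ∀ w, v 0 w = w
  cont : ∀ w, Continuous fun t => v t w
  comm : ∀ t w, v t (P w) = P (v t w)
  strip : ∀ ζ η, ∃ F, IsStripFun F ∧ (∀ t : ℝ, F t = ⟪ζ, P (v t η)⟫_ℂ) ∧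
    ∀ t : ℝ, F (t + Complex.I) = ⟪ζ, v t η - P (v t η)⟫_ℂ

namespace IsStripFamily

variable {P : E →L[ℂ] E} {v u : ℝ → E →L[ℂ] E} {p : ℝ}

theorem integrable (hv : IsStripFamily P v) (hp : |p| ≤ 1) (w : E) :
    MeasureTheory.Integrable fun t => stripKernel p t • v t w :=
  integrable_stripKernel_smul hp (hv.cont w) fun t => (hv.norm_apply t w).le

/-- The strip average of the family. -/
def avg (hv : IsStripFamily P v) (hp : |p| ≤ 1) : E →L[ℂ] E :=
  LinearMap.mkContinuous
    { toFun := fun w => ∫ t, stripKernel p t • v t w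
      map_add' := fun a b => by
        simp only [map_add, smul_add]
        exact MeasureTheory.integral_add (hv.integrable hp a) (hv.integrable hp b)
      map_smul' := fun c a => by
        simp only [map_smul, RingHom.id_apply]
        rw [← MeasureTheory.integral_smul]
        congr 1
        ext t
        exact smul_comm _ _ _ } (∫ t, stripKernel p t) fun w => by
    refine (MeasureTheory.norm_integral_le_integral_norm _).trans ?_
    simp only [norm_smul, hv.norm_apply, Real.norm_of_nonneg (stripKernel_pos p _).le]
    rw [MeasureTheory.integral_mul_const]

theorem avg_apply (hv : IsStripFamily P v) (hp : |p| ≤ 1) (w : E) :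
    hv.avg hp w = ∫ t, stripKernel p t • v t w := rfl

theorem comm_avg (hv : IsStripFamily P v) (hp : |p| ≤ 1) {B : E →L[ℂ] E}
    (hB : ∀ t w, B (v t w) = v t (B w)) (w : E) : B (hv.avg hp w) = hv.avg hp (B w) := by
  rw [avg_apply, avg_apply, ← B.integral_comp_comm (hv.integrable hp w)]
  congr 1
  ext t
  rw [← hB]
  exact (B.restrictScalars ℝ).map_smul _ _

theorem inner_avg (hv : IsStripFamily P v) (hp : |p| ≤ 1) (ζ w : E) :
    ⟪ζ, hv.avg hp w⟫_ℂ = ∫ t, stripKernel p t • ⟪ζ, v t w⟫_ℂ := by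
  rw [avg_apply, ← integral_inner (hv.integrable hp w)]
  congr 1
  ext t
  rw [inner_smul_right_eq_smul]

theorem weight_avg (hv : IsStripFamily P v) (hp : |p| ≤ 1) (w : E) :
    Complex.exp (p / 2 * Complex.I) • P (hv.avg hp w) +
      Complex.exp (-(p / 2 * Complex.I)) • (hv.avg hp w - P (hv.avg hp w)) =
    ((stripConst p / stripConst 0 : ℝ) : ℂ) • hv.avg (p := 0) (by simp) w := by
  have hP : ∀ {q : ℝ} (hq : |q| ≤ 1), P (hv.avg hq w) = hv.avg hq (P w) := fun hq =>
    hv.comm_avg hq (fun t x => (hv.comm t x).symm) w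
  refine ext_inner_left ℂ fun ζ => ?_
  obtain ⟨F, hF, h0, h1⟩ := hv.strip ζ w
  have key : ∀ {q : ℝ} (hq : |q| ≤ 1), ⟪ζ, Complex.exp (q / 2 * Complex.I) • P (hv.avg hq w) +
      Complex.exp (-(q / 2 * Complex.I)) • (hv.avg hq w - P (hv.avg hq w))⟫_ℂ =
      stripConst q * F (Complex.I / 2) := by
    intro q hq
    rw [← hF.integral_eq hq, hP hq, ← map_sub, ← map_smul (hv.avg hq), ← map_smul (hv.avg hq),
      ← map_add, hv.inner_avg hq]
    congr 1
    ext t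
    rw [h0, h1, map_add, map_smul, map_smul, map_sub, hv.comm, inner_add_right, inner_smul_right,
      inner_smul_right]
  have k0 := key (q := 0) (by simp)
  have hc : stripConst 0 ≠ 0 := (stripConst_pos (by simp)).ne'
  rw [key hp, inner_smul_right]
  have : ⟪ζ, hv.avg (p := 0) (by simp) w⟫_ℂ = stripConst 0 * F (Complex.I / 2) := by
    rw [← k0]; simp
  rw [this]
  push_cast
  have hc' : (stripConst 0 : ℂ) ≠ 0 := by exact_mod_cast hc
  field_simp

theorem weight_inj (hP : ∀ a b, ⟪P a, b⟫_ℂ = ⟪a, P b⟫_ℂ) (hp : |p| ≤ 1) {w : E}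
    (hw : Complex.exp (p / 2 * Complex.I) • P w +
      Complex.exp (-(p / 2 * Complex.I)) • (w - P w) = 0) : w = 0 := by
  have hc : 0 < Real.cos (p / 2) := by
    apply Real.cos_pos_of_mem_Ioo
    rw [abs_le] at hp
    constructor <;> linarith [Real.pi_gt_three]
  have h1 : (⟪w, Complex.exp (p / 2 * Complex.I) • P w +
      Complex.exp (-(p / 2 * Complex.I)) • (w - P w)⟫_ℂ).re = Real.cos (p / 2) * ‖w‖ ^ 2 := by
    have e1 : Complex.exp (p / 2 * Complex.I) =
        Real.cos (p / 2) + Real.sin (p / 2) * Complex.I := by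
      rw [Complex.exp_mul_I]; push_cast; rfl
    have e2 : Complex.exp (-(p / 2 * Complex.I)) =
        Real.cos (p / 2) - Real.sin (p / 2) * Complex.I := by
      rw [← neg_mul, Complex.exp_mul_I, Complex.cos_neg, Complex.sin_neg]; push_cast; ring
    have e3 : (⟪w, P w⟫_ℂ).im = 0 := by
      have := congrArg Complex.im (inner_conj_symm (𝕜 := ℂ) w (P w))
      rw [hP, Complex.conj_im] at this
      linarith
    have e4 : ⟪w, w⟫_ℂ = (‖w‖ : ℂ) ^ 2 := inner_self_eq_norm_sq_to_K w
    rw [inner_add_right, inner_smul_right, inner_smul_right, inner_sub_right, e1, e2, e4,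
      ← Complex.ofReal_pow]
    simp only [Complex.add_re, Complex.mul_re, Complex.sub_re, Complex.ofReal_re,
      Complex.ofReal_im, Complex.I_re, Complex.I_im, Complex.sub_im, Complex.add_im,
      Complex.mul_im, e3]
    ring
  rw [hw, inner_zero_right, Complex.zero_re] at h1
  have : ‖w‖ ^ 2 = 0 := by
    rcases mul_eq_zero.1 h1.symm with h2 | h2
    · exact absurd h2 hc.ne'
    · exact h2
  simpa using this

theorem eq_zero_of_avg (hv : IsStripFamily P v)
    (hP : ∀ a b, ⟪P a, b⟫_ℂ = ⟪a, P b⟫_ℂ) {w : E}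
    (hw : hv.avg (p := 0) (by simp) w = 0) : w = 0 := by
  have : ∀ p, ∀ hp : |p| ≤ 1, hv.avg hp w = 0 := fun p hp =>
    weight_inj hP hp (by rw [hv.weight_avg hp, hw, smul_zero])
  rw [← hv.zero_apply w]
  refine ext_inner_left ℂ fun ζ => ?_
  have hz := eq_zero_of_integral_stripKernel_eq_zero (h := fun t => ⟪ζ, v t w⟫_ℂ)
    (C := ‖ζ‖ * ‖w‖) (continuous_const.inner (hv.cont w))
    (fun t => (norm_inner_le_norm _ _).trans (by rw [hv.norm_apply])) (fun p hp => by
      rw [← hv.inner_avg hp, this p hp, inner_zero_right])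
  rw [inner_zero_right]
  exact congrFun hz 0

/-- Two commuting strip families for the same weight coincide. -/
theorem eq_of_comm (hv : IsStripFamily P v) (hu : IsStripFamily P u)
    (hP : ∀ a b, ⟪P a, b⟫_ℂ = ⟪a, P b⟫_ℂ)
    (hc : ∀ s t w, u s (v t w) = v t (u s w)) (t : ℝ) : v t = u t := by
  have h0 : |(0 : ℝ)| ≤ 1 := by simp
  set R := hv.avg h0 with hR
  set S := hu.avg h0 with hS
  have hSv : ∀ t w, S (v t w) = v t (S w) := fun t w =>
    (hu.comm_avg h0 (B := v t) (fun s w => (hc s t w).symm) w).symm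
  have hRu : ∀ t w, R (u t w) = u t (R w) := fun t w =>
    (hv.comm_avg h0 (B := u t) (fun s w => hc t s w) w).symm
  have hSR : ∀ w, S (R w) = R (S w) := hv.comm_avg h0 hSv
  have hSP : ∀ w, S (P w) = P (S w) := fun w =>
    (hu.comm_avg h0 (fun s w => (hu.comm s w).symm) w).symm
  have hRP : ∀ w, R (P w) = P (R w) := fun w =>
    (hv.comm_avg h0 (fun s w => (hv.comm s w).symm) w).symm
  have key : ∀ p, ∀ hp : |p| ≤ 1, ∀ w, S (hv.avg hp w) = R (hu.avg hp w) := by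
    intro p hp w
    rw [← sub_eq_zero]
    refine weight_inj hP hp ?_
    have e1 := congrArg S (hv.weight_avg hp w)
    have e2 := congrArg R (hu.weight_avg hp w)
    rw [← hR, map_add, map_smul, map_smul, map_smul, map_sub, hSP, hSR] at e1
    rw [← hS, map_add, map_smul, map_smul, map_smul, map_sub, hRP, ← e1] at e2
    rw [← sub_eq_zero] at e2
    rw [← neg_eq_zero, ← e2]
    simp only [map_sub, smul_sub]
    abel
  have key2 : ∀ t w, S (v t w) = R (u t w) := by
    intro t w
    refine ext_inner_left ℂ fun ζ => ?_
    have hz := eq_zero_of_integral_stripKernel_eq_zero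
      (h := fun t => ⟪ζ, v t (S w)⟫_ℂ - ⟪ζ, u t (R w)⟫_ℂ)
      (C := ‖ζ‖ * ‖S w‖ + ‖ζ‖ * ‖R w‖)
      ((continuous_const.inner (hv.cont _)).sub (continuous_const.inner (hu.cont _)))
      (fun t => (norm_sub_le _ _).trans (add_le_add
        ((norm_inner_le_norm _ _).trans (by rw [hv.norm_apply]))
        ((norm_inner_le_norm _ _).trans (by rw [hu.norm_apply])))) (fun p hp => by
        have b1 : MeasureTheory.Integrable fun t => stripKernel p t • ⟪ζ, v t (S w)⟫_ℂ :=
          integrable_stripKernel_smul hp (continuous_const.inner (hv.cont _))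
            (fun t => (norm_inner_le_norm _ _).trans (by rw [hv.norm_apply]))
        have b2 : MeasureTheory.Integrable fun t => stripKernel p t • ⟪ζ, u t (R w)⟫_ℂ :=
          integrable_stripKernel_smul hp (continuous_const.inner (hu.cont _))
            (fun t => (norm_inner_le_norm _ _).trans (by rw [hu.norm_apply]))
        simp only [smul_sub]
        rw [MeasureTheory.integral_sub b1 b2, ← hv.inner_avg hp, ← hu.inner_avg hp,
          ← hv.comm_avg hp hSv, ← hu.comm_avg hp hRu, key, sub_self])
    rw [hSv, hRu]
    exact sub_eq_zero.1 (congrFun hz t)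
  have hRS : ∀ w, S w = R w := fun w => by
    simpa [hv.zero_apply, hu.zero_apply] using key2 0 w
  ext w
  rw [← sub_eq_zero]
  refine hv.eq_zero_of_avg hP ?_
  rw [map_sub]
  change R _ - R _ = 0
  rw [← key2, hRS, sub_self]

end IsStripFamily

end ModularKMS

section ModularUniqueness

variable {E : Type*} [NormedAddCommGroup E] [InnerProductSpace ℂ E] [CompleteSpace E]

open VonNeumannAlgebra Filter Topology

theorem inner_apply_eq_of_norm_apply {v : E →L[ℂ] E} (hv : ∀ w, ‖v w‖ = ‖w‖) (a b : E) :
    ⟪v a, v b⟫_ℂ = ⟪a, b⟫_ℂ :=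
  LinearIsometry.inner_map_map ⟨(v : E →ₗ[ℂ] E), hv⟩ a b

/-- A weakly continuous isometric family is strongly continuous. -/
theorem continuous_of_continuous_inner {v : ℝ → E →L[ℂ] E} (hv : ∀ t w, ‖v t w‖ = ‖w‖)
    {w : E} (hw : ∀ ζ, Continuous fun t => ⟪ζ, v t w⟫_ℂ) : Continuous fun t => v t w := by
  rw [continuous_iff_continuousAt]
  intro s
  rw [ContinuousAt, tendsto_iff_norm_sub_tendsto_zero]
  have h1 : Tendsto (fun t => ‖v t w - v s w‖ ^ 2) (𝓝 s) (𝓝 0) := by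
    have e : ∀ t, ‖v t w - v s w‖ ^ 2 = 2 * ‖w‖ ^ 2 - 2 * (⟪v s w, v t w⟫_ℂ).re := by
      intro t
      rw [@norm_sub_sq ℂ, hv, hv, inner_re_symm]
      change _ - 2 * (⟪v s w, v t w⟫_ℂ).re + _ = _
      ring
    simp only [e]
    have h2 : Tendsto (fun t => (⟪v s w, v t w⟫_ℂ).re) (𝓝 s) (𝓝 ((⟪v s w, v s w⟫_ℂ).re)) :=
      (Complex.continuous_re.comp (hw (v s w))).tendsto s
    have h3 : (⟪v s w, v s w⟫_ℂ).re = ‖w‖ ^ 2 := by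
      rw [inner_apply_eq_of_norm_apply (hv s)]
      exact inner_self_eq_norm_sq (𝕜 := ℂ) w
    have := (h2.const_mul 2).const_sub (2 * ‖w‖ ^ 2)
    rwa [h3, sub_self] at this
  have := h1.sqrt
  simpa [Real.sqrt_sq] using this

namespace IsCyclicSeparating

variable {M : VonNeumannAlgebra E} {Ω : E} (h : IsCyclicSeparating M Ω)
include h

theorem isStripFamily {v : ℝ → E →L[ℂ] E} (hv : ∀ t w, ‖v t w‖ = ‖w‖) (h0 : ∀ w, v 0 w = w)
    (hP : ∀ t w, v t (modP M Ω w) = modP M Ω (v t w))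
    (hK : ∀ t w, v t (modK M Ω w) = modK M Ω (v t w))
    (hs : ∀ a ∈ M, ∀ b ∈ M, ∃ F, IsStripFun F ∧
      (∀ t : ℝ, F t = ⟪star b Ω, v t (a Ω)⟫_ℂ) ∧
      ∀ t : ℝ, F (t + Complex.I) = ⟪v t (star a Ω), b Ω⟫_ℂ) :
    IsStripFamily (modP M Ω) v := by
  have hm := h.isModularPair
  have hPi : ∀ v w, ⟪modP M Ω v, w⟫_ℂ = ⟪v, modP M Ω w⟫_ℂ := modP_inner M Ω
  have base : ∀ y' ∈ M.commutant, ∀ a ∈ M, ∃ F, IsStripFun F ∧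
      (∀ t : ℝ, F t = ⟪y' Ω, modP M Ω (v t (a Ω))⟫_ℂ) ∧
      ∀ t : ℝ, F (t + Complex.I) = ⟪y' Ω, v t (a Ω) - modP M Ω (v t (a Ω))⟫_ℂ := by
    intro y' hy' a ha
    obtain ⟨y, hy, ey, eys⟩ := h.exists_lift hy'
    obtain ⟨F, hF, e0, e1⟩ := hs a ha (star y) (star_mem hy)
    refine ⟨F, hF, fun t => ?_, fun t => ?_⟩
    · rw [e0, star_star, ey, hPi]
    · rw [e1, eys, ← modK_apply_of_mem_commutant M Ω hy', hm.inner_comm, ← hK,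
        modK_apply_of_mem M Ω (star_mem ha), star_star, map_sub, hP]
  have strip : ∀ ζ η, ∃ F, IsStripFun F ∧ (∀ t : ℝ, F t = ⟪ζ, modP M Ω (v t η)⟫_ℂ) ∧
      ∀ t : ℝ, F (t + Complex.I) = ⟪ζ, v t η - modP M Ω (v t η)⟫_ℂ := by
    intro ζ η
    obtain ⟨ζs, hζ, tζ⟩ := mem_closure_iff_seq_limit.1 (h.dense' ζ)
    obtain ⟨ηs, hη, tη⟩ := mem_closure_iff_seq_limit.1 (h.dense η)
    have hex : ∀ n, ∃ F, IsStripFun F ∧ (∀ t : ℝ, F t = ⟪ζs n, modP M Ω (v t (ηs n))⟫_ℂ) ∧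
      ∀ t : ℝ, F (t + Complex.I) = ⟪ζs n, v t (ηs n) - modP M Ω (v t (ηs n))⟫_ℂ := by
      intro n
      obtain ⟨y, hy, ey⟩ := hζ n
      obtain ⟨a, ha, ea⟩ := hη n
      rw [← ey, ← ea]
      exact base y hy a ha
    choose F hF e0 e1 using hex
    set Q : E →L[ℂ] E := 1 - modP M Ω with hQ
    have hQa : ∀ w, w - modP M Ω w = Q w := fun w => rfl
    set C := ‖modP M Ω‖ + ‖Q‖ with hC
    have bound : ∀ B : E →L[ℂ] E, ‖B‖ ≤ C → ∀ n t,
        ‖⟪ζs n, B (v t (ηs n))⟫_ℂ - ⟪ζ, B (v t η)⟫_ℂ‖ ≤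
          ‖ζs n - ζ‖ * (C * ‖ηs n‖) + ‖ζ‖ * (C * ‖ηs n - η‖) := by
      intro B hB n t
      have : ⟪ζs n, B (v t (ηs n))⟫_ℂ - ⟪ζ, B (v t η)⟫_ℂ =
          ⟪ζs n - ζ, B (v t (ηs n))⟫_ℂ + ⟪ζ, B (v t (ηs n - η))⟫_ℂ := by
        rw [inner_sub_left, map_sub, map_sub, inner_sub_right]
        ring
      rw [this]
      refine (norm_add_le _ _).trans ?_
      have hBv : ∀ w, ‖B (v t w)‖ ≤ C * ‖w‖ := fun w => by
        rw [← hv t w]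
        exact B.le_of_opNorm_le hB _
      refine add_le_add ((norm_inner_le_norm _ _).trans ?_) ((norm_inner_le_norm _ _).trans ?_)
      · gcongr; exact hBv _
      · gcongr; exact hBv _
    refine exists_isStripFun_of_tendsto hF
      (ε := fun n => ‖ζs n - ζ‖ * (C * ‖ηs n‖) + ‖ζ‖ * (C * ‖ηs n - η‖)) ?_ ?_ ?_
    · have t1 := tendsto_iff_norm_sub_tendsto_zero.1 tζ
      have t2 := tendsto_iff_norm_sub_tendsto_zero.1 tη
      have := (t1.mul (tη.norm.const_mul C)).add ((t2.const_mul C).const_mul ‖ζ‖)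
      simpa using this
    · intro n t
      rw [e0]
      exact bound _ (by rw [hC]; linarith [norm_nonneg Q]) n t
    · intro n t
      rw [e1, hQa, hQa]
      exact bound _ (by rw [hC]; linarith [norm_nonneg (modP M Ω)]) n t
  refine ⟨hv, h0, fun w => continuous_of_continuous_inner hv fun ζ => ?_, hP, strip⟩
  obtain ⟨F, hF, e0, e1⟩ := strip ζ w
  have : (fun t => ⟪ζ, v t w⟫_ℂ) = fun t : ℝ => F t + F (t + Complex.I) := by
    ext t
    rw [e0, e1, ← inner_add_right]
    congr 1
    abel
  rw [this]
  exact hF.continuous_bottom.add hF.continuous_top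

theorem isStripFamily_modU : IsStripFamily (modP M Ω) (modU (modP M Ω)) :=
  h.isStripFamily h.isModularPair.norm_modU h.isModularPair.modU_zero
    (fun t w => (h.isModularPair.P_modU t w).symm) (fun t w => (h.isModularPair.apply_modU t w).symm)
    fun _ ha _ hb => h.exists_isStripFun_modU ha hb

/-- The modular group is the only unitary group preserving the self-adjoint orbit and satisfying
the KMS condition. -/
theorem eq_modU {v : ℝ → E →L[ℂ] E} (hv : ∀ t w, ‖v t w‖ = ‖w‖) (h0 : ∀ w, v 0 w = w)
    (hinv : ∀ t w, v t (v (-t) w) = w)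
    (hsa : ∀ t, ∀ a ∈ M, star a = a → ∃ b ∈ M, star b = b ∧ v t (a Ω) = b Ω)
    (hs : ∀ a ∈ M, ∀ b ∈ M, ∃ F, IsStripFun F ∧
      (∀ t : ℝ, F t = ⟪star b Ω, v t (a Ω)⟫_ℂ) ∧
      ∀ t : ℝ, F (t + Complex.I) = ⟪v t (star a Ω), b Ω⟫_ℂ) (t : ℝ) :
    v t = modU (modP M Ω) t := by
  have hm := h.isModularPair
  have hadj : ∀ t a b, ⟪v t a, b⟫_ℂ = ⟪a, v (-t) b⟫_ℂ := by
    intro t a b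
    conv_lhs => rw [← hinv t b]
    exact inner_apply_eq_of_norm_apply (hv t) _ _
  have hcl : ∀ t, ∀ w ∈ closure (saOrbit M Ω : Set E), v t w ∈ closure (saOrbit M Ω : Set E) := by
    intro t w hw
    refine map_mem_closure (v t).continuous hw ?_
    rintro _ ⟨a, ha, has, rfl⟩
    obtain ⟨b, hb, hbs, e⟩ := hsa t a ha has
    exact ⟨b, hb, hbs, e.symm⟩
  have hfix : ∀ w ∈ closure (saOrbit M Ω : Set E), saProj M Ω w = w := by
    have : IsClosed {w | saProj M Ω w = w} := isClosed_eq (saProj M Ω).continuous continuous_id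
    refine fun w hw => this.closure_subset_iff.2 ?_ hw
    rintro _ ⟨a, ha, has, rfl⟩
    exact saProj_eq_self_of_mem M Ω ha has
  have hpvp : ∀ t w, saProj M Ω (v t (saProj M Ω w)) = v t (saProj M Ω w) := fun t w =>
    hfix _ (hcl t _ (saProj_mem_closure M Ω w))
  have hpv : ∀ t w, v t (saProj M Ω w) = saProj M Ω (v t w) := by
    intro t w
    rw [← hpvp]
    have hre : ∀ z, (⟪saProj M Ω (v t (saProj M Ω w)), z⟫_ℂ).re =
        (⟪saProj M Ω (v t w), z⟫_ℂ).re := by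
      intro z
      rw [re_inner_saProj, hadj, re_inner_saProj, hpvp, ← hadj, ← re_inner_saProj]
    refine ext_inner_right ℂ fun z => Complex.ext (hre z) ?_
    have := hre (Complex.I • z)
    rw [inner_smul_right, inner_smul_right] at this
    simpa using this
  have hqv : ∀ t w, v t (saProjI M Ω w) = saProjI M Ω (v t w) := by
    intro t w
    rw [saProjI_apply, saProjI_apply, map_neg, map_smul, hpv, map_smul]
  have hsm : ∀ t w, v t ((1 / 2 : ℝ) • w) = (1 / 2 : ℝ) • v t w := fun t w =>
    ((v t).restrictScalars ℝ).map_smul _ _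
  have hPv : ∀ t w, v t (modP M Ω w) = modP M Ω (v t w) := by
    intro t w
    rw [modP_apply, modP_apply, hsm, map_add, hpv, hqv]
  have hKv : ∀ t w, v t (modK M Ω w) = modK M Ω (v t w) := by
    intro t w
    rw [modK_apply, modK_apply, hsm, map_sub, hpv, hqv]
  exact (h.isStripFamily hv h0 hPv hKv hs).eq_of_comm h.isStripFamily_modU (modP_inner M Ω)
    (fun s t w => (hm.comm_modU (hPv t) s w).symm) t

end IsCyclicSeparating

end ModularUniqueness

section NormalVectors

variable {E : Type*} [NormedAddCommGroup E] [InnerProductSpace ℂ E] [CompleteSpace E]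

/-- A subspace invariant under a von Neumann algebra `N` is dense as soon as no nonzero element
of the commutant annihilates it. -/
theorem VonNeumannAlgebra.dense_of_separating (N : VonNeumannAlgebra E) (S : Submodule ℂ E)
    (hS : ∀ y ∈ N, ∀ v ∈ S, y v ∈ S)
    (hsep : ∀ x ∈ N.commutant, (∀ v ∈ S, x v = 0) → x = 0) : Dense (S : Set E) := by
  let p := S.topologicalClosure.starProjection
  have hp : IsStarProjection p := isStarProjection_starProjection
  have hmem : p ∈ N.commutant := by
    rw [VonNeumannAlgebra.IsStarProjection.mem_iff hp, VonNeumannAlgebra.commutant_commutant]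
    intro y hy
    have hr : p.range = S.topologicalClosure := Submodule.range_starProjection _
    rw [hr, Module.End.mem_invtSubmodule]
    intro v hv
    have hv' : v ∈ closure (S : Set E) := hv
    exact map_mem_closure y.continuous hv' (fun w hw => hS y hy w hw)
  have h0 := hsep (1 - p) (sub_mem (one_mem _) hmem) (fun v hv => by
    have : p v = v := Submodule.starProjection_eq_self_iff.mpr (S.le_topologicalClosure hv)
    simp [sub_apply, this])
  intro v
  have h1 : p v = v := by
    have := congrArg (fun q : E →L[ℂ] E => q v) h0
    simp only [sub_apply, one_apply_eq_self, zero_apply] at this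
    exact (sub_eq_zero.mp this).symm
  exact Submodule.starProjection_eq_self_iff.mp h1

theorem HilbertBasis.summable_norm_inner_sq {ι κ : Type*} (e : HilbertBasis ι ℂ E) {η : κ → E}
    (hη : Summable fun j => ‖η j‖ ^ 2) :
    Summable fun p : κ × ι => ‖⟪e p.2, η p.1⟫_ℂ‖ ^ 2 := by
  have key : ∀ v : E, HasSum (fun i => ‖⟪e i, v⟫_ℂ‖ ^ 2) (‖v‖ ^ 2) := by
    intro v
    have h := Complex.hasSum_re (e.hasSum_inner_mul_inner v v)
    have e1 : ∀ i, (⟪v, e i⟫_ℂ * ⟪e i, v⟫_ℂ).re = ‖⟪e i, v⟫_ℂ‖ ^ 2 := by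
      intro i
      rw [← inner_conj_symm, Complex.conj_mul']
      norm_cast
    have e2 : (⟪v, v⟫_ℂ).re = ‖v‖ ^ 2 := inner_self_eq_norm_sq (𝕜 := ℂ) v
    simpa only [e1, e2] using h
  rw [summable_prod_of_nonneg (fun p => by positivity)]
  refine ⟨fun j => (key (η j)).summable, ?_⟩
  simpa only [(key _).tsum_eq] using hη

/-- The trace functional of a positive trace class operator is a sum of vector functionals. -/
theorem exists_hasSum_inner_of_trace {ι : Type*} (e : HilbertBasis ι ℂ E) {ρ : E →L[ℂ] E}
    (hρ : ρ.IsPositive) (htr : HasSum (fun i => ⟪e i, ρ (e i)⟫_ℂ) 1) :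
    ∃ ζ : ι → E, (Summable fun i => ‖ζ i‖ ^ 2) ∧ ∀ (a : E →L[ℂ] E) (c : ℂ),
      HasSum (fun i => ⟪e i, ρ (a (e i))⟫_ℂ) c → HasSum (fun i => ⟪ζ i, a (ζ i)⟫_ℂ) c := by
  have hρ0 : 0 ≤ ρ := (ContinuousLinearMap.nonneg_iff_isPositive ρ).mpr hρ
  set s : E →L[ℂ] E := CFC.sqrt ρ with hs
  have hss : ∀ v, s (s v) = ρ v := fun v => by
    rw [← mul_apply_eq_comp, CFC.sqrt_mul_sqrt_self ρ hρ0]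
  have hsa : ∀ v w, ⟪s v, w⟫_ℂ = ⟪v, s w⟫_ℂ := by
    have : IsSelfAdjoint s := (CFC.sqrt_nonneg ρ).isSelfAdjoint
    intro v w
    exact (ContinuousLinearMap.isSelfAdjoint_iff_isSymmetric.mp this) v w
  have hsum : Summable fun i => ‖s (e i)‖ ^ 2 := by
    have h := (Complex.hasSum_re htr).summable
    refine h.congr fun i => ?_
    rw [← hss, ← hsa]
    exact (inner_self_eq_norm_sq (𝕜 := ℂ) _)
  refine ⟨fun i => s (e i), hsum, fun a c hc => ?_⟩
  have hsum' : Summable fun j => ‖star a (s (e j))‖ ^ 2 := by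
    refine Summable.of_nonneg_of_le (fun _ => by positivity) (fun j => ?_)
      (hsum.mul_left (‖star a‖ ^ 2))
    rw [← mul_pow]
    gcongr
    exact (star a).le_opNorm _
  let g : ι × ι → ℂ := fun p => ⟪star a (s (e p.1)), e p.2⟫_ℂ * ⟪e p.2, s (e p.1)⟫_ℂ
  have hg : Summable g := by
    refine Summable.of_norm_bounded
      ((e.summable_norm_inner_sq hsum').add (e.summable_norm_inner_sq hsum)) fun p => ?_
    simp only [g, norm_mul]
    rw [norm_inner_symm]
    nlinarith [sq_nonneg (‖⟪e p.2, star a (s (e p.1))⟫_ℂ‖ - ‖⟪e p.2, s (e p.1)⟫_ℂ‖),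
      sq_nonneg (‖⟪e p.2, star a (s (e p.1))⟫_ℂ‖), sq_nonneg (‖⟪e p.2, s (e p.1)⟫_ℂ‖)]
  have h1 : HasSum (fun j => ⟪s (e j), a (s (e j))⟫_ℂ) (∑' p, g p) := by
    refine hg.hasSum.prod_fiberwise fun j => ?_
    have := e.hasSum_inner_mul_inner (star a (s (e j))) (s (e j))
    rwa [show ⟪star a (s (e j)), s (e j)⟫_ℂ = ⟪s (e j), a (s (e j))⟫_ℂ from
      ContinuousLinearMap.adjoint_inner_left a _ _] at this
  have h2 : HasSum (fun i => ⟪e i, ρ (a (e i))⟫_ℂ) (∑' p, g p) := by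
    refine (((Equiv.prodComm ι ι).hasSum_iff (f := g)).mpr hg.hasSum).prod_fiberwise fun i => ?_
    have := e.hasSum_inner_mul_inner (s (e i)) (s (a (e i)))
    rw [show ⟪s (e i), s (a (e i))⟫_ℂ = ⟪e i, ρ (a (e i))⟫_ℂ by rw [hsa, hss]] at this
    have hfun : (fun j => g (Equiv.prodComm ι ι (i, j))) =
        fun j => ⟪s (e i), e j⟫_ℂ * ⟪e j, s (a (e i))⟫_ℂ := by
      funext j
      change ⟪star a (s (e j)), e i⟫_ℂ * ⟪e i, s (e j)⟫_ℂ = _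
      rw [show ⟪star a (s (e j)), e i⟫_ℂ = ⟪s (e j), a (e i)⟫_ℂ from
        ContinuousLinearMap.adjoint_inner_left a _ _, hsa (e j), ← hsa (e i), mul_comm]
    change HasSum (fun j => g (Equiv.prodComm ι ι (i, j))) _
    rw [hfun]
    exact this
  rwa [hc.unique h2]

end NormalVectors

section StandardRepresentation

variable {E : Type*} [NormedAddCommGroup E] [InnerProductSpace ℂ E] [CompleteSpace E]
variable {H : Type*} [NormedAddCommGroup H] [InnerProductSpace ℂ H] [CompleteSpace H]

open VonNeumannAlgebra ContinuousLinearMap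

/-- Formal sums of pairs of an operator in `D` and a vector, evaluated. -/
def sumEval (D : Set (E →L[ℂ] H)) : (D →₀ E) →ₗ[ℂ] H :=
  Finsupp.lsum ℂ fun w => (w : E →L[ℂ] H).toLinearMap

theorem sumEval_single (D : Set (E →L[ℂ] H)) (w : D) (v : E) :
    sumEval D (Finsupp.single w v) = (w : E →L[ℂ] H) v := by
  simp [sumEval]

theorem inner_sumEval_mapRange {D : Set (E →L[ℂ] H)} {c : E →L[ℂ] E}
    (hc : ∀ w₁ ∈ D, ∀ w₂ ∈ D, ∀ v, star c (adjoint w₁ (w₂ v)) = adjoint w₁ (w₂ (star c v)))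
    (f g : D →₀ E) :
    ⟪sumEval D (Finsupp.mapRange.linearMap (c : E →ₗ[ℂ] E) f), sumEval D g⟫_ℂ =
      ⟪sumEval D f, sumEval D (Finsupp.mapRange.linearMap (star c : E →L[ℂ] E).toLinearMap g)⟫_ℂ := by
  induction f using Finsupp.induction_linear with
  | zero => simp
  | add f₁ f₂ h₁ h₂ => simp only [map_add, inner_add_left, h₁, h₂]
  | single w v =>
    induction g using Finsupp.induction_linear with
    | zero => simp
    | add g₁ g₂ h₁ h₂ => simp only [map_add, inner_add_right, h₁, h₂]
    | single w' v' =>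
      rw [Finsupp.mapRange.linearMap_apply, Finsupp.mapRange.linearMap_apply,
        Finsupp.mapRange_single, Finsupp.mapRange_single]
      simp only [sumEval_single]
      change ⟪w.1 (c v), w'.1 v'⟫_ℂ = ⟪w.1 v, w'.1 (star c v')⟫_ℂ
      rw [← adjoint_inner_right, ← adjoint_inner_right]
      change ⟪v, star c (adjoint w.1 (w'.1 v'))⟫_ℂ = _
      rw [hc _ w.2 _ w'.2, adjoint_inner_right]

theorem norm_sumEval_mapRange_le {D : Set (E →L[ℂ] H)} {z : E →L[ℂ] E}
    (hz : ∀ w₁ ∈ D, ∀ w₂ ∈ D, ∀ v, z (adjoint w₁ (w₂ v)) = adjoint w₁ (w₂ (z v)))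
    (hz' : ∀ w₁ ∈ D, ∀ w₂ ∈ D, ∀ v, star z (adjoint w₁ (w₂ v)) = adjoint w₁ (w₂ (star z v)))
    (f : D →₀ E) :
    ‖sumEval D (Finsupp.mapRange.linearMap (z : E →ₗ[ℂ] E) f)‖ ≤ ‖z‖ * ‖sumEval D f‖ := by
  set b : E →L[ℂ] E := algebraMap ℝ (E →L[ℂ] E) (‖z‖ ^ 2) - star z * z with hb
  have hb0 : 0 ≤ b := sub_nonneg.mpr CStarAlgebra.star_mul_le_algebraMap_norm_sq
  set y : E →L[ℂ] E := CFC.sqrt b with hy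
  have hyy : y * y = b := CFC.sqrt_mul_sqrt_self b hb0
  have hysa : star y = y := (CFC.sqrt_nonneg b).isSelfAdjoint
  have hbv : ∀ v, b v = ((‖z‖ ^ 2 : ℝ) : ℂ) • v - star z (z v) := by
    intro v
    rw [hb, Algebra.algebraMap_eq_smul_one]
    rfl
  have hyc : ∀ w₁ ∈ D, ∀ w₂ ∈ D, ∀ v, y (adjoint w₁ (w₂ v)) = adjoint w₁ (w₂ (y v)) := by
    intro w₁ h₁ w₂ h₂ v
    rw [hy, CFC.sqrt_eq_real_sqrt b hb0, cfcₙ_eq_cfc]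
    refine (commute_cfc_apply (B := adjoint w₁ ∘L w₂) hb0.isSelfAdjoint (fun v => ?_)
      Real.continuous_sqrt v).symm
    change adjoint w₁ (w₂ (b v)) = b (adjoint w₁ (w₂ v))
    rw [hbv, hbv, hz _ h₁ _ h₂, hz' _ h₁ _ h₂]
    simp
  have hcomp : ∀ c d : E →L[ℂ] E, ∀ g : D →₀ E, Finsupp.mapRange.linearMap (c : E →ₗ[ℂ] E)
      (Finsupp.mapRange.linearMap (d : E →ₗ[ℂ] E) g) =
      Finsupp.mapRange.linearMap ((c * d : E →L[ℂ] E) : E →ₗ[ℂ] E) g := by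
    intro c d g
    ext w
    rfl
  have h1 := inner_sumEval_mapRange hz' f (Finsupp.mapRange.linearMap (z : E →ₗ[ℂ] E) f)
  have h2 := inner_sumEval_mapRange (c := y) (by rwa [hysa]) f
    (Finsupp.mapRange.linearMap (y : E →ₗ[ℂ] E) f)
  rw [hcomp] at h1 h2
  have h3 : sumEval D (Finsupp.mapRange.linearMap ((star z * z : E →L[ℂ] E) : E →ₗ[ℂ] E) f) +
      sumEval D (Finsupp.mapRange.linearMap ((star y * y : E →L[ℂ] E) : E →ₗ[ℂ] E) f) =
      ((‖z‖ ^ 2 : ℝ) : ℂ) • sumEval D f := by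
    rw [← map_add, ← map_smul]
    congr 1
    ext w
    rw [hysa, hyy]
    change star z (z (f w)) + b (f w) = ((‖z‖ ^ 2 : ℝ) : ℂ) • f w
    rw [hbv]
    abel
  have h4 : ‖sumEval D (Finsupp.mapRange.linearMap (z : E →ₗ[ℂ] E) f)‖ ^ 2 +
      ‖sumEval D (Finsupp.mapRange.linearMap (y : E →ₗ[ℂ] E) f)‖ ^ 2 =
      ‖z‖ ^ 2 * ‖sumEval D f‖ ^ 2 := by
    have := congrArg (fun v => ⟪sumEval D f, v⟫_ℂ) h3
    simp only [inner_add_right, inner_smul_right] at this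
    rw [← h1, ← h2, inner_self_eq_norm_sq_to_K, inner_self_eq_norm_sq_to_K,
      inner_self_eq_norm_sq_to_K] at this
    apply Complex.ofReal_injective
    push_cast at this ⊢
    exact this
  refine abs_le_of_sq_le_sq' ?_ (by positivity) |>.2
  rw [mul_pow]
  nlinarith [sq_nonneg ‖sumEval D (Finsupp.mapRange.linearMap (y : E →ₗ[ℂ] E) f)‖]

/-- The data of a standard (GNS) representation of a von Neumann algebra for the functional `ω`,
with enough intertwiners to the defining representation. -/
structure IsStandardRep (A : VonNeumannAlgebra H) (ω : ↥A.toStarSubalgebra →ₗ[ℂ] ℂ)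
    (π : ↥A.toStarSubalgebra →⋆ₐ[ℂ] (E →L[ℂ] E)) (Ω : E) : Prop where
  inner : ∀ a, ω a = ⟪Ω, π a Ω⟫_ℂ
  dense : DenseRange fun a => π a Ω
  sep : ∀ ξ, (∀ w : E →L[ℂ] H, (∀ a v, w (π a v) = (a : H →L[ℂ] H) (w v)) → w ξ = 0) → ξ = 0
  norm_le : ∀ a, ‖π a‖ ≤ ‖(a : H →L[ℂ] H)‖
  faithful : ∀ a, ω (star a * a) = 0 → a = 0
  map_one : ω 1 = 1

namespace IsStandardRep

/-- The operators intertwining `π` and the defining representation. -/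
def intertwiners (A : VonNeumannAlgebra H)
    (π : ↥A.toStarSubalgebra →⋆ₐ[ℂ] (E →L[ℂ] E)) : Set (E →L[ℂ] H) :=
  {w | ∀ a v, w (π a v) = (a : H →L[ℂ] H) (w v)}

variable {A : VonNeumannAlgebra H} {ω : ↥A.toStarSubalgebra →ₗ[ℂ] ℂ}
  {π : ↥A.toStarSubalgebra →⋆ₐ[ℂ] (E →L[ℂ] E)} {Ω : E} (h : IsStandardRep A ω π Ω)
include h

theorem eq_zero {a : ↥A.toStarSubalgebra} (ha : π a Ω = 0) : a = 0 := by
  apply h.faithful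
  rw [h.inner, map_mul, mul_apply_eq_comp, ha]
  simp

theorem injective : Function.Injective π := by
  refine (injective_iff_map_eq_zero π).mpr fun a ha => h.eq_zero ?_
  rw [ha]
  rfl

theorem eq_of_apply_eq {a b : ↥A.toStarSubalgebra} (hab : π a Ω = π b Ω) : a = b := by
  refine sub_eq_zero.mp (h.eq_zero ?_)
  rw [map_sub, sub_apply, hab, sub_self]

theorem denseRange_sumEval : DenseRange (sumEval (intertwiners A π)) := by
  have := A.commutant.dense_of_separating (LinearMap.range (sumEval (intertwiners A π))) ?_ ?_
  · rwa [LinearMap.coe_range] at this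
  · rintro y hy _ ⟨f, rfl⟩
    induction f using Finsupp.induction_linear with
    | zero => simp
    | add f g hf hg =>
      simp only [map_add]
      exact add_mem hf hg
    | single w v =>
      rw [sumEval_single]
      have hw : y ∘L w.1 ∈ intertwiners A π := fun a v => by
        change y (w.1 (π a v)) = (a : H →L[ℂ] H) (y (w.1 v))
        rw [w.2 a v, apply_comm a.2 hy]
      exact ⟨Finsupp.single ⟨_, hw⟩ v, sumEval_single _ _ _⟩
  · intro x hx hx0
    rw [commutant_commutant] at hx
    have : (⟨x, hx⟩ : ↥A.toStarSubalgebra) = 0 := by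
      refine h.eq_zero (h.sep _ fun w hw => ?_)
      rw [hw]
      exact hx0 _ ⟨Finsupp.single ⟨w, hw⟩ Ω, sumEval_single _ _ _⟩
    exact congrArg Subtype.val this

/-- The range of a standard representation equals its double commutant. -/
theorem exists_eq_of_centralizer {z : E →L[ℂ] E}
    (hz : z ∈ Set.centralizer (Set.centralizer (Set.range π))) :
    ∃ a : ↥A.toStarSubalgebra, π a = z ∧ ‖(a : H →L[ℂ] H)‖ ≤ ‖z‖ := by
  have hcent : ∀ w₁ ∈ intertwiners A π, ∀ w₂ ∈ intertwiners A π,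
      adjoint w₁ ∘L w₂ ∈ Set.centralizer (Set.range π) := by
    rintro w₁ h₁ w₂ h₂ _ ⟨a, rfl⟩
    ext v
    refine ext_inner_left ℂ fun u => ?_
    change ⟪u, π a (adjoint w₁ (w₂ v))⟫_ℂ = ⟪u, adjoint w₁ (w₂ (π a v))⟫_ℂ
    rw [h₂ a v, adjoint_inner_right, ← adjoint_inner_left (π a), adjoint_inner_right]
    have : adjoint (π a) = π (star a) := (map_star π a).symm
    rw [this, h₁]
    exact adjoint_inner_left (a : H →L[ℂ] H) _ _
  have hcz : ∀ w₁ ∈ intertwiners A π, ∀ w₂ ∈ intertwiners A π, ∀ v,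
      z (adjoint w₁ (w₂ v)) = adjoint w₁ (w₂ (z v)) := fun w₁ h₁ w₂ h₂ v =>
    (DFunLike.congr_fun (hz _ (hcent w₁ h₁ w₂ h₂)) v).symm
  have hcz' : ∀ w₁ ∈ intertwiners A π, ∀ w₂ ∈ intertwiners A π, ∀ v,
      star z (adjoint w₁ (w₂ v)) = adjoint w₁ (w₂ (star z v)) := by
    intro w₁ h₁ w₂ h₂ v
    refine ext_inner_left ℂ fun u => ?_
    rw [show ⟪u, star z (adjoint w₁ (w₂ v))⟫_ℂ = ⟪z u, adjoint w₁ (w₂ v)⟫_ℂ from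
      adjoint_inner_right z _ _, adjoint_inner_right, ← adjoint_inner_left, ← hcz w₂ h₂ w₁ h₁,
      adjoint_inner_right, ← adjoint_inner_left w₂, ← adjoint_inner_right z]
    rfl
  have hb := norm_sumEval_mapRange_le hcz hcz'
  set W := sumEval (intertwiners A π) with hW
  set T := W ∘ₗ Finsupp.mapRange.linearMap (z : E →ₗ[ℂ] E) with hT
  have hd := h.denseRange_sumEval
  set X : H →L[ℂ] H := T.extendOfNorm W with hX
  have hXw : ∀ w ∈ intertwiners A π, ∀ v, X (w v) = w (z v) := by
    intro w hw v
    have := LinearMap.extendOfNorm_eq (f := T) (e := W) hd ⟨_, hb⟩ (Finsupp.single ⟨w, hw⟩ v)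
    rw [← hX, hW, sumEval_single] at this
    rw [this, hT, LinearMap.comp_apply, Finsupp.mapRange.linearMap_apply,
      Finsupp.mapRange_single, sumEval_single]
    rfl
  have hXA : X ∈ A := by
    refine mem_of_forall_commutant fun y hy v => ?_
    refine hd.induction_on (p := fun v => y (X v) = X (y v)) v
      (isClosed_eq (by fun_prop) (by fun_prop)) fun f => ?_
    induction f using Finsupp.induction_linear with
    | zero => simp
    | add f g hf hg => simp only [map_add, hf, hg]
    | single w v =>
      rw [sumEval_single, hXw _ w.2]
      have hw : y ∘L w.1 ∈ intertwiners A π := fun a v => by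
        change y (w.1 (π a v)) = (a : H →L[ℂ] H) (y (w.1 v))
        rw [w.2 a v, apply_comm a.2 hy]
      exact (hXw _ hw v).symm
  refine ⟨⟨X, hXA⟩, ?_, LinearMap.opNorm_extendOfNorm_le hd (norm_nonneg z) hb⟩
  ext v
  refine sub_eq_zero.mp (h.sep _ fun w hw => ?_)
  rw [map_sub, hw, sub_eq_zero]
  exact hXw w hw v

theorem norm_eq_le (a : ↥A.toStarSubalgebra) : ‖(a : H →L[ℂ] H)‖ ≤ ‖π a‖ := by
  obtain ⟨b, hb, hn⟩ := h.exists_eq_of_centralizer (z := π a)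
    (Set.subset_centralizer_centralizer ⟨a, rfl⟩)
  rwa [h.injective hb] at hn

/-- The range of a standard representation, as a von Neumann algebra. -/
def rangeAlgebra : VonNeumannAlgebra E where
  toStarSubalgebra := π.range
  centralizer_centralizer' := by
    have hr : (π.range.carrier : Set (E →L[ℂ] E)) = Set.range π := π.coe_range
    rw [hr]
    refine Set.Subset.antisymm (fun z hz => ?_) Set.subset_centralizer_centralizer
    obtain ⟨a, ha, _⟩ := h.exists_eq_of_centralizer hz
    exact ⟨a, ha⟩

theorem mem_rangeAlgebra {z : E →L[ℂ] E} : z ∈ h.rangeAlgebra ↔ ∃ a, π a = z := by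
  exact Iff.rfl

theorem isCyclicSeparating : IsCyclicSeparating h.rangeAlgebra Ω where
  norm_eq := by
    have h1 := h.inner 1
    rw [h.map_one, _root_.map_one, one_apply_eq_self, inner_self_eq_norm_sq_to_K] at h1
    have h2 : ‖Ω‖ ^ 2 = 1 := by
      apply Complex.ofReal_injective
      push_cast
      exact h1.symm
    nlinarith [norm_nonneg Ω]
  dense := by
    refine h.dense.mono ?_
    rintro _ ⟨a, rfl⟩
    exact ⟨π a, h.mem_rangeAlgebra.mpr ⟨a, rfl⟩, rfl⟩
  dense' := by
    let S : Submodule ℂ E :=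
      { carrier := {w | ∃ a ∈ h.rangeAlgebra.commutant, a Ω = w}
        add_mem' := by
          rintro _ _ ⟨a, ha, rfl⟩ ⟨b, hb, rfl⟩
          exact ⟨a + b, add_mem ha hb, rfl⟩
        zero_mem' := ⟨0, zero_mem _, rfl⟩
        smul_mem' := by
          rintro c _ ⟨a, ha, rfl⟩
          exact ⟨c • a, smul_mem_of_mem ha c, rfl⟩ }
    refine h.rangeAlgebra.commutant.dense_of_separating S ?_ fun x hx hx0 => ?_
    · rintro y hy _ ⟨a, ha, rfl⟩
      exact ⟨y * a, mul_mem hy ha, rfl⟩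
    · rw [commutant_commutant] at hx
      obtain ⟨a, rfl⟩ := h.mem_rangeAlgebra.mp hx
      rw [h.eq_zero (hx0 Ω ⟨1, one_mem _, rfl⟩), map_zero]

end IsStandardRep

end StandardRepresentation

section DiagonalRepresentation

variable {H : Type*} [NormedAddCommGroup H] [InnerProductSpace ℂ H] [CompleteSpace H]
variable {ι : Type*}

open VonNeumannAlgebra

/-- The diagonal action of an operator on the Hilbert sum of copies of `H`. -/
def lpDiag (ι : Type*) (a : H →L[ℂ] H) : lp (fun _ : ι => H) 2 →L[ℂ] lp (fun _ : ι => H) 2 :=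
  LinearMap.mkContinuous
    { toFun := fun v => ⟨fun i => a (v i), (lp.memℓp (‖a‖ • v)).mono' fun i => by
        simpa [norm_smul] using a.le_opNorm (v i)⟩
      map_add' := fun v w => by
        ext i
        exact map_add a (v i) (w i)
      map_smul' := fun c v => by ext i; simp } ‖a‖ fun v => by
        have : ‖‖a‖ • v‖ = ‖a‖ * ‖v‖ := by simp [norm_smul]
        rw [← this]
        refine lp.norm_mono (by norm_num) fun i => ?_
        simpa [norm_smul] using a.le_opNorm (v i)

theorem norm_lpDiag_le (a : H →L[ℂ] H) : ‖lpDiag ι a‖ ≤ ‖a‖ :=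
  LinearMap.mkContinuous_norm_le _ (norm_nonneg _) _

theorem inner_lpDiag (a : H →L[ℂ] H) (v w : lp (fun _ : ι => H) 2) :
    ⟪lpDiag ι (star a) v, w⟫_ℂ = ⟪v, lpDiag ι a w⟫_ℂ := by
  rw [lp.inner_eq_tsum, lp.inner_eq_tsum]
  exact tsum_congr fun i => ContinuousLinearMap.adjoint_inner_left a _ _

variable (A : VonNeumannAlgebra H) (ζ : lp (fun _ : ι => H) 2)

/-- The cyclic subspace generated by `ζ` under the diagonal action of `A`. -/
def diagCyclic : Submodule ℂ (lp (fun _ : ι => H) 2) :=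
  Submodule.topologicalClosure
    { carrier := {v | ∃ a ∈ A, lpDiag ι a ζ = v}
      add_mem' := by
        rintro _ _ ⟨a, ha, rfl⟩ ⟨b, hb, rfl⟩
        exact ⟨a + b, add_mem ha hb, rfl⟩
      zero_mem' := ⟨0, zero_mem _, rfl⟩
      smul_mem' := by
        rintro c _ ⟨a, ha, rfl⟩
        exact ⟨c • a, smul_mem_of_mem ha c, rfl⟩ }

instance : CompleteSpace (diagCyclic A ζ) :=
  (Submodule.isClosed_topologicalClosure _).completeSpace_coe

theorem lpDiag_mem_diagCyclic {a : H →L[ℂ] H} (ha : a ∈ A) :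
    ∀ v ∈ diagCyclic A ζ, lpDiag ι a v ∈ diagCyclic A ζ := by
  intro v hv
  refine map_mem_closure (lpDiag ι a).continuous hv ?_
  rintro _ ⟨b, hb, rfl⟩
  exact ⟨a * b, mul_mem ha hb, rfl⟩

theorem restrict_lpDiag_star {a : H →L[ℂ] H} (ha : a ∈ A) (ha' : star a ∈ A) :
    (lpDiag ι (star a)).restrict (lpDiag_mem_diagCyclic A ζ ha') =
      star ((lpDiag ι a).restrict (lpDiag_mem_diagCyclic A ζ ha)) := by
  refine (ContinuousLinearMap.eq_adjoint_iff _ _).mpr fun v w => ?_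
  rw [Submodule.coe_inner, Submodule.coe_inner, ContinuousLinearMap.coe_restrict_apply,
    ContinuousLinearMap.coe_restrict_apply]
  exact inner_lpDiag a v.1 w.1

/-- The diagonal action of `A` on the cyclic subspace generated by `ζ`. -/
def diagRep : ↥A.toStarSubalgebra →⋆ₐ[ℂ] (diagCyclic A ζ →L[ℂ] diagCyclic A ζ) where
  toFun a := (lpDiag ι (a : H →L[ℂ] H)).restrict (lpDiag_mem_diagCyclic A ζ a.2)
  map_one' := rfl
  map_mul' _ _ := rfl
  map_zero' := rfl
  map_add' _ _ := rfl
  commutes' _ := rfl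
  map_star' a := by
    exact restrict_lpDiag_star A ζ a.2 (star a).2

/-- `ζ` as an element of the cyclic subspace it generates. -/
def diagVector : diagCyclic A ζ := ⟨ζ, subset_closure ⟨1, one_mem _, rfl⟩⟩

/-- A faithful sum of vector functionals is implemented by a standard representation. -/
theorem isStandardRep_diagRep {ω : ↥A.toStarSubalgebra →ₗ[ℂ] ℂ}
    (hω : ∀ a : ↥A.toStarSubalgebra, HasSum (fun i => ⟪ζ i, (a : H →L[ℂ] H) (ζ i)⟫_ℂ) (ω a))
    (hf : ∀ a, ω (star a * a) = 0 → a = 0) (h1 : ω 1 = 1) :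
    IsStandardRep A ω (diagRep A ζ) (diagVector A ζ) where
  inner a := (hω a).unique (lp.hasSum_inner ζ (lpDiag ι (a : H →L[ℂ] H) ζ))
  dense := by
    intro v
    rw [closure_subtype]
    refine closure_mono ?_ v.2
    rintro _ ⟨a, ha, rfl⟩
    exact ⟨diagRep A ζ ⟨a, ha⟩ (diagVector A ζ), ⟨⟨a, ha⟩, rfl⟩, rfl⟩
  sep ξ hξ := by
    ext i
    exact hξ (lp.evalCLM ℂ (fun _ : ι => H) 2 i ∘L (diagCyclic A ζ).subtypeL) fun a v => rfl
  norm_le a := by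
    refine ContinuousLinearMap.opNorm_le_bound _ (norm_nonneg _) fun v => ?_
    exact (lpDiag ι (a : H →L[ℂ] H)).le_of_opNorm_le (norm_lpDiag_le _) v
  faithful := hf
  map_one := h1

end DiagonalRepresentation

section ModularAutomorphisms

variable {E : Type*} [NormedAddCommGroup E] [InnerProductSpace ℂ E] [CompleteSpace E]
variable {H : Type*} [NormedAddCommGroup H] [InnerProductSpace ℂ H] [CompleteSpace H]

open VonNeumannAlgebra Filter Topology

namespace IsStandardRep

variable {A : VonNeumannAlgebra H} {ω : ↥A.toStarSubalgebra →ₗ[ℂ] ℂ}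
  {π : ↥A.toStarSubalgebra →⋆ₐ[ℂ] (E →L[ℂ] E)} {Ω : E} (h : IsStandardRep A ω π Ω)

/-- The modular unitary group of a standard representation. -/
def modUnitary (t : ℝ) : E →L[ℂ] E := modU (modP h.rangeAlgebra Ω) t

include h in
theorem exists_modAut (t : ℝ) (a : ↥A.toStarSubalgebra) :
    ∃ b, π b = h.modUnitary t * π a * h.modUnitary (-t) := by
  have := h.isCyclicSeparating.modU_mul_mem (h.mem_rangeAlgebra.mpr ⟨a, rfl⟩) (-t)
  rw [neg_neg] at this
  exact h.mem_rangeAlgebra.mp this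

theorem modUnitary_neg_apply (t : ℝ) (v : E) : h.modUnitary (-t) (h.modUnitary t v) = v :=
  h.isCyclicSeparating.isModularPair.modU_neg_apply t v

theorem modUnitary_apply_neg (t : ℝ) (v : E) : h.modUnitary t (h.modUnitary (-t) v) = v :=
  h.isCyclicSeparating.isModularPair.modU_apply_neg t v

theorem modUnitary_add (s t : ℝ) (v : E) :
    h.modUnitary (s + t) v = h.modUnitary s (h.modUnitary t v) :=
  h.isCyclicSeparating.isModularPair.modU_add s t v

theorem modUnitary_zero (v : E) : h.modUnitary 0 v = v :=
  h.isCyclicSeparating.isModularPair.modU_zero v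

theorem norm_modUnitary (t : ℝ) (v : E) : ‖h.modUnitary t v‖ = ‖v‖ :=
  h.isCyclicSeparating.isModularPair.norm_modU t v

theorem modUnitary_inner (t : ℝ) (v w : E) :
    ⟪h.modUnitary t v, w⟫_ℂ = ⟪v, h.modUnitary (-t) w⟫_ℂ :=
  h.isCyclicSeparating.isModularPair.modU_inner t v w

theorem modUnitary_base (t : ℝ) : h.modUnitary t Ω = Ω :=
  h.isCyclicSeparating.isModularPair.modU_eq_self (modP_base _ _) t

theorem continuous_modUnitary_apply {c : ℝ → E} (hc : Continuous c) :
    Continuous fun t => h.modUnitary t (c t) := by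
  rw [continuous_iff_continuousAt]
  intro s
  rw [ContinuousAt, tendsto_iff_norm_sub_tendsto_zero]
  have h1 : Tendsto (fun t => ‖c t - c s‖) (𝓝 s) (𝓝 0) :=
    tendsto_iff_norm_sub_tendsto_zero.mp (hc.tendsto s)
  have h2 : Tendsto (fun t => ‖h.modUnitary t (c s) - h.modUnitary s (c s)‖) (𝓝 s) (𝓝 0) :=
    tendsto_iff_norm_sub_tendsto_zero.mp
      ((h.isCyclicSeparating.isModularPair.continuous_modU (c s)).tendsto s)
  have h3 := h1.add h2
  rw [add_zero] at h3
  refine squeeze_zero (fun _ => norm_nonneg _) (fun t => ?_) h3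
  have : h.modUnitary t (c t) - h.modUnitary s (c s) = h.modUnitary t (c t - c s) +
      (h.modUnitary t (c s) - h.modUnitary s (c s)) := by
    rw [map_sub]
    abel
  rw [this]
  exact (norm_add_le _ _).trans (by rw [h.norm_modUnitary])

/-- The underlying function of the modular automorphism group. -/
def modAutFun (t : ℝ) (a : ↥A.toStarSubalgebra) : ↥A.toStarSubalgebra :=
  Classical.choose (h.exists_modAut t a)

theorem map_modAutFun (t : ℝ) (a : ↥A.toStarSubalgebra) :
    π (h.modAutFun t a) = h.modUnitary t * π a * h.modUnitary (-t) :=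
  Classical.choose_spec (h.exists_modAut t a)

/-- The modular automorphism group of a standard representation. -/
def modAut (t : ℝ) : ↥A.toStarSubalgebra →⋆ₐ[ℂ] ↥A.toStarSubalgebra where
  toFun := h.modAutFun t
  map_one' := h.injective <| by
    rw [h.map_modAutFun, _root_.map_one, mul_one]
    ext v
    exact h.modUnitary_apply_neg t v
  map_mul' a b := h.injective <| by
    rw [map_mul, h.map_modAutFun,
      h.map_modAutFun, h.map_modAutFun,
      map_mul]
    ext v
    simp only [mul_apply_eq_comp, h.modUnitary_neg_apply]
  map_zero' := h.injective <| by
    rw [h.map_modAutFun, map_zero, mul_zero, zero_mul]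
  map_add' a b := h.injective <| by
    rw [map_add, h.map_modAutFun,
      h.map_modAutFun, h.map_modAutFun,
      map_add, mul_add, add_mul]
  commutes' c := h.injective <| by
    rw [h.map_modAutFun, Algebra.algebraMap_eq_smul_one, map_smul,
      _root_.map_one, mul_smul_comm, smul_mul_assoc, mul_one]
    congr 1
    ext v
    exact h.modUnitary_apply_neg t v
  map_star' a := h.injective <| by
    rw [map_star, h.map_modAutFun,
      h.map_modAutFun, map_star]
    refine (ContinuousLinearMap.eq_adjoint_iff _ _).mpr fun v w => ?_
    simp only [mul_apply_eq_comp]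
    rw [h.modUnitary_inner, inner_apply_left, star_star]
    have := h.modUnitary_inner (-t) v (π a (h.modUnitary (-t) w))
    rwa [neg_neg] at this

theorem map_modAut_apply (t : ℝ) (a : ↥A.toStarSubalgebra) (v : E) :
    π (h.modAut t a) v = h.modUnitary t (π a (h.modUnitary (-t) v)) :=
  DFunLike.congr_fun (h.map_modAutFun t a) v

theorem modAut_zero : h.modAut 0 = StarAlgHom.id ℂ ↥A.toStarSubalgebra := by
  ext1 a
  refine h.injective ?_
  ext v
  rw [h.map_modAut_apply, neg_zero, h.modUnitary_zero, h.modUnitary_zero]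
  rfl

theorem modAut_add (s t : ℝ) : h.modAut (s + t) = (h.modAut s).comp (h.modAut t) := by
  ext1 a
  refine h.injective ?_
  ext v
  rw [StarAlgHom.comp_apply, h.map_modAut_apply, h.map_modAut_apply, h.map_modAut_apply,
    neg_add_rev, h.modUnitary_add, h.modUnitary_add]

theorem norm_modAut_le (t : ℝ) (a : ↥A.toStarSubalgebra) :
    ‖(h.modAut t a : H →L[ℂ] H)‖ ≤ ‖(a : H →L[ℂ] H)‖ := by
  refine (h.norm_eq_le _).trans (le_trans ?_ (h.norm_le a))
  refine ContinuousLinearMap.opNorm_le_bound _ (norm_nonneg _) fun v => ?_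
  rw [h.map_modAut_apply, h.norm_modUnitary]
  refine ((π a).le_opNorm _).trans ?_
  rw [h.norm_modUnitary]

theorem continuous_modAut_apply (a : ↥A.toStarSubalgebra) (v : H) :
    Continuous fun t => (h.modAut t a : H →L[ℂ] H) v := by
  have h1 : ∀ f, Continuous fun t =>
      (h.modAut t a : H →L[ℂ] H) (sumEval (intertwiners A π) f) := by
    intro f
    induction f using Finsupp.induction_linear with
    | zero => simpa using continuous_const
    | add f g hf hg => 
      simp only [map_add]
      exact hf.add hg
    | single w ξ =>
      simp only [sumEval_single, ← w.2 _ ξ, h.map_modAut_apply]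
      refine w.1.continuous.comp (h.continuous_modUnitary_apply ((π a).continuous.comp ?_))
      exact (h.isCyclicSeparating.isModularPair.continuous_modU ξ).comp continuous_neg
  refine continuous_of_uniform_approx_of_continuous fun u hu => ?_
  obtain ⟨ε, hε, hu⟩ := Metric.mem_uniformity_dist.mp hu
  have hc : 0 < ‖(a : H →L[ℂ] H)‖ + 1 := by positivity
  obtain ⟨f, hf⟩ := h.denseRange_sumEval.exists_dist_lt v (div_pos hε hc)
  refine ⟨_, h1 f, fun t => hu ?_⟩
  rw [dist_eq_norm] at hf ⊢
  rw [← map_sub]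
  calc _ ≤ ‖(h.modAut t a : H →L[ℂ] H)‖ * ‖v - sumEval (intertwiners A π) f‖ :=
        ContinuousLinearMap.le_opNorm _ _
    _ ≤ (‖(a : H →L[ℂ] H)‖ + 1) * ‖v - sumEval (intertwiners A π) f‖ := by
        gcongr
        linarith [h.norm_modAut_le t a]
    _ < ε := by
        rw [lt_div_iff₀ hc] at hf
        linarith

include h in
theorem inner_star_mul (a : ↥A.toStarSubalgebra) : ω (star a * a) = (‖π a Ω‖ ^ 2 : ℝ) := by
  rw [h.inner, map_mul, mul_apply_eq_comp, map_star, inner_apply_right, star_star,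
    inner_self_eq_norm_sq_to_K]
  push_cast
  rfl

theorem modAut_kms (a b : ↥A.toStarSubalgebra) : ∃ f, IsStripFun f ∧
    (∀ t : ℝ, f t = ω (b * h.modAut t a)) ∧
    ∀ t : ℝ, f (t + Complex.I) = ω (h.modAut t a * b) := by
  obtain ⟨F, hF, e0, e1⟩ := h.isCyclicSeparating.exists_isStripFun_modU
    (h.mem_rangeAlgebra.mpr ⟨a, rfl⟩) (h.mem_rangeAlgebra.mpr ⟨b, rfl⟩)
  refine ⟨F, hF, fun t => ?_, fun t => ?_⟩
  · rw [e0, h.inner, map_mul, mul_apply_eq_comp, h.map_modAut_apply, h.modUnitary_base,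
      inner_apply_right (π b)]
    rfl
  · rw [e1, h.inner, map_mul, mul_apply_eq_comp, h.map_modAut_apply]
    have := h.modUnitary_inner (-t) Ω (π a (h.modUnitary (-t) (π b Ω)))
    rw [h.modUnitary_base] at this
    change ⟪h.modUnitary t (star (π a) Ω), π b Ω⟫_ℂ = _
    rw [h.modUnitary_inner, inner_apply_left, star_star, this, neg_neg]

theorem eq_modAut {τ : ℝ → (↥A.toStarSubalgebra →⋆ₐ[ℂ] ↥A.toStarSubalgebra)}
    (h0 : τ 0 = StarAlgHom.id ℂ ↥A.toStarSubalgebra)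
    (hadd : ∀ s t, τ (s + t) = (τ s).comp (τ t))
    (hτ : ∀ a b, ∃ f, IsStripFun f ∧ (∀ t : ℝ, f t = ω (b * τ t a)) ∧
      ∀ t : ℝ, f (t + Complex.I) = ω (τ t a * b)) : τ = h.modAut := by
  have hinv : ∀ t a, ω (τ t a) = ω a := by
    intro t a
    obtain ⟨f, hf, e0, e1⟩ := hτ a 1
    have hc := hf.eq_const_of_periodic fun t => by rw [e0, e1, mul_one, one_mul]
    have := (hc t).trans (hc 0).symm
    rwa [e0, e0, one_mul, one_mul, h0] at this
  let ev : ↥A.toStarSubalgebra →ₗ[ℂ] E :=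
    { toFun := fun a => π a Ω
      map_add' := fun a b => by rw [map_add]; rfl
      map_smul' := fun c a => by rw [map_smul]; rfl }
  have hd : DenseRange ev := h.dense
  let T : ℝ → ↥A.toStarSubalgebra →ₗ[ℂ] E := fun t => ev ∘ₗ (τ t).toAlgHom.toLinearMap
  have hn : ∀ t a, ‖T t a‖ = ‖ev a‖ := by
    intro t a
    have h1 : ‖π (τ t a) Ω‖ ^ 2 = ‖π a Ω‖ ^ 2 := by
      apply Complex.ofReal_injective
      rw [← h.inner_star_mul, ← h.inner_star_mul, ← map_star, ← map_mul, hinv]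
    exact (sq_eq_sq₀ (norm_nonneg _) (norm_nonneg _)).mp h1
  have hb : ∀ t, ∃ C, ∀ a, ‖T t a‖ ≤ C * ‖ev a‖ := fun t => ⟨1, fun a => by rw [hn, one_mul]⟩
  let v : ℝ → E →L[ℂ] E := fun t => (T t).extendOfNorm ev
  have hv : ∀ t a, v t (π a Ω) = π (τ t a) Ω := fun t a =>
    LinearMap.extendOfNorm_eq (f := T t) (e := ev) hd (hb t) a
  have key : ∀ t, v t = h.modUnitary t := by
    refine h.isCyclicSeparating.eq_modU ?_ ?_ ?_ ?_ ?_
    · intro t w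
      refine hd.induction_on (p := fun w => ‖v t w‖ = ‖w‖) w
        (isClosed_eq (by fun_prop) (by fun_prop)) fun a => ?_
      exact (congrArg norm (hv t a)).trans (hn t a)
    · intro w
      refine hd.induction_on (p := fun w => v 0 w = w) w
        (isClosed_eq (by fun_prop) (by fun_prop)) fun a => ?_
      refine (hv 0 a).trans ?_
      rw [h0]
      rfl
    · intro t w
      refine hd.induction_on (p := fun w => v t (v (-t) w) = w) w
        (isClosed_eq (by fun_prop) (by fun_prop)) fun a => ?_
      change v t (v (-t) (π a Ω)) = π a Ω
      rw [hv, hv, ← StarAlgHom.comp_apply (τ t), ← hadd, add_neg_cancel, h0]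
      rfl
    · intro t a ha hs
      obtain ⟨a, rfl⟩ := h.mem_rangeAlgebra.mp ha
      refine ⟨π (τ t a), h.mem_rangeAlgebra.mpr ⟨_, rfl⟩, ?_, hv t a⟩
      rw [← map_star, ← map_star, h.injective ((map_star π a).trans hs)]
    · intro a ha b hb
      obtain ⟨a, rfl⟩ := h.mem_rangeAlgebra.mp ha
      obtain ⟨b, rfl⟩ := h.mem_rangeAlgebra.mp hb
      obtain ⟨F, hF, e0, e1⟩ := hτ a b
      refine ⟨F, hF, fun t => ?_, fun t => ?_⟩
      · rw [e0, hv, h.inner, map_mul, mul_apply_eq_comp, inner_apply_right (π b)]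
      · rw [e1, ← map_star, hv, map_star, map_star, h.inner, map_mul, mul_apply_eq_comp,
          inner_apply_right (π (τ t a))]
  funext t
  ext1 a
  refine h.eq_of_apply_eq ?_
  rw [← hv, key, h.map_modAut_apply, h.modUnitary_base]

end IsStandardRep

end ModularAutomorphisms

section StandardRepresentationOfState

open VonNeumannAlgebra

theorem IsNormalState.exists_hasSum_inner {A : VonNeumannAlgebra H}
    {φ : ↥A.toStarSubalgebra →ₗ[ℂ] ℂ} (h : IsNormalState A φ) :
    ∃ (ι : Type) (ζ : ι → H), (Summable fun i => ‖ζ i‖ ^ 2) ∧ ∀ a : ↥A.toStarSubalgebra,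
      HasSum (fun i => ⟪ζ i, (a : H →L[ℂ] H) (ζ i)⟫_ℂ) (φ a) := by
  obtain ⟨ρ, hρ, ι, e, htr, hφ⟩ := h
  obtain ⟨ζ, hζ, hsum⟩ := exists_hasSum_inner_of_trace e hρ htr
  exact ⟨ι, ζ, hζ, fun a => hsum _ _ (hφ a)⟩

theorem IsNormalState.continuous_apply {A : VonNeumannAlgebra H}
    {φ : ↥A.toStarSubalgebra →ₗ[ℂ] ℂ} (h : IsNormalState A φ) {c : ℝ → ↥A.toStarSubalgebra}
    {C : ℝ} (hC : ∀ t, ‖(c t : H →L[ℂ] H)‖ ≤ C)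
    (hc : ∀ v, Continuous fun t => (c t : H →L[ℂ] H) v) : Continuous fun t => φ (c t) := by
  obtain ⟨ι, ζ, hζ, hφ⟩ := h.exists_hasSum_inner
  simp only [← (hφ _).tsum_eq]
  refine continuous_tsum (fun i => continuous_const.inner (hc (ζ i))) (hζ.mul_left C)
    fun i t => ?_
  calc _ ≤ ‖ζ i‖ * ‖(c t : H →L[ℂ] H) (ζ i)‖ := norm_inner_le_norm _ _
    _ ≤ ‖ζ i‖ * (C * ‖ζ i‖) := by
        gcongr
        exact (c t : H →L[ℂ] H).le_of_opNorm_le (hC t) _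
    _ = C * ‖ζ i‖ ^ 2 := by ring

theorem exists_isStandardRep {A : VonNeumannAlgebra H} {ω : ↥A.toStarSubalgebra →ₗ[ℂ] ℂ}
    (hstate : IsStateOn A ω) (hfaithful : IsFaithfulState A ω) (hnormal : IsNormalState A ω) :
    ∃ (ι : Type) (ζ : lp (fun _ : ι => H) 2),
      IsStandardRep A ω (diagRep A ζ) (diagVector A ζ) := by
  obtain ⟨ι, ζ, hζ, hω⟩ := hnormal.exists_hasSum_inner
  have hm : Memℓp ζ 2 := memℓp_gen (by simpa using hζ)
  exact ⟨ι, ⟨ζ, hm⟩, isStandardRep_diagRep A ⟨ζ, hm⟩ hω hfaithful hstate.2⟩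

theorem IsKMSState.exists_isStripFun {A : VonNeumannAlgebra H}
    {ω : ↥A.toStarSubalgebra →ₗ[ℂ] ℂ}
    {σ : ℝ → (↥A.toStarSubalgebra →⋆ₐ[ℂ] ↥A.toStarSubalgebra)} (h : IsKMSState A ω σ 1)
    (a b : ↥A.toStarSubalgebra) : ∃ f, IsStripFun f ∧ (∀ t : ℝ, f t = ω (b * σ t a)) ∧
      ∀ t : ℝ, f (t + Complex.I) = ω (σ t a * b) := by
  obtain ⟨f, hb, hc, hd, e0, e1⟩ := h a b
  refine ⟨f, ⟨hb, hc, hd⟩, e0, fun t => ?_⟩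
  simpa using e1 t

end StandardRepresentationOfState

/-- **Tomita–Takesaki theorem.** If `ω` is a faithful normal state on a von Neumann
algebra `A`, there exists a unique one-parameter group of *-automorphisms
`(σ_t)_{t ∈ ℝ}` of `A` — satisfying `σ_{s+t} = σ_s ∘ σ_t`, `σ_0 = id`, and such that
`t ↦ φ(σ_t(a))` is continuous for every `a ∈ A` and every normal state `φ` — such that
`ω` is a `(σ, 1)`-KMS state on `A`. -/
theorem tomita_takesaki (A : VonNeumannAlgebra H)
    (ω : ↥A.toStarSubalgebra →ₗ[ℂ] ℂ)
    (hstate : IsStateOn A ω) (hfaithful : IsFaithfulState A ω)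
    (hnormal : IsNormalState A ω) :
    ∃! σ : ℝ → (↥A.toStarSubalgebra →⋆ₐ[ℂ] ↥A.toStarSubalgebra),
      IsOneParamAutGroup A σ ∧
      (∀ a : ↥A.toStarSubalgebra, ∀ φ : ↥A.toStarSubalgebra →ₗ[ℂ] ℂ,
        IsStateOn A φ → IsNormalState A φ → Continuous fun t : ℝ => φ (σ t a)) ∧
      IsKMSState A ω σ 1 := by
  obtain ⟨ι, ζ, h⟩ := exists_isStandardRep hstate hfaithful hnormal
  refine ⟨h.modAut, ⟨⟨h.modAut_zero, h.modAut_add⟩, fun a φ _ hφ => ?_, fun a b => ?_⟩, ?_⟩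
  · exact hφ.continuous_apply (fun t => h.norm_modAut_le t a) (h.continuous_modAut_apply a)
  · obtain ⟨f, ⟨hb, hc, hd⟩, e0, e1⟩ := h.modAut_kms a b
    refine ⟨f, hb, hc, hd, e0, fun t => ?_⟩
    simpa using e1 t
  · rintro τ ⟨⟨h0, hadd⟩, -, hkms⟩
    exact h.eq_modAut h0 hadd hkms.exists_isStripFun

end
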